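/- Let N ≥ 2, α > 1, and let s ≥ 1 be an integer. For every loop U ∈ Lip_α(T → SU(N)) there exists a constant C (depending on α, s, N and U) and a sequence of SU(N)-valued polynomial loops U_n of degree ≤ n such that ‖U − U_n‖_C ≤ C (n+1)^{−2sα/(α+2s)} for all n ≥ 0. -/

import Mathlib

open scoped Real

attribute [local instance] Matrix.normedAddCommGroup Matrix.normedSpace

/-- Spectral norm (operator 2-norm) of a complex `N × N` matrix. -/
noncomputable def specNorm {N : ℕ} (A : Matrix (Fin N) (Fin N) ℂ) : ℝ :=
  ‖Matrix.toEuclideanCLM (𝕜 := ℂ) A‖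

/-- The special unitary group `SU(N)` as a set of matrices. -/
def SpecialUnitary (N : ℕ) : Set (Matrix (Fin N) (Fin N) ℂ) :=
  {A | A ∈ Matrix.unitaryGroup (Fin N) ℂ ∧ A.det = 1}

/-- The Lie algebra `su(N)`: skew-Hermitian traceless matrices. -/
def SkewTraceless (N : ℕ) : Set (Matrix (Fin N) (Fin N) ℂ) :=
  {A | A.conjTranspose = -A ∧ A.trace = 0}

/-- Uniform (sup) norm of a matrix-valued function, w.r.t. the spectral norm. -/
noncomputable def unifNorm {N : ℕ} (F : ℝ → Matrix (Fin N) (Fin N) ℂ) : ℝ :=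
  ⨆ t, specNorm (F t)

/-- `P` is a polynomial loop of degree `≤ n` with values in the set `G`:
`P t = ∑_{k=-n}^{n} e^{ikt} • C_k` with constant matrix coefficients, and `P t ∈ G`. -/
def IsPolyLoop {N : ℕ} (n : ℕ) (G : Set (Matrix (Fin N) (Fin N) ℂ))
    (P : ℝ → Matrix (Fin N) (Fin N) ℂ) : Prop :=
  (∃ c : ℤ → Matrix (Fin N) (Fin N) ℂ,
    ∀ t : ℝ, P t = ∑ k ∈ Finset.Icc (-(n : ℤ)) (n : ℤ),
      Complex.exp (k * t * Complex.I) • c k) ∧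
  ∀ t : ℝ, P t ∈ G

/-- For `α > 0`, the integer `r` in the decomposition `α = r + β`, `0 < β ≤ 1`. -/
noncomputable def lipR (α : ℝ) : ℕ := ⌈α⌉₊ - 1

/-- For `α > 0`, the exponent `β ∈ (0,1]` in the decomposition `α = r + β`. -/
noncomputable def lipβ (α : ℝ) : ℝ := α - lipR α

/-- Membership in the Lipschitz class `Lip_α`: `F` is `r` times continuously
differentiable and its `r`-th derivative is `β`-Hölder. -/
def MemLip {N : ℕ} (α : ℝ) (F : ℝ → Matrix (Fin N) (Fin N) ℂ) : Prop :=
  ContDiff ℝ (lipR α : ℕ∞) F ∧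
  ∃ C : ℝ, ∀ s t : ℝ,
    specNorm (iteratedDeriv (lipR α) F t - iteratedDeriv (lipR α) F s) ≤ C * |t - s| ^ lipβ α

/-- The `Lip_α` norm: the sup norm plus the smallest Hölder constant of the
`r`-th derivative. -/
noncomputable def lipNorm {N : ℕ} (α : ℝ) (F : ℝ → Matrix (Fin N) (Fin N) ℂ) : ℝ :=
  unifNorm F + sInf {C : ℝ | 0 ≤ C ∧ ∀ s t : ℝ,
    specNorm (iteratedDeriv (lipR α) F t - iteratedDeriv (lipR α) F s) ≤ C * |t - s| ^ lipβ α}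

namespace LoopApprox

/-- The character `t ↦ e^{ikt}` of the circle. -/
noncomputable def chr (k : ℤ) (t : ℝ) : ℂ := Complex.exp (k * t * Complex.I)

lemma chr_zero (t : ℝ) : chr 0 t = 1 := by simp [chr]

lemma chr_add (k l : ℤ) (t : ℝ) : chr (k + l) t = chr k t * chr l t := by
  simp only [chr, ← Complex.exp_add]
  congr 1
  push_cast
  ring

lemma star_chr (k : ℤ) (t : ℝ) : star (chr k t) = chr (-k) t := by
  simp only [chr, Complex.star_def, ← Complex.exp_conj]
  congr 1
  simp

lemma norm_chr (k : ℤ) (t : ℝ) : ‖chr k t‖ = 1 := by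
  have := Complex.norm_exp_ofReal_mul_I (k * t)
  simpa [chr] using this

lemma chr_neg_mul_chr (k : ℤ) (t : ℝ) : chr (-k) t * chr k t = 1 := by
  rw [← chr_add, neg_add_cancel, chr_zero]

lemma continuous_chr (k : ℤ) : Continuous (chr k) := by
  unfold chr
  fun_prop

lemma chr_periodic (k : ℤ) : Function.Periodic (chr k) (2 * π) := by
  intro t
  have h : (k : ℂ) * ((t + 2 * π : ℝ) : ℂ) * Complex.I
      = k * t * Complex.I + k * (2 * π * Complex.I) := by
    push_cast
    ring
  simp only [chr, h, Complex.exp_add, Complex.exp_int_mul_two_pi_mul_I, mul_one]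

/-- `f` is an absolutely convergent trigonometric series with coefficient sum at most `δ`. -/
def WienerLE (δ : ℝ) (f : ℝ → ℂ) : Prop :=
  ∃ (ι : Type) (_ : Countable ι) (m : ι → ℤ) (a : ι → ℂ), Summable (fun i => ‖a i‖) ∧
    ∑' i, ‖a i‖ ≤ δ ∧
    ∀ t, f t = ∑' i, a i * chr (m i) t

lemma summable_mul_chr {ι : Type*} {m : ι → ℤ} {a : ι → ℂ} (h : Summable fun i => ‖a i‖) (t : ℝ) :
    Summable fun i => a i * chr (m i) t :=
  Summable.of_norm (by simpa [norm_chr] using h)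

namespace WienerLE

variable {f g : ℝ → ℂ} {δ ε : ℝ}

lemma nonneg (h : WienerLE δ f) : 0 ≤ δ := by
  obtain ⟨ι, hι, m, a, -, h2, -⟩ := h
  exact (tsum_nonneg fun _ => norm_nonneg _).trans h2

lemma mono (h : WienerLE δ f) (hδ : δ ≤ ε) : WienerLE ε f := by
  obtain ⟨ι, hι, m, a, h1, h2, h3⟩ := h
  exact ⟨ι, hι, m, a, h1, h2.trans hδ, h3⟩

lemma norm_le (h : WienerLE δ f) (t : ℝ) : ‖f t‖ ≤ δ := by
  obtain ⟨ι, hι, m, a, h1, h2, h3⟩ := h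
  rw [h3]
  refine (norm_tsum_le_tsum_norm (by simpa [norm_chr] using h1)).trans ?_
  simpa [norm_chr] using h2

lemma mul_chr (c : ℂ) (k : ℤ) : WienerLE ‖c‖ (fun t => c * chr k t) :=
  ⟨Unit, inferInstance, fun _ => k, fun _ => c, Summable.of_finite, by simp, by simp⟩

lemma const (c : ℂ) : WienerLE ‖c‖ (fun _ => c) := by
  simpa [chr_zero] using mul_chr c 0

lemma zero : WienerLE 0 (fun _ => 0) := by simpa using const 0

lemma add (hf : WienerLE δ f) (hg : WienerLE ε g) : WienerLE (δ + ε) (fun t => f t + g t) := by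
  obtain ⟨ι, hι, m, a, h1, h2, h3⟩ := hf
  obtain ⟨κ, hκ, n, b, k1, k2, k3⟩ := hg
  have hs : ∀ t, Summable fun i => a i * chr (m i) t := summable_mul_chr h1
  have ks : ∀ t, Summable fun i => b i * chr (n i) t := summable_mul_chr k1
  refine ⟨ι ⊕ κ, inferInstance, Sum.elim m n, Sum.elim a b, ?_, ?_, fun t => ?_⟩
  · exact (HasSum.sum (f := fun i => ‖Sum.elim a b i‖) h1.hasSum k1.hasSum).summable
  · rw [(HasSum.sum (f := fun i => ‖Sum.elim a b i‖) h1.hasSum k1.hasSum).tsum_eq]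
    exact add_le_add h2 k2
  · simp only [h3, k3]
    exact (HasSum.sum (f := fun i => Sum.elim a b i * chr (Sum.elim m n i) t)
      (hs t).hasSum (ks t).hasSum).tsum_eq.symm

lemma mul (hf : WienerLE δ f) (hg : WienerLE ε g) : WienerLE (δ * ε) (fun t => f t * g t) := by
  have hδ := hf.nonneg
  obtain ⟨ι, hι, m, a, h1, h2, h3⟩ := hf
  obtain ⟨κ, hκ, n, b, k1, k2, k3⟩ := hg
  refine ⟨ι × κ, inferInstance, fun p => m p.1 + n p.2, fun p => a p.1 * b p.2, ?_, ?_, fun t => ?_⟩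
  · simpa using h1.mul_of_nonneg k1 (fun _ => norm_nonneg _) (fun _ => norm_nonneg _)
  · have := tsum_mul_tsum_of_summable_norm (f := fun i => ‖a i‖) (g := fun i => ‖b i‖)
      (by simpa using h1) (by simpa using k1)
    simp only [norm_mul]
    rw [← this]
    exact mul_le_mul h2 k2 (tsum_nonneg fun _ => norm_nonneg _) hδ
  · simp only [h3, k3]
    rw [tsum_mul_tsum_of_summable_norm (by simpa [norm_chr] using h1)
      (by simpa [norm_chr] using k1)]
    refine tsum_congr fun p => ?_
    rw [chr_add]
    ring

lemma star (hf : WienerLE δ f) : WienerLE δ (fun t => star (f t)) := by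
  obtain ⟨ι, hι, m, a, h1, h2, h3⟩ := hf
  refine ⟨ι, hι, fun i => -m i, fun i => Star.star (a i), by simpa using h1, by simpa using h2,
    fun t => ?_⟩
  simp only [h3, tsum_star]
  exact tsum_congr fun i => by rw [star_mul', star_chr]

lemma const_mul (c : ℂ) (hf : WienerLE δ f) : WienerLE (‖c‖ * δ) (fun t => c * f t) :=
  (const c).mul hf

lemma neg (hf : WienerLE δ f) : WienerLE δ (fun t => - f t) := by
  simpa using hf.const_mul (-1)

lemma sub (hf : WienerLE δ f) (hg : WienerLE ε g) : WienerLE (δ + ε) (fun t => f t - g t) := by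
  simpa [sub_eq_add_neg] using hf.add hg.neg

lemma sum {ι : Type*} (s : Finset ι) {f : ι → ℝ → ℂ} {δ : ι → ℝ}
    (h : ∀ i ∈ s, WienerLE (δ i) (f i)) : WienerLE (∑ i ∈ s, δ i) (fun t => ∑ i ∈ s, f i t) := by
  classical
  induction s using Finset.induction_on with
  | empty => simpa using zero
  | insert i s hi ih =>
    simp only [Finset.sum_insert hi]
    exact (h i (by simp)).add (ih fun j hj => h j (by simp [hj]))

lemma prod {ι : Type*} (s : Finset ι) {f : ι → ℝ → ℂ} {δ : ι → ℝ}
    (h : ∀ i ∈ s, WienerLE (δ i) (f i)) : WienerLE (∏ i ∈ s, δ i) (fun t => ∏ i ∈ s, f i t) := by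
  classical
  induction s using Finset.induction_on with
  | empty => simpa using const 1
  | insert i s hi ih =>
    simp only [Finset.prod_insert hi]
    exact (h i (by simp)).mul (ih fun j hj => h j (by simp [hj]))

lemma hasSum {f : ℕ → ℝ → ℂ} {δ : ℕ → ℝ} {g : ℝ → ℂ} (h : ∀ i, WienerLE (δ i) (f i))
    (hδ : Summable δ) (hg : ∀ t, HasSum (fun i => f i t) (g t)) : WienerLE (∑' i, δ i) g := by
  choose ι hι m a h1 h2 h3 using h
  have hs : Summable fun p : Σ i, ι i => ‖a p.1 p.2‖ := by
    rw [summable_sigma_of_nonneg fun _ => norm_nonneg _]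
    exact ⟨h1, Summable.of_nonneg_of_le (fun _ => tsum_nonneg fun _ => norm_nonneg _) h2 hδ⟩
  refine ⟨Σ i, ι i, inferInstance, fun p => m p.1 p.2, fun p => a p.1 p.2, hs, ?_, fun t => ?_⟩
  · rw [Summable.tsum_sigma' (f := fun p : Σ i, ι i => ‖a p.1 p.2‖) h1 hs]
    exact (((summable_sigma_of_nonneg fun _ => norm_nonneg _).1 hs).2).tsum_le_tsum h2 hδ
  · have hs' : Summable fun p : Σ i, ι i => a p.1 p.2 * chr (m p.1 p.2) t := summable_mul_chr hs t
    rw [Summable.tsum_sigma' (fun i => summable_mul_chr (h1 i) t) hs', ← (hg t).tsum_eq]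
    exact tsum_congr fun i => h3 i t

lemma congr (hf : WienerLE δ f) (h : ∀ t, f t = g t) : WienerLE δ g := by
  rwa [← funext h]

end WienerLE

/-- Trigonometric polynomials of degree at most `D`. -/
noncomputable def trigPoly (D : ℕ) : Submodule ℂ (ℝ → ℂ) :=
  Submodule.span ℂ (chr '' (Finset.Icc (-(D : ℤ)) D : Finset ℤ))

lemma chr_mem {D : ℕ} {k : ℤ} (h : |k| ≤ D) : chr k ∈ trigPoly D :=
  Submodule.subset_span ⟨k, by simpa [abs_le] using h, rfl⟩

lemma trigPoly_mono {D E : ℕ} (h : D ≤ E) : trigPoly D ≤ trigPoly E := by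
  refine Submodule.span_mono (Set.image_mono ?_)
  intro k
  simp only [Finset.coe_Icc, Set.mem_Icc]
  lia

lemma mul_mem_trigPoly {D E : ℕ} {f g : ℝ → ℂ} (hf : f ∈ trigPoly D) (hg : g ∈ trigPoly E) :
    f * g ∈ trigPoly (D + E) := by
  refine Submodule.span_induction₂ (p := fun f g _ _ => f * g ∈ trigPoly (D + E))
    ?_ ?_ ?_ ?_ ?_ ?_ ?_ hf hg
  · rintro _ _ ⟨k, hk, rfl⟩ ⟨l, hl, rfl⟩
    have : chr k * chr l = chr (k + l) := funext fun t => (chr_add k l t).symm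
    rw [this]
    simp only [Finset.coe_Icc, Set.mem_Icc] at hk hl
    exact chr_mem (by rw [abs_le]; push_cast; lia)
  · simp
  · simp
  · intro x y z _ _ _ hx hy
    simpa [add_mul] using add_mem hx hy
  · intro x y z _ _ _ hx hy
    simpa [mul_add] using add_mem hx hy
  · intro c x y _ _ h
    simpa using Submodule.smul_mem _ c h
  · intro c x y _ _ h
    simpa using Submodule.smul_mem _ c h

lemma star_mem_trigPoly {D : ℕ} {f : ℝ → ℂ} (hf : f ∈ trigPoly D) : star f ∈ trigPoly D := by
  refine Submodule.span_induction (p := fun f _ => star f ∈ trigPoly D) ?_ ?_ ?_ ?_ hf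
  · rintro _ ⟨k, hk, rfl⟩
    have : star (chr k) = chr (-k) := funext fun t => star_chr k t
    rw [this]
    simp only [Finset.coe_Icc, Set.mem_Icc] at hk
    exact chr_mem (by rw [abs_le]; lia)
  · simp
  · intro x y _ _ hx hy
    simpa using add_mem hx hy
  · intro c x _ h
    simpa using Submodule.smul_mem _ (star c) h

lemma const_mem_trigPoly (D : ℕ) (c : ℂ) : (fun _ => c) ∈ trigPoly D := by
  have : (fun _ => c : ℝ → ℂ) = c • chr 0 := by
    ext t
    simp [chr_zero]
  rw [this]
  exact Submodule.smul_mem _ _ (chr_mem (by simp))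

lemma mem_trigPoly_iff {D : ℕ} {f : ℝ → ℂ} : f ∈ trigPoly D ↔
    ∃ c : ℤ → ℂ, ∀ t, f t = ∑ k ∈ Finset.Icc (-(D : ℤ)) D, c k * chr k t := by
  rw [trigPoly, Submodule.mem_span_image_finset_iff_exists_fun']
  refine exists_congr fun c => ?_
  constructor
  · rintro rfl t
    simp
  · intro h
    ext t
    simp [h]

lemma prod_mem_trigPoly {ι : Type*} (s : Finset ι) {D : ℕ} {f : ι → ℝ → ℂ}
    (h : ∀ i ∈ s, f i ∈ trigPoly D) : ∏ i ∈ s, f i ∈ trigPoly (s.card * D) := by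
  classical
  induction s using Finset.induction_on with
  | empty => exact trigPoly_mono (by simp) (const_mem_trigPoly 0 1)
  | insert i s hi ih =>
    rw [Finset.prod_insert hi, Finset.card_insert_of_notMem hi, add_mul, one_mul, add_comm]
    exact mul_mem_trigPoly (h i (by simp)) (ih fun j hj => h j (by simp [hj]))

lemma trigPoly_continuous {D : ℕ} {f : ℝ → ℂ} (hf : f ∈ trigPoly D) : Continuous f := by
  obtain ⟨c, hc⟩ := mem_trigPoly_iff.1 hf
  rw [funext hc]
  exact continuous_finsetSum _ fun k _ => continuous_const.mul (continuous_chr k)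

end LoopApprox

namespace LoopApprox

lemma integral_chr (k : ℤ) : ∫ t in (-π)..π, chr k t = if k = 0 then (2 * π : ℂ) else 0 := by
  split_ifs with h
  · subst h
    simp only [chr_zero, intervalIntegral.integral_const]
    simp
    ring
  · have hc : (k : ℂ) * Complex.I ≠ 0 := mul_ne_zero (by exact_mod_cast h) Complex.I_ne_zero
    have h1 : ∀ t : ℝ, chr k t = Complex.exp (k * Complex.I * t) := fun t => by
      rw [chr]
      congr 1
      ring
    have h2 : chr k (-π) = chr k π := by
      have := chr_periodic k (-π)
      rw [← this]
      congr 1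
      ring
    simp only [h1] at h2
    simp only [h1]
    rw [integral_exp_mul_complex hc, ← h2]
    simp

lemma integral_sum_mul_chr {ι : Type*} [Countable ι] {m : ι → ℤ} {a : ι → ℂ}
    (h : Summable fun i => ‖a i‖) (k : ℤ) :
    ∫ t in (-π)..π, (∑' i, a i * chr (m i) t) * chr (-k) t =
      2 * π * ∑' i, if m i = k then a i else 0 := by
  have h1 : ∀ t, (∑' i, a i * chr (m i) t) * chr (-k) t = ∑' i, a i * chr (m i - k) t := by
    intro t
    rw [← tsum_mul_right]
    exact tsum_congr fun i => by rw [sub_eq_add_neg, chr_add, mul_assoc]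
  simp only [h1]
  have h2 := intervalIntegral.hasSum_intervalIntegral_of_summable_norm (a := -π) (b := π)
    (f := fun i => (⟨fun t => a i * chr (m i - k) t,
      continuous_const.mul (continuous_chr _)⟩ : C(ℝ, ℂ))) (by
      refine Summable.of_nonneg_of_le (fun _ => norm_nonneg _) (fun i => ?_) h
      rw [ContinuousMap.norm_le _ (norm_nonneg _)]
      intro x
      simp [norm_chr])
  simp only [ContinuousMap.coe_mk] at h2
  rw [← h2.tsum_eq, ← tsum_mul_left]
  refine tsum_congr fun i => ?_
  rw [intervalIntegral.integral_const_mul, integral_chr]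
  simp only [sub_eq_zero]
  split_ifs
  · ring
  · simp

/-- For a trigonometric polynomial the bound on an absolutely convergent expansion transfers to
its coefficients. -/
lemma WienerLE.exists_coeff {D : ℕ} {f : ℝ → ℂ} {δ : ℝ} (hf : f ∈ trigPoly D) (h : WienerLE δ f) :
    ∃ c : ℤ → ℂ, (∀ t, f t = ∑ k ∈ Finset.Icc (-(D : ℤ)) D, c k * chr k t) ∧
      ∑ k ∈ Finset.Icc (-(D : ℤ)) D, ‖c k‖ ≤ δ := by
  obtain ⟨c, hc⟩ := mem_trigPoly_iff.1 hf
  obtain ⟨ι, hι, m, a, h1, h2, h3⟩ := h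
  refine ⟨c, hc, le_trans ?_ h2⟩
  have hπ : (2 * π : ℂ) ≠ 0 := by exact_mod_cast Real.two_pi_pos.ne'
  have key : ∀ k ∈ Finset.Icc (-(D : ℤ)) D, c k = ∑' i, if m i = k then a i else 0 := by
    intro k hk
    have e1 := integral_sum_mul_chr (m := m) h1 k
    have e2 := integral_sum_mul_chr (ι := Finset.Icc (-(D : ℤ)) D) (m := fun k => k)
      (a := fun k => c k) Summable.of_finite k
    have e3 : ∀ t, (∑' i, a i * chr (m i) t)
        = ∑' i : Finset.Icc (-(D : ℤ)) D, c i * chr i t := by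
      intro t
      rw [← h3, hc, tsum_fintype, Finset.sum_coe_sort _ (fun k => c k * chr k t)]
    simp only [e3] at e1
    rw [e2] at e1
    have := mul_left_cancel₀ hπ e1
    rw [← this, tsum_fintype, Finset.sum_coe_sort _ (fun i => if i = k then c i else 0)]
    simp [Finset.mem_Icc.1 hk]
  have hs : ∀ k : ℤ, Summable fun i => if m i = k then ‖a i‖ else 0 := fun k =>
    Summable.of_nonneg_of_le (fun i => by split_ifs <;> simp) (fun i => by split_ifs <;> simp) h1
  have hk : ∀ k ∈ Finset.Icc (-(D : ℤ)) D, ‖c k‖ ≤ ∑' i, if m i = k then ‖a i‖ else 0 := by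
    intro k hk
    rw [key k hk]
    have e : ∀ i, ‖(if m i = k then a i else 0)‖ = if m i = k then ‖a i‖ else 0 := fun i => by
      split_ifs <;> simp
    refine (norm_tsum_le_tsum_norm ?_).trans (le_of_eq (tsum_congr e))
    simpa only [e] using hs k
  refine (Finset.sum_le_sum hk).trans ?_
  rw [← Summable.tsum_finsetSum fun k _ => hs k]
  refine (summable_sum fun k _ => hs k).tsum_le_tsum (fun i => ?_) h1
  rw [Finset.sum_ite_eq]
  split_ifs <;> simp

lemma integral_normSq_sum (s : Finset ℤ) (c : ℤ → ℂ) :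
    ∫ t in (-π)..π, ‖∑ k ∈ s, c k * chr k t‖ ^ 2 = 2 * π * ∑ k ∈ s, ‖c k‖ ^ 2 := by
  have h1 : ∀ t, ((‖∑ k ∈ s, c k * chr k t‖ ^ 2 : ℝ) : ℂ)
      = ∑ k ∈ s, ∑ l ∈ s, c k * star (c l) * chr (k - l) t := by
    intro t
    have : ((‖∑ k ∈ s, c k * chr k t‖ ^ 2 : ℝ) : ℂ)
        = (∑ k ∈ s, c k * chr k t) * star (∑ k ∈ s, c k * chr k t) := by
      rw [Complex.star_def, Complex.mul_conj, Complex.normSq_eq_norm_sq]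
    rw [this, star_sum, Finset.sum_mul_sum]
    refine Finset.sum_congr rfl fun k _ => Finset.sum_congr rfl fun l _ => ?_
    rw [star_mul', star_chr, sub_eq_add_neg, chr_add]
    ring
  have h2 : ((∫ t in (-π)..π, ‖∑ k ∈ s, c k * chr k t‖ ^ 2 : ℝ) : ℂ)
      = ((2 * π * ∑ k ∈ s, ‖c k‖ ^ 2 : ℝ) : ℂ) := by
    rw [← intervalIntegral.integral_ofReal]
    simp only [h1]
    rw [intervalIntegral.integral_finsetSum]
    swap
    · intro k _
      exact Continuous.intervalIntegrable (continuous_finsetSum _ fun l _ =>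
        continuous_const.mul (continuous_chr _)) _ _
    push_cast
    rw [Finset.mul_sum]
    refine Finset.sum_congr rfl fun k hk => ?_
    rw [intervalIntegral.integral_finsetSum]
    swap
    · intro l _
      exact Continuous.intervalIntegrable (continuous_const.mul (continuous_chr _)) _ _
    simp only [intervalIntegral.integral_const_mul, integral_chr, sub_eq_zero]
    simp only [mul_ite, mul_zero, Finset.sum_ite_eq, hk, if_true]
    rw [Complex.star_def, Complex.mul_conj, Complex.normSq_eq_norm_sq]
    push_cast
    ring
  exact_mod_cast h2

lemma wienerLE_sum (s : Finset ℤ) (c : ℤ → ℂ) :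
    WienerLE (∑ k ∈ s, ‖c k‖) (fun t => ∑ k ∈ s, c k * chr k t) :=
  WienerLE.sum s fun k _ => WienerLE.mul_chr (c k) k

lemma wienerLE_of_norm_le {D : ℕ} {f : ℝ → ℂ} {η : ℝ} (hf : f ∈ trigPoly D)
    (h : ∀ t, ‖f t‖ ≤ η) : WienerLE (√(2 * D + 1) * η) f := by
  have hη : 0 ≤ η := (norm_nonneg _).trans (h 0)
  obtain ⟨c, hc⟩ := mem_trigPoly_iff.1 hf
  have h1 := integral_normSq_sum (Finset.Icc (-(D : ℤ)) D) c
  have h2 : ∫ t in (-π)..π, ‖∑ k ∈ Finset.Icc (-(D : ℤ)) D, c k * chr k t‖ ^ 2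
      ≤ ∫ t in (-π)..π, η ^ 2 := by
    refine intervalIntegral.integral_mono_on (by linarith [Real.pi_pos]) ?_ (by simp) ?_
    · refine Continuous.intervalIntegrable ?_ _ _
      simp only [← hc]
      exact (trigPoly_continuous hf).norm.pow 2
    · intro t _
      rw [← hc]
      have := h t
      gcongr
  rw [h1] at h2
  simp only [intervalIntegral.integral_const, smul_eq_mul] at h2
  have h3 : ∑ k ∈ Finset.Icc (-(D : ℤ)) D, ‖c k‖ ^ 2 ≤ η ^ 2 := by
    have := Real.two_pi_pos
    nlinarith
  refine ((wienerLE_sum _ c).congr fun t => (hc t).symm).mono ?_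
  have h4 := sq_sum_le_card_mul_sum_sq (s := Finset.Icc (-(D : ℤ)) D) (f := fun k => ‖c k‖)
  have hcard : ((Finset.Icc (-(D : ℤ)) D).card : ℝ) = 2 * D + 1 := by
    rw [Int.card_Icc]
    have : ((D : ℤ) + 1 - -(D : ℤ)).toNat = 2 * D + 1 := by lia
    rw [this]
    push_cast
    ring
  rw [hcard] at h4
  refine le_of_sq_le_sq ?_ (by positivity)
  rw [mul_pow, Real.sq_sqrt (by positivity)]
  exact h4.trans (by gcongr)

/-- Truncation: a function with absolutely convergent expansion is approximated by trigonometric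
polynomials. -/
lemma WienerLE.exists_trigPoly {f : ℝ → ℂ} {δ : ℝ} (h : WienerLE δ f) {ε : ℝ} (hε : 0 < ε) :
    ∃ D, ∃ p ∈ trigPoly D, WienerLE ε (fun t => p t - f t) := by
  classical
  obtain ⟨ι, hι, m, a, h1, h2, h3⟩ := h
  obtain ⟨s, hs⟩ := (((tendsto_order.1 (tendsto_tsum_compl_atTop_zero fun i => ‖a i‖)).2 ε
    hε).exists)
  refine ⟨s.sup fun i => (m i).natAbs, ∑ i ∈ s, a i • chr (m i), ?_, WienerLE.congr
    (f := fun t => - ∑' i : {i // i ∉ s}, a i * chr (m i) t) (WienerLE.neg ?_) ?_⟩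
  · refine Submodule.sum_mem _ fun i hi => Submodule.smul_mem _ _ (chr_mem ?_)
    have := Finset.le_sup (f := fun i => (m i).natAbs) hi
    rw [Int.abs_eq_natAbs]
    exact_mod_cast this
  · exact ⟨{i // i ∉ s}, inferInstance, fun i => m i, fun i => a i, h1.subtype _, hs.le,
      fun t => rfl⟩
  · intro t
    rw [h3, ← (summable_mul_chr h1 t).sum_add_tsum_subtype_compl s]
    simp
end LoopApprox

namespace LoopApprox

open Matrix

/-- Entrywise version of `WienerLE`. -/
def MWienerLE {m n : ℕ} (δ : ℝ) (F : ℝ → Matrix (Fin m) (Fin n) ℂ) : Prop :=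
  ∀ i j, WienerLE δ (fun t => F t i j)

namespace MWienerLE

variable {m n p : ℕ} {δ ε : ℝ} {F : ℝ → Matrix (Fin m) (Fin n) ℂ}

lemma mono (h : MWienerLE δ F) (hδ : δ ≤ ε) : MWienerLE ε F := fun i j => (h i j).mono hδ

lemma congr {G : ℝ → Matrix (Fin m) (Fin n) ℂ} (h : MWienerLE δ F) (hG : ∀ t, F t = G t) :
    MWienerLE δ G := by
  rwa [← funext hG]

lemma const (A : Matrix (Fin m) (Fin n) ℂ) (h : ∀ i j, ‖A i j‖ ≤ δ) : MWienerLE δ (fun _ => A) :=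
  fun i j => (WienerLE.const _).mono (h i j)

lemma add {G : ℝ → Matrix (Fin m) (Fin n) ℂ} (hF : MWienerLE δ F) (hG : MWienerLE ε G) :
    MWienerLE (δ + ε) (fun t => F t + G t) := fun i j => (hF i j).add (hG i j)

lemma sub {G : ℝ → Matrix (Fin m) (Fin n) ℂ} (hF : MWienerLE δ F) (hG : MWienerLE ε G) :
    MWienerLE (δ + ε) (fun t => F t - G t) := fun i j => (hF i j).sub (hG i j)

lemma mul {G : ℝ → Matrix (Fin n) (Fin p) ℂ} (hF : MWienerLE δ F) (hG : MWienerLE ε G) :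
    MWienerLE (n * (δ * ε)) (fun t => F t * G t) := fun i j => by
  simp only [Matrix.mul_apply]
  refine (WienerLE.sum Finset.univ fun k _ => (hF i k).mul (hG k j)).mono ?_
  simp

lemma conjTranspose (hF : MWienerLE δ F) : MWienerLE δ (fun t => (F t)ᴴ) :=
  fun i j => (hF j i).star

lemma sum {ι : Type*} (s : Finset ι) {F : ι → ℝ → Matrix (Fin m) (Fin n) ℂ} {δ : ι → ℝ}
    (h : ∀ i ∈ s, MWienerLE (δ i) (F i)) :
    MWienerLE (∑ i ∈ s, δ i) (fun t => ∑ i ∈ s, F i t) := fun i j => by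
  simp only [Matrix.sum_apply]
  exact WienerLE.sum s fun k hk => h k hk i j

lemma one (n : ℕ) : MWienerLE 1 (fun _ => (1 : Matrix (Fin n) (Fin n) ℂ)) :=
  const _ fun i j => by
    rw [Matrix.one_apply]
    split_ifs <;> simp

lemma smul_one {f : ℝ → ℂ} (h : WienerLE δ f) (n : ℕ) :
    MWienerLE δ (fun t => f t • (1 : Matrix (Fin n) (Fin n) ℂ)) := fun i j => by
  refine (h.mul (one n i j)).mono (by simp) |>.congr fun t => by simp

lemma const_smul (c : ℂ) (hF : MWienerLE δ F) : MWienerLE (‖c‖ * δ) (fun t => c • F t) :=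
  fun i j => (hF i j).const_mul c

lemma trace {G : ℝ → Matrix (Fin n) (Fin n) ℂ} (hG : MWienerLE δ G) :
    WienerLE (n * δ) (fun t => (G t).trace) := by
  refine (WienerLE.sum Finset.univ fun k _ => hG k k).mono ?_
  simp

end MWienerLE

/-- Entrywise trigonometric polynomials. -/
def MTrigPoly {m n : ℕ} (D : ℕ) (F : ℝ → Matrix (Fin m) (Fin n) ℂ) : Prop :=
  ∀ i j, (fun t => F t i j) ∈ trigPoly D

namespace MTrigPoly

variable {m n p D E : ℕ} {F : ℝ → Matrix (Fin m) (Fin n) ℂ}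

lemma mono (h : MTrigPoly D F) (hD : D ≤ E) : MTrigPoly E F :=
  fun i j => trigPoly_mono hD (h i j)

lemma congr {G : ℝ → Matrix (Fin m) (Fin n) ℂ} (h : MTrigPoly D F) (hG : ∀ t, F t = G t) :
    MTrigPoly D G := by
  rwa [← funext hG]

lemma const (D : ℕ) (A : Matrix (Fin m) (Fin n) ℂ) : MTrigPoly D (fun _ => A) :=
  fun _ _ => const_mem_trigPoly _ _

lemma add {G : ℝ → Matrix (Fin m) (Fin n) ℂ} (hF : MTrigPoly D F) (hG : MTrigPoly D G) :
    MTrigPoly D (fun t => F t + G t) := fun i j => add_mem (hF i j) (hG i j)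

lemma sub {G : ℝ → Matrix (Fin m) (Fin n) ℂ} (hF : MTrigPoly D F) (hG : MTrigPoly D G) :
    MTrigPoly D (fun t => F t - G t) := fun i j => sub_mem (hF i j) (hG i j)

lemma mul {G : ℝ → Matrix (Fin n) (Fin p) ℂ} (hF : MTrigPoly D F) (hG : MTrigPoly E G) :
    MTrigPoly (D + E) (fun t => F t * G t) := fun i j => by
  have : (fun t => (F t * G t) i j) = ∑ k, (fun t => F t i k) * (fun t => G t k j) := by
    ext t
    simp [Matrix.mul_apply]
  rw [this]
  exact Submodule.sum_mem _ fun k _ => mul_mem_trigPoly (hF i k) (hG k j)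

lemma conjTranspose (hF : MTrigPoly D F) : MTrigPoly D (fun t => (F t)ᴴ) :=
  fun i j => star_mem_trigPoly (hF j i)

lemma det {G : ℝ → Matrix (Fin n) (Fin n) ℂ} (hG : MTrigPoly D G) :
    (fun t => (G t).det) ∈ trigPoly (n * D) := by
  have : (fun t => (G t).det) = ∑ σ : Equiv.Perm (Fin n),
      (((Equiv.Perm.sign σ : ℤ) : ℂ)) • ∏ i, fun t => G t (σ i) i := by
    ext t
    simp [Matrix.det_apply']
  rw [this]
  refine Submodule.sum_mem _ fun σ _ => Submodule.smul_mem _ _ ?_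
  simpa using prod_mem_trigPoly Finset.univ fun i _ => hG (σ i) i

end MTrigPoly

lemma wienerLE_prod_one_add_sub {ι : Type*} (s : Finset ι) :
    ∃ C : ℝ, 0 ≤ C ∧ ∀ (δ : ℝ) (f : ι → ℝ → ℂ), δ ≤ 1 → (∀ i ∈ s, WienerLE δ (f i)) →
      WienerLE (C * δ ^ 2) (fun t => ∏ i ∈ s, (1 + f i t) - 1 - ∑ i ∈ s, f i t) := by
  classical
  induction s using Finset.induction_on with
  | empty => exact ⟨0, le_rfl, fun δ f _ _ => by simpa using WienerLE.zero⟩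
  | insert i s hi ih =>
    obtain ⟨C, hC, h⟩ := ih
    refine ⟨2 * C + s.card, by positivity, fun δ f hδ hf => ?_⟩
    have h1 := h δ f hδ fun j hj => hf j (by simp [hj])
    have h2 := hf i (by simp)
    have h3 : WienerLE (1 + δ) (fun t => 1 + f i t) := by
      simpa using (WienerLE.const 1).add h2
    have h4 := WienerLE.sum s (f := f) fun j hj => hf j (by simp [hj])
    refine (((h1.mul h3).add (h4.mul h2)).congr fun t => ?_).mono ?_
    · rw [Finset.prod_insert hi, Finset.sum_insert hi]
      ring
    · have := h2.nonneg
      simp only [Finset.sum_const, nsmul_eq_mul]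
      have : C * δ ^ 2 * (1 + δ) ≤ C * δ ^ 2 * 2 := by gcongr; linarith
      linarith

lemma wienerLE_det_one_add_sub (N : ℕ) :
    ∃ C : ℝ, 0 ≤ C ∧ ∀ (δ : ℝ) (E : ℝ → Matrix (Fin N) (Fin N) ℂ), δ ≤ 1 → MWienerLE δ E →
      WienerLE (C * δ ^ 2) (fun t => (1 + E t).det - 1 - (E t).trace) := by
  obtain ⟨C, hC, h⟩ := wienerLE_prod_one_add_sub (Finset.univ : Finset (Fin N))
  refine ⟨C + ∑ σ ∈ (Finset.univ : Finset (Equiv.Perm (Fin N))).erase 1, 2 ^ N, by positivity,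
    fun δ E hδ hE => ?_⟩
  have h1 := h δ (fun i t => E t i i) hδ fun i _ => hE i i
  have h2 : ∀ σ ∈ (Finset.univ : Finset (Equiv.Perm (Fin N))).erase 1,
      WienerLE (2 ^ N * δ ^ 2)
        (fun t => ((Equiv.Perm.sign σ : ℤ) : ℂ) * ∏ i, (1 + E t) (σ i) i) := by
    intro σ hσ
    have hσ1 : σ ≠ 1 := (Finset.mem_erase.1 hσ).1
    obtain ⟨i, hi⟩ : ∃ i, σ i ≠ i := by
      by_contra! hcon
      exact hσ1 (Equiv.ext hcon)
    have hj : σ (σ i) ≠ σ i := fun hcon => hi (σ.injective hcon)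
    have hδ0 : 0 ≤ δ := (hE i i).nonneg
    have hp := WienerLE.prod Finset.univ (f := fun k t => (1 + E t) (σ k) k)
      (δ := fun k => if σ k = k then 2 else δ) (fun k _ => by
        split_ifs with hk
        · have := (MWienerLE.one N (σ k) k).add (hE (σ k) k)
          exact this.mono (by linarith)
        · exact (hE (σ k) k).congr fun t => by simp [hk])
    refine ((hp.const_mul _).mono ?_)
    have hs : ‖((Equiv.Perm.sign σ : ℤ) : ℂ)‖ = 1 := by
      rcases Int.units_eq_one_or (Equiv.Perm.sign σ) with hh | hh <;> simp [hh]
    rw [hs, one_mul, ← Finset.mul_prod_erase _ _ (Finset.mem_univ i),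
      ← Finset.mul_prod_erase (Finset.univ.erase i) _
        (Finset.mem_erase.2 ⟨hi, Finset.mem_univ (σ i)⟩), if_neg hi, if_neg hj]
    have hr : ∏ k ∈ (Finset.univ.erase i).erase (σ i), (if σ k = k then (2 : ℝ) else δ)
        ≤ 2 ^ N := by
      refine (Finset.prod_le_prod (fun k _ => by split_ifs <;> linarith)
        (fun k _ => (by split_ifs <;> linarith : (if σ k = k then (2 : ℝ) else δ) ≤ 2))).trans ?_
      rw [Finset.prod_const]
      refine pow_le_pow_right₀ (by norm_num) ?_
      exact (Finset.card_le_univ _).trans (by simp)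
    calc _ = δ ^ 2 * ∏ k ∈ (Finset.univ.erase i).erase (σ i), (if σ k = k then (2 : ℝ) else δ) := by
          ring
      _ ≤ δ ^ 2 * 2 ^ N := by gcongr
      _ = _ := by ring
  have h3 := WienerLE.sum _ h2
  refine ((h1.add h3).congr fun t => ?_).mono ?_
  · rw [Matrix.det_apply', ← Finset.add_sum_erase _ _ (Finset.mem_univ (1 : Equiv.Perm (Fin N)))]
    simp only [Equiv.Perm.sign_one, Units.val_one, Int.cast_one, one_mul, Equiv.Perm.one_apply,
      Matrix.add_apply, Matrix.one_apply_eq, Matrix.trace, Matrix.diag]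
    ring
  · rw [← Finset.sum_mul]
    linarith

section SpecialUnitary

variable {N : ℕ}

lemma specialUnitary_one : (1 : Matrix (Fin N) (Fin N) ℂ) ∈ SpecialUnitary N :=
  ⟨one_mem _, det_one⟩

lemma specialUnitary_mul {A B : Matrix (Fin N) (Fin N) ℂ} (hA : A ∈ SpecialUnitary N)
    (hB : B ∈ SpecialUnitary N) : A * B ∈ SpecialUnitary N :=
  ⟨mul_mem hA.1 hB.1, by rw [det_mul, hA.2, hB.2, one_mul]⟩

lemma specialUnitary_conjTranspose_mul {A : Matrix (Fin N) (Fin N) ℂ}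
    (hA : A ∈ SpecialUnitary N) : Aᴴ * A = 1 := Matrix.mem_unitaryGroup_iff'.1 hA.1

lemma specialUnitary_mul_conjTranspose {A : Matrix (Fin N) (Fin N) ℂ}
    (hA : A ∈ SpecialUnitary N) : A * Aᴴ = 1 := Matrix.mem_unitaryGroup_iff.1 hA.1

lemma mem_specialUnitary {A : Matrix (Fin N) (Fin N) ℂ} (h : A * Aᴴ = 1) (hd : A.det = 1) :
    A ∈ SpecialUnitary N := ⟨Matrix.mem_unitaryGroup_iff.2 h, hd⟩

lemma specialUnitary_norm_le {A : Matrix (Fin N) (Fin N) ℂ} (hA : A ∈ SpecialUnitary N)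
    (i j : Fin N) : ‖A i j‖ ≤ 1 := entry_norm_bound_of_unitary hA.1 i j

lemma su_two_mem {a b : ℂ} (h : ‖a‖ ^ 2 + ‖b‖ ^ 2 = 1) :
    !![a, b; -star b, star a] ∈ SpecialUnitary 2 := by
  have ha : a * star a = ((‖a‖ ^ 2 : ℝ) : ℂ) := by
    rw [Complex.star_def, Complex.mul_conj, Complex.normSq_eq_norm_sq]
  have hb : b * star b = ((‖b‖ ^ 2 : ℝ) : ℂ) := by
    rw [Complex.star_def, Complex.mul_conj, Complex.normSq_eq_norm_sq]
  have hab : a * star a + b * star b = 1 := by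
    rw [ha, hb]
    exact_mod_cast h
  refine mem_specialUnitary ?_ ?_
  · ext i j
    fin_cases i <;> fin_cases j <;>
      simp only [Matrix.mul_apply, Fin.sum_univ_two, Matrix.conjTranspose_apply] <;> simp
    · exact hab
    · ring
    · ring
    · simpa [add_comm, mul_comm] using hab
  · rw [Matrix.det_fin_two_of]
    linear_combination hab

/-- The action of a `2 × 2` matrix on the plane spanned by the orthonormal columns of `Z`. -/
def planeEmbed (Z : Matrix (Fin N) (Fin 2) ℂ) (M : Matrix (Fin 2) (Fin 2) ℂ) :
    Matrix (Fin N) (Fin N) ℂ := 1 + Z * (M - 1) * Zᴴ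

lemma planeEmbed_mem {Z : Matrix (Fin N) (Fin 2) ℂ} (hZ : Zᴴ * Z = 1)
    {M : Matrix (Fin 2) (Fin 2) ℂ} (hM : M ∈ SpecialUnitary 2) :
    planeEmbed Z M ∈ SpecialUnitary N := by
  have h := specialUnitary_mul_conjTranspose hM
  refine mem_specialUnitary ?_ ?_
  · have e : (planeEmbed Z M)ᴴ = 1 + Z * (Mᴴ - 1) * Zᴴ := by
      simp [planeEmbed, Matrix.mul_assoc]
    have e2 : Z * (M - 1) * Zᴴ * (Z * (Mᴴ - 1) * Zᴴ) = Z * ((M - 1) * (Mᴴ - 1)) * Zᴴ := by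
      calc _ = Z * (M - 1) * (Zᴴ * Z) * (Mᴴ - 1) * Zᴴ := by simp only [Matrix.mul_assoc]
        _ = _ := by rw [hZ]; simp only [Matrix.mul_assoc, Matrix.mul_one]
    have e3 : (M - 1) * (Mᴴ - 1) = -(M - 1) - (Mᴴ - 1) := by
      rw [sub_mul, mul_sub, h, mul_one, one_mul]
      abel
    rw [e, planeEmbed, add_mul, mul_add, mul_add, one_mul, mul_one, one_mul, e2, e3]
    simp only [Matrix.mul_sub, Matrix.mul_neg, Matrix.sub_mul, Matrix.neg_mul]
    abel
  · rw [planeEmbed, Matrix.mul_assoc, Matrix.det_one_add_mul_comm, Matrix.mul_assoc, hZ,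
      Matrix.mul_one, add_sub_cancel, hM.2]

/-- `V` is an `SU(N)`-valued loop with trigonometric polynomial entries of degree at most `D`. -/
def IsTrigLoop (D : ℕ) (V : ℝ → Matrix (Fin N) (Fin N) ℂ) : Prop :=
  (∀ t, V t ∈ SpecialUnitary N) ∧ MTrigPoly D V

lemma IsTrigLoop.mul {D E : ℕ} {V V' : ℝ → Matrix (Fin N) (Fin N) ℂ} (h : IsTrigLoop D V)
    (h' : IsTrigLoop E V') : IsTrigLoop (D + E) (fun t => V t * V' t) :=
  ⟨fun t => specialUnitary_mul (h.1 t) (h'.1 t), h.2.mul h'.2⟩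

lemma IsTrigLoop.mono {D E : ℕ} {V : ℝ → Matrix (Fin N) (Fin N) ℂ} (h : IsTrigLoop D V)
    (hD : D ≤ E) : IsTrigLoop E V := ⟨h.1, h.2.mono hD⟩

lemma isTrigLoop_one (D : ℕ) : IsTrigLoop D (fun _ => (1 : Matrix (Fin N) (Fin N) ℂ)) :=
  ⟨fun _ => specialUnitary_one, MTrigPoly.const _ _⟩

end SpecialUnitary

end LoopApprox

namespace LoopApprox

open Matrix

lemma MWienerLE.longProd {n : ℕ} (hn : 1 ≤ n) {h P : ℕ → ℝ → Matrix (Fin n) (Fin n) ℂ} {β : ℕ → ℝ}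
    (hβ : ∀ j, 0 ≤ β j) (hh : ∀ j, MWienerLE (β j) (h j)) (hP0 : ∀ t, P 0 t = 1)
    (hP : ∀ j t, P (j + 1) t = P j t * (1 + h j t)) (j : ℕ) :
    MWienerLE (Real.exp (n * ∑ i ∈ Finset.range j, β i) - 1 - n * ∑ i ∈ Finset.range j, β i)
      (fun t => P j t - 1 - ∑ i ∈ Finset.range j, h i t) := by
  have hn' : (1 : ℝ) ≤ n := by exact_mod_cast hn
  induction j with
  | zero =>
    have := MWienerLE.const (δ := 0) (0 : Matrix (Fin n) (Fin n) ℂ) (by simp)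
    simpa [hP0] using this
  | succ j ih =>
    have hs : 0 ≤ ∑ i ∈ Finset.range j, β i := Finset.sum_nonneg fun i _ => hβ i
    have h1 : MWienerLE (∑ i ∈ Finset.range j, β i) (fun t => ∑ i ∈ Finset.range j, h i t) :=
      MWienerLE.sum _ fun i _ => hh i
    have h2 := (ih.add ((ih.add h1).mul (hh j)))
    refine (h2.mono ?_).congr fun t => ?_
    · rw [Finset.sum_range_succ, mul_add, Real.exp_add]
      set S := ∑ i ∈ Finset.range j, β i
      have h3 := Real.add_one_le_exp (n * β j)
      have h4 := Real.exp_pos (n * S)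
      have h5 : (S : ℝ) * (n * β j) ≤ n * S * (n * β j) := by
        have : 0 ≤ n * β j := mul_nonneg (by linarith) (hβ j)
        gcongr
        nlinarith
      nlinarith [mul_le_mul_of_nonneg_left h3 h4.le]
    · rw [hP, Finset.sum_range_succ]
      noncomm_ring

/-- The elementary rotation with off-diagonal entries `b * z` and `-conj (b * z)`. -/
noncomputable def givens (b z : ℂ) : Matrix (Fin 2) (Fin 2) ℂ :=
  !![((√(1 - ‖b‖ ^ 2) : ℝ) : ℂ), b * z; -star (b * z), ((√(1 - ‖b‖ ^ 2) : ℝ) : ℂ)]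

lemma givens_mem {b z : ℂ} (hb : ‖b‖ ≤ 1) (hz : ‖z‖ = 1) : givens b z ∈ SpecialUnitary 2 := by
  have h : 0 ≤ 1 - ‖b‖ ^ 2 := by nlinarith [norm_nonneg b]
  have := su_two_mem (a := ((√(1 - ‖b‖ ^ 2) : ℝ) : ℂ)) (b := b * z) (by
    rw [norm_mul, hz, Complex.norm_real, Real.norm_eq_abs, sq_abs, Real.sq_sqrt h]
    ring)
  simpa [givens] using this

lemma abs_sqrt_one_sub_sq_sub_one_le {x : ℝ} (hx : 0 ≤ x) (hx1 : x ≤ 1) :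
    |√(1 - x ^ 2) - 1| ≤ x ^ 2 := by
  have h1 : 1 - x ^ 2 ≤ √(1 - x ^ 2) := by
    apply Real.le_sqrt_of_sq_le
    have : x ^ 2 ≤ 1 := by nlinarith
    nlinarith [sq_nonneg x]
  have h2 : √(1 - x ^ 2) ≤ 1 := by
    rw [Real.sqrt_le_one]
    nlinarith
  rw [abs_le]
  constructor <;> linarith

lemma MTrigPoly.diag_chr {D : ℕ} {k : ℤ} (h : |k| ≤ D) :
    MTrigPoly D (fun t => !![chr k t, 0; 0, 1]) := by
  intro i j
  fin_cases i <;> fin_cases j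
  · simpa using chr_mem h
  · simpa using const_mem_trigPoly D 0
  · simpa using const_mem_trigPoly D 0
  · simpa using const_mem_trigPoly D 1

lemma MTrigPoly.prod_givens (b : ℕ → ℂ) {D : ℕ} {P : ℕ → ℝ → Matrix (Fin 2) (Fin 2) ℂ}
    (hP0 : ∀ t, P 0 t = 1)
    (hP : ∀ j t, P (j + 1) t = P j t * givens (b j) (chr ((j : ℤ) - D) t)) (j : ℕ) :
    MTrigPoly (D + j) (fun t => P j t * !![chr ((j : ℤ) - D) t, 0; 0, 1]) := by
  induction j with
  | zero =>
    simp only [hP0, one_mul]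
    exact MTrigPoly.diag_chr (by simp)
  | succ j ih =>
    have h1 : MTrigPoly 1 (fun t => givens (b j) 1 * !![chr 1 t, 0; 0, 1]) :=
      ((MTrigPoly.const 0 _).mul (MTrigPoly.diag_chr (D := 1) (k := 1) (by simp))).mono (by simp)
    refine (ih.mul h1).congr fun t => ?_
    rw [hP, mul_assoc, mul_assoc]
    congr 1
    have e1 : chr (((j + 1 : ℕ) : ℤ) - D) t = chr ((j : ℤ) - D) t * chr 1 t := by
      rw [← chr_add]; congr 1; push_cast; ring
    have e2 : star (chr ((j : ℤ) - D) t) * chr ((j : ℤ) - D) t = 1 := by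
      rw [star_chr, chr_neg_mul_chr]
    rw [e1]
    generalize chr ((j : ℤ) - D) t = z at *
    ext i k
    fin_cases i <;> fin_cases k <;> simp [givens, Matrix.mul_apply]
    · ring
    · ring
    · simp only [Complex.star_def] at e2
      linear_combination -(starRingEnd ℂ (b j) * chr 1 t) * e2

lemma exists_trigLoop_two : ∃ C : ℝ, 0 ≤ C ∧ ∀ (D : ℕ) (b : ℤ → ℂ) (s : ℝ),
    ∑ k ∈ Finset.Icc (-(D : ℤ)) D, ‖b k‖ ≤ s → s ≤ 1 / 2 →
    ∃ G : ℝ → Matrix (Fin 2) (Fin 2) ℂ, IsTrigLoop (4 * D + 2) G ∧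
      MWienerLE (C * s ^ 2) (fun t => G t - 1 -
        !![0, ∑ k ∈ Finset.Icc (-(D : ℤ)) D, b k * chr k t;
          -star (∑ k ∈ Finset.Icc (-(D : ℤ)) D, b k * chr k t), 0]) := by
  refine ⟨5, by norm_num, fun D b s hb hs => ?_⟩
  have hreidx : ∀ {M : Type} [AddCommMonoid M] (f : ℤ → M),
      ∑ k ∈ Finset.Icc (-(D : ℤ)) D, f k = ∑ j ∈ Finset.range (2 * D + 1), f ((j : ℤ) - D) := by
    intro M _ f
    refine Finset.sum_nbij' (fun k => (k + D).toNat) (fun j => (j : ℤ) - D) ?_ ?_ ?_ ?_ ?_ <;>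
      intro k hk <;> simp only [Finset.mem_Icc, Finset.mem_range] at hk ⊢
    · omega
    · omega
    · omega
    · omega
    · congr 1; omega
  set b' : ℕ → ℂ := fun j => if j < 2 * D + 1 then b ((j : ℤ) - D) else 0 with hb'
  have hbb : ∀ j ∈ Finset.range (2 * D + 1), b' j = b ((j : ℤ) - D) := by
    intro j hj
    exact if_pos (Finset.mem_range.1 hj)
  have hsum : ∑ j ∈ Finset.range (2 * D + 1), ‖b' j‖ ≤ s := by
    rw [Finset.sum_congr rfl fun j hj => by rw [hbb j hj], ← hreidx fun k => ‖b k‖]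
    exact hb
  have hs0 : 0 ≤ s := (Finset.sum_nonneg fun _ _ => norm_nonneg _).trans hsum
  have hb1 : ∀ j, ‖b' j‖ ≤ 1 := by
    intro j
    by_cases hj : j < 2 * D + 1
    · have := Finset.single_le_sum (f := fun j => ‖b' j‖) (fun _ _ => norm_nonneg _)
        (Finset.mem_range.2 hj)
      exact this.trans (by linarith)
    · rw [hb']
      simp only [if_neg hj, norm_zero, zero_le_one]
  obtain ⟨P, hP0, hP⟩ : ∃ P : ℕ → ℝ → Matrix (Fin 2) (Fin 2) ℂ, (∀ t, P 0 t = 1) ∧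
      ∀ j t, P (j + 1) t = P j t * givens (b' j) (chr ((j : ℤ) - D) t) :=
    ⟨fun j t => Nat.rec 1 (fun j A => A * givens (b' j) (chr ((j : ℤ) - D) t)) j,
      fun t => rfl, fun j t => rfl⟩
  clear_value b'
  have hmem : ∀ j t, P j t ∈ SpecialUnitary 2 := by
    intro j t
    induction j with
    | zero => rw [hP0]; exact specialUnitary_one
    | succ j ih => rw [hP]; exact specialUnitary_mul ih (givens_mem (hb1 j) (norm_chr _ _))
  refine ⟨P (2 * D + 1), ⟨hmem _, ?_⟩, ?_⟩
  · have h1 := (MTrigPoly.prod_givens b' hP0 hP (2 * D + 1)).mul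
      (MTrigPoly.diag_chr (D := D + 1) (k := -(((2 * D + 1 : ℕ) : ℤ) - D)) (by
        rw [abs_le]; push_cast; constructor <;> linarith))
    refine (h1.mono (by omega)).congr fun t => ?_
    rw [mul_assoc]
    convert mul_one _
    have := chr_neg_mul_chr (((2 * D + 1 : ℕ) : ℤ) - D) t
    ext i k
    fin_cases i <;> fin_cases k <;> simp [Matrix.mul_apply]
    · rw [mul_comm]
      simpa using this
  · have hc : ∀ j, ‖((√(1 - ‖b' j‖ ^ 2) : ℝ) : ℂ) - 1‖ ≤ ‖b' j‖ ^ 2 := by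
      intro j
      rw [← Complex.ofReal_one, ← Complex.ofReal_sub, Complex.norm_real, Real.norm_eq_abs]
      exact abs_sqrt_one_sub_sq_sub_one_le (norm_nonneg _) (hb1 j)
    have hc' : ∀ j, ‖((√(1 - ‖b' j‖ ^ 2) : ℝ) : ℂ) - 1‖ ≤ ‖b' j‖ := fun j =>
      (hc j).trans (by nlinarith [norm_nonneg (b' j), hb1 j])
    have hW : ∀ j, MWienerLE ‖b' j‖ (fun t => givens (b' j) (chr ((j : ℤ) - D) t) - 1) := by
      intro j i k
      have h1 := (WienerLE.const (((√(1 - ‖b' j‖ ^ 2) : ℝ) : ℂ) - 1)).mono (hc' j)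
      have h2 := WienerLE.mul_chr (b' j) ((j : ℤ) - D)
      fin_cases i <;> fin_cases k
      · simpa [givens] using h1
      · simpa [givens] using h2
      · simpa [givens] using h2.star.neg
      · simpa [givens] using h1
    have h1 := MWienerLE.longProd (n := 2) (by norm_num) (fun j => norm_nonneg (b' j)) hW hP0
      (fun j t => by rw [hP, add_sub_cancel]) (2 * D + 1)
    have h2 : MWienerLE (s ^ 2) (fun _ : ℝ => (∑ j ∈ Finset.range (2 * D + 1),
        (((√(1 - ‖b' j‖ ^ 2) : ℝ) : ℂ) - 1)) • (1 : Matrix (Fin 2) (Fin 2) ℂ)) := by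
      refine MWienerLE.smul_one ((WienerLE.const _).mono ((norm_sum_le _ _).trans ?_)) 2
      refine (Finset.sum_le_sum fun j _ => hc j).trans ?_
      calc _ ≤ (∑ j ∈ Finset.range (2 * D + 1), ‖b' j‖) ^ 2 :=
            Finset.sum_sq_le_sq_sum_of_nonneg fun _ _ => norm_nonneg _
        _ ≤ s ^ 2 := by gcongr
    refine ((h1.add h2).mono ?_).congr fun t => ?_
    · set S := ∑ j ∈ Finset.range (2 * D + 1), ‖b' j‖
      have hS : 0 ≤ S := Finset.sum_nonneg fun _ _ => norm_nonneg _
      have := Real.abs_exp_sub_one_sub_id_le (x := (2 : ℕ) * S) (by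
        rw [abs_of_nonneg (by positivity)]; push_cast; linarith)
      rw [abs_le] at this
      push_cast at this ⊢
      nlinarith
    · have e : ∑ k ∈ Finset.Icc (-(D : ℤ)) D, b k * chr k t =
          ∑ j ∈ Finset.range (2 * D + 1), b' j * chr ((j : ℤ) - D) t := by
        rw [hreidx]
        exact Finset.sum_congr rfl fun j hj => by rw [hbb j hj]
      rw [e, sub_add]
      congr 1
      ext i k
      simp only [Matrix.sub_apply, Matrix.sum_apply]
      fin_cases i <;> fin_cases k <;> simp [givens, star_sum]

end LoopApprox

namespace LoopApprox

open Matrix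

variable {N : ℕ}

/-- Small trigonometric polynomial perturbations of the form `B = L C - (L C)ᴴ` can be realised,
up to a quadratic error, as `1 + B ≈ G` with `G` an `SU(N)`-valued loop of comparable degree. -/
def Splittable (L : Matrix (Fin N) (Fin N) ℂ → Matrix (Fin N) (Fin N) ℂ) : Prop :=
  ∃ M : ℕ, 1 ≤ M ∧ ∀ (D : ℕ) (C : ℤ → Matrix (Fin N) (Fin N) ℂ) (b : ℝ), 0 ≤ b → M * b ≤ 1 →
    (∀ i j, ∑ k ∈ Finset.Icc (-(D : ℤ)) D, ‖C k i j‖ ≤ b) →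
    ∃ G, IsTrigLoop (M * (D + 1)) G ∧ MWienerLE (M * b) (fun t => G t - 1) ∧
      MWienerLE (M * b ^ 2) (fun t => G t - 1 - ∑ k ∈ Finset.Icc (-(D : ℤ)) D,
        (chr k t • L (C k) - chr (-k) t • (L (C k))ᴴ))

lemma Splittable.zero : Splittable (N := N) (fun _ => 0) := by
  refine ⟨1, le_rfl, fun D C b hb _ _ => ⟨fun _ => 1, isTrigLoop_one _, ?_, ?_⟩⟩
  · exact MWienerLE.congr (MWienerLE.const 0 (by simp [hb])) (by simp)
  · exact MWienerLE.congr (MWienerLE.const (δ := _) 0 (by simp [sq_nonneg])) (by simp)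

lemma Splittable.add {L L' : Matrix (Fin N) (Fin N) ℂ → Matrix (Fin N) (Fin N) ℂ}
    (h : Splittable L) (h' : Splittable L') : Splittable (fun C => L C + L' C) := by
  obtain ⟨M, hM, h⟩ := h
  obtain ⟨M', hM', h'⟩ := h'
  refine ⟨M + M' + N * M * M', by omega, fun D C b hb hMb hC => ?_⟩
  have e0 : (0 : ℝ) ≤ N * M * M' * b := by positivity
  have e1 : (0 : ℝ) ≤ M * b := by positivity
  have e2 : (0 : ℝ) ≤ M' * b := by positivity
  have e3 : (1 : ℝ) ≤ M := by exact_mod_cast hM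
  push_cast at hMb
  obtain ⟨G, hG, hG1, hG2⟩ := h D C b hb (by nlinarith) hC
  obtain ⟨G', hG', hG1', hG2'⟩ := h' D C b hb (by nlinarith) hC
  refine ⟨fun t => G t * G' t,
    (hG.mul hG').mono (by nlinarith [Nat.zero_le (N * M * M' * (D + 1))]),
    ?_, ?_⟩
  · refine (((hG1.add hG1').add (hG1.mul hG1')).mono ?_).congr fun t => by noncomm_ring
    push_cast
    have : b ≤ 1 := by nlinarith
    nlinarith
  · refine (((hG2.add hG2').add (hG1.mul hG1')).mono ?_).congr fun t => ?_
    · push_cast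
      nlinarith
    · simp only [conjTranspose_add, smul_add]
      have : ∀ k, chr k t • L (C k) + chr k t • L' (C k) -
          (chr (-k) t • (L (C k))ᴴ + chr (-k) t • (L' (C k))ᴴ) =
          (chr k t • L (C k) - chr (-k) t • (L (C k))ᴴ) +
            (chr k t • L' (C k) - chr (-k) t • (L' (C k))ᴴ) := fun k => by abel
      simp only [this, Finset.sum_add_distrib]
      noncomm_ring

lemma Splittable.sum {ι : Type*} (s : Finset ι)
    {L : ι → Matrix (Fin N) (Fin N) ℂ → Matrix (Fin N) (Fin N) ℂ}
    (h : ∀ i ∈ s, Splittable (L i)) : Splittable (fun C => ∑ i ∈ s, L i C) := by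
  classical
  induction s using Finset.induction_on with
  | empty => simpa using Splittable.zero
  | insert i s his ih =>
    simp only [Finset.sum_insert his]
    exact (h i (Finset.mem_insert_self _ _)).add
      (ih fun j hj => h j (Finset.mem_insert_of_mem hj))

lemma norm_le_one_of_conjTranspose_mul {m n : ℕ} {Z : Matrix (Fin m) (Fin n) ℂ} (h : Zᴴ * Z = 1)
    (i : Fin m) (j : Fin n) : ‖Z i j‖ ≤ 1 := by
  have h1 := congrFun (congrFun h j) j
  rw [Matrix.mul_apply, Matrix.one_apply_eq] at h1
  have h2 : ∑ i, ‖Z i j‖ ^ 2 = 1 := by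
    rw [← Complex.ofReal_inj]
    push_cast
    rw [← h1]
    refine Finset.sum_congr rfl fun i _ => ?_
    rw [conjTranspose_apply, Complex.star_def, mul_comm, Complex.mul_conj,
      Complex.normSq_eq_norm_sq]
    push_cast
    rfl
  have h3 := Finset.single_le_sum (f := fun i => ‖Z i j‖ ^ 2) (fun _ _ => sq_nonneg _)
    (Finset.mem_univ i)
  have h4 : ‖Z i j‖ ^ 2 ≤ 1 := h2 ▸ h3
  nlinarith [norm_nonneg (Z i j)]

lemma MWienerLE.conj_isometry {Z : Matrix (Fin N) (Fin 2) ℂ} (hZ : Zᴴ * Z = 1) {δ : ℝ}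
    {X : ℝ → Matrix (Fin 2) (Fin 2) ℂ} (hX : MWienerLE δ X) :
    MWienerLE (4 * δ) (fun t => Z * X t * Zᴴ) := by
  have hZ1 : MWienerLE 1 (fun _ => Z) := MWienerLE.const Z (norm_le_one_of_conjTranspose_mul hZ)
  refine ((hZ1.mul hX).mul hZ1.conjTranspose).mono ?_
  push_cast
  linarith

lemma Splittable.atom {x y : Fin N → ℂ} (hx : star x ⬝ᵥ x = 1) (hy : star y ⬝ᵥ y = 1)
    (hxy : star x ⬝ᵥ y = 0) (κ : ℂ) (i j : Fin N) :
    Splittable (fun C => (κ * C i j) • vecMulVec x (star y)) := by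
  obtain ⟨c, hc, h⟩ := exists_trigLoop_two
  set Z : Matrix (Fin N) (Fin 2) ℂ := Matrix.of fun r => ![x r, y r] with hZdef
  have hyx : star y ⬝ᵥ x = 0 := by
    have := congrArg star hxy
    rwa [star_dotProduct, star_star, star_zero] at this
  have hZ : Zᴴ * Z = 1 := by
    ext a b
    fin_cases a <;> fin_cases b
    · simpa [Matrix.mul_apply, hZdef, dotProduct] using hx
    · simpa [Matrix.mul_apply, hZdef, dotProduct] using hxy
    · simpa [Matrix.mul_apply, hZdef, dotProduct] using hyx
    · simpa [Matrix.mul_apply, hZdef, dotProduct] using hy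
  obtain ⟨M, hM⟩ := exists_nat_ge (4 * c * ‖κ‖ ^ 2 + 4 * ‖κ‖ + 6)
  have hκ := norm_nonneg κ
  have hcκ : 0 ≤ c * ‖κ‖ ^ 2 := by positivity
  have hM6 : 6 ≤ M := by
    have : (6 : ℝ) ≤ M := by linarith
    exact_mod_cast this
  refine ⟨M, by omega, fun D C b hb hMb hC => ?_⟩
  have hb1 : b ≤ 1 := by nlinarith
  obtain ⟨G, hG, hGW⟩ := h D (fun k => κ * C k i j) (‖κ‖ * b) (by
    simp only [norm_mul, ← Finset.mul_sum]
    exact mul_le_mul_of_nonneg_left (hC i j) hκ) (by nlinarith)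
  have hE : MWienerLE (‖κ‖ * b) (fun t =>
      !![0, ∑ k ∈ Finset.Icc (-(D : ℤ)) D, κ * C k i j * chr k t;
          -star (∑ k ∈ Finset.Icc (-(D : ℤ)) D, κ * C k i j * chr k t), 0]) := by
    have h1 : WienerLE (‖κ‖ * b) (fun t => ∑ k ∈ Finset.Icc (-(D : ℤ)) D, κ * C k i j * chr k t) :=
      (wienerLE_sum _ _).mono (by
        simp only [norm_mul, ← Finset.mul_sum]
        exact mul_le_mul_of_nonneg_left (hC i j) hκ)
    have h0 := WienerLE.zero.mono h1.nonneg
    intro a b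
    fin_cases a <;> fin_cases b
    · exact h0
    · exact h1
    · exact h1.star.neg
    · exact h0
  refine ⟨fun t => planeEmbed Z (G t), ⟨fun t => planeEmbed_mem hZ (hG.1 t), ?_⟩, ?_, ?_⟩
  · have h1 : MTrigPoly (4 * D + 2) (fun t => G t - 1) := hG.2.sub (MTrigPoly.const _ _)
    refine (MTrigPoly.const _ 1).add ((((MTrigPoly.const 0 Z).mul h1).mul
      (MTrigPoly.const 0 Zᴴ)).mono ?_)
    nlinarith
  · refine (((hGW.add hE).conj_isometry hZ).mono ?_).congr fun t => ?_
    · have : b ^ 2 ≤ b := by nlinarith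
      nlinarith
    · simp [planeEmbed]
  · refine ((hGW.conj_isometry hZ).mono ?_).congr fun t => ?_
    · nlinarith [sq_nonneg b]
    · have e : ∑ k ∈ Finset.Icc (-(D : ℤ)) D, (chr k t • (κ * C k i j) • vecMulVec x (star y) -
          chr (-k) t • ((κ * C k i j) • vecMulVec x (star y))ᴴ) =
          Z * !![0, ∑ k ∈ Finset.Icc (-(D : ℤ)) D, κ * C k i j * chr k t;
          -star (∑ k ∈ Finset.Icc (-(D : ℤ)) D, κ * C k i j * chr k t), 0] * Zᴴ := by
        ext a b
        simp only [Matrix.sum_apply, Matrix.mul_apply, Fin.sum_univ_two, star_sum, ← star_chr]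
        simp only [hZdef, conjTranspose_apply, vecMulVec_apply, Matrix.sub_apply, Matrix.smul_apply]
        simp [Finset.sum_mul, Finset.mul_sum, Finset.sum_sub_distrib, ← sub_eq_add_neg]
        rw [add_comm, ← sub_eq_add_neg]
        congr 1 <;> refine Finset.sum_congr rfl fun k _ => by ring
      simp only [e, planeEmbed, Matrix.mul_sub, Matrix.sub_mul]
      abel

end LoopApprox

namespace LoopApprox

open Matrix

variable {N : ℕ}

lemma splittable_single {l m : Fin N} (hlm : l ≠ m) (κ : ℂ) (i j : Fin N) :
    Splittable (fun C => (κ * C i j) • Matrix.single l m (1 : ℂ)) := by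
  have := Splittable.atom (x := Pi.single l 1) (y := Pi.single m 1) (by simp) (by simp)
    (by simp [hlm]) κ i j
  convert this using 4
  ext a b
  simp [vecMulVec_apply, Matrix.single_apply, Pi.single_apply]
  grind

lemma splittable_diag (l m : Fin N) (κ : ℂ) (i j : Fin N) :
    Splittable (fun C => (κ * C i j) • (Matrix.single l l (1 : ℂ) - Matrix.single m m 1)) := by
  rcases eq_or_ne l m with rfl | hlm
  · simpa using Splittable.zero
  obtain ⟨c, hc, hc2⟩ : ∃ c : ℂ, star c = c ∧ c * c = 1 / 2 := by
    refine ⟨((√2)⁻¹ : ℝ), by rw [Complex.star_def, Complex.conj_ofReal], ?_⟩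
    rw [← Complex.ofReal_mul, ← mul_inv, Real.mul_self_sqrt (by norm_num)]
    norm_num
  have h1 := Splittable.atom (x := c • (Pi.single l 1 + Pi.single m 1))
    (y := c • (Pi.single l 1 - Pi.single m 1))
    (by
      simp [hlm, hlm.symm, hc, -Complex.star_def]
      linear_combination 2 * hc2)
    (by
      simp [hlm, hlm.symm, hc, -Complex.star_def]
      linear_combination 2 * hc2)
    (by
      simp [hlm, hlm.symm, hc, -Complex.star_def]) (2 * κ) i j
  refine cast (congrArg Splittable (funext fun C => ?_))
    ((h1.add (splittable_single hlm κ i j)).add (splittable_single hlm.symm (-κ) i j))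
  simp only [vecMulVec_smul, smul_vecMulVec, star_smul, hc, smul_smul]
  rw [show 2 * κ * C i j * (c * c) = κ * C i j by linear_combination 2 * κ * C i j * hc2]
  rw [neg_mul, neg_smul, ← smul_add, ← sub_eq_add_neg, ← smul_sub]
  congr 1
  ext a b
  simp [vecMulVec_apply, Matrix.single_apply, Pi.single_apply]
  grind

lemma splittable_traceless (hN : N ≠ 0) :
    Splittable (fun C : Matrix (Fin N) (Fin N) ℂ => C - (C.trace / N) • (1 : Matrix _ _ ℂ)) := by
  have hN' : (N : ℂ) ≠ 0 := by exact_mod_cast hN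
  have h1 : Splittable (fun C : Matrix (Fin N) (Fin N) ℂ =>
      ∑ p ∈ Finset.univ.filter (fun p : Fin N × Fin N => p.1 ≠ p.2),
        ((1 : ℂ) * C p.1 p.2) • Matrix.single p.1 p.2 (1 : ℂ)) :=
    Splittable.sum _ fun p hp => splittable_single (Finset.mem_filter.1 hp).2 1 p.1 p.2
  have h2 : Splittable (fun C : Matrix (Fin N) (Fin N) ℂ => ∑ l, ∑ m,
      ((N : ℂ)⁻¹ * C l l) • (Matrix.single l l (1 : ℂ) - Matrix.single m m 1)) :=
    Splittable.sum _ fun l _ => Splittable.sum _ fun m _ => splittable_diag l m _ l l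
  refine cast (congrArg Splittable (funext fun C => ?_)) (h1.add h2)
  have e1 : ∀ l, ∑ m, ((N : ℂ)⁻¹ * C l l) • (Matrix.single l l (1 : ℂ) - Matrix.single m m 1) =
      C l l • Matrix.single l l 1 - ((N : ℂ)⁻¹ * C l l) • (1 : Matrix (Fin N) (Fin N) ℂ) := by
    intro l
    rw [← Finset.smul_sum, Finset.sum_sub_distrib, smul_sub]
    congr 1
    · simp [← Nat.cast_smul_eq_nsmul ℂ]
      field_simp
    · congr 1
      ext a b
      rw [Matrix.sum_apply]
      simp only [Matrix.single_apply, Matrix.one_apply]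
      split_ifs with h
      · subst h
        simp
      · exact Finset.sum_eq_zero fun x _ => if_neg fun hx => h (hx.1.symm.trans hx.2)
  simp only [e1, Finset.sum_sub_distrib, ← Finset.sum_smul, ← Finset.mul_sum]
  have e2 : C = ∑ p : Fin N × Fin N, C p.1 p.2 • Matrix.single p.1 p.2 (1 : ℂ) := by
    rw [Fintype.sum_prod_type]
    simpa using matrix_eq_sum_single C
  have e3 : ∑ p ∈ Finset.univ.filter (fun p : Fin N × Fin N => ¬ p.1 ≠ p.2),
      C p.1 p.2 • Matrix.single p.1 p.2 (1 : ℂ) = ∑ l, C l l • Matrix.single l l (1 : ℂ) := by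
    simp only [not_not]
    rw [Finset.sum_filter, Fintype.sum_prod_type]
    simp
  rw [add_sub, ← e3, div_eq_inv_mul]
  simp only [one_mul]
  rw [Finset.sum_filter_add_sum_filter_not, ← e2]
  rfl

end LoopApprox

namespace LoopApprox

open Matrix

variable {N : ℕ}

/-- The projection of `E` to the traceless skew-Hermitian matrices. -/
noncomputable def skewPart (E : Matrix (Fin N) (Fin N) ℂ) : Matrix (Fin N) (Fin N) ℂ :=
  (1 / 2 : ℂ) • (E - Eᴴ) - ((1 / (2 * N) : ℂ) * (E.trace - star E.trace)) • 1

lemma skewPart_conjTranspose (E : Matrix (Fin N) (Fin N) ℂ) : (skewPart E)ᴴ = -skewPart E := by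
  have h2 : star (2 : ℂ) = 2 := by simp
  have hN : star (N : ℂ) = N := by simp
  simp only [skewPart, conjTranspose_sub, conjTranspose_smul, conjTranspose_conjTranspose,
    conjTranspose_one, star_mul', star_div₀, star_one, star_sub, star_star, h2, hN]
  rw [neg_sub, ← neg_sub E.trace, mul_neg, neg_smul, ← neg_sub E, smul_neg]
  abel

lemma MWienerLE.skewPart (hN : 2 ≤ N) {δ : ℝ} {E : ℝ → Matrix (Fin N) (Fin N) ℂ}
    (h : MWienerLE δ E) : MWienerLE (2 * δ) (fun t => skewPart (E t)) := by
  have hN' : (2 : ℝ) ≤ N := by exact_mod_cast hN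
  refine (((h.sub h.conjTranspose).const_smul (1 / 2)).sub
    (MWienerLE.smul_one ((h.trace.sub h.trace.star).const_mul (1 / (2 * N))) N)).mono ?_
  simp only [norm_div, norm_mul, norm_one, Complex.norm_ofNat, Complex.norm_natCast]
  field_simp
  norm_num
  linarith

lemma sum_chr_smul_eq_skewPart {D : ℕ} {E : ℝ → Matrix (Fin N) (Fin N) ℂ}
    {c : ℤ → Matrix (Fin N) (Fin N) ℂ}
    (hE : ∀ t, E t = ∑ k ∈ Finset.Icc (-(D : ℤ)) D, chr k t • c k) (t : ℝ) :
    ∑ k ∈ Finset.Icc (-(D : ℤ)) D,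
      (chr k t • (((1 / 2 : ℂ) • c k) - (((1 / 2 : ℂ) • c k).trace / N) • 1) -
        chr (-k) t • (((1 / 2 : ℂ) • c k) - (((1 / 2 : ℂ) • c k).trace / N) • 1)ᴴ) =
      skewPart (E t) := by
  have h2 : star (2 : ℂ) = 2 := by simp
  have hN : star (N : ℂ) = N := by simp
  simp only [hE, skewPart, conjTranspose_sum, conjTranspose_smul, trace_sum, trace_smul, star_sum,
    star_smul, star_chr, ← Finset.sum_sub_distrib, Finset.smul_sum, Finset.mul_sum, Finset.sum_smul]
  refine Finset.sum_congr rfl fun k _ => ?_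
  simp only [conjTranspose_sub, conjTranspose_smul, conjTranspose_one, star_div₀, star_mul',
    smul_eq_mul, h2, hN, star_one]
  ext i j
  simp only [Matrix.sub_apply, Matrix.smul_apply, smul_eq_mul]
  ring

lemma newton_step (hN : 2 ≤ N) : ∃ M : ℕ, 1 ≤ M ∧ ∀ (D K : ℕ)
    (V P : ℝ → Matrix (Fin N) (Fin N) ℂ) (δ : ℝ), IsTrigLoop D V → MTrigPoly K P → M * δ ≤ 1 →
    MWienerLE δ (fun t => (V t)ᴴ * P t - 1) →
    ∃ V' ρ, IsTrigLoop (D + M * (D + K + 1)) V' ∧ MWienerLE (M * δ ^ 2) ρ ∧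
      ∀ t, (V' t)ᴴ * P t - 1 = (1 / 2 : ℂ) • ((P t)ᴴ * P t - 1) +
        ((1 / (2 * N) : ℂ) * (((P t).det - 1) - star ((P t).det - 1))) • 1 + ρ t := by
  obtain ⟨M₀, hM₀, hs⟩ := splittable_traceless (N := N) (by omega)
  obtain ⟨c, hc0, hc⟩ := wienerLE_det_one_add_sub N
  obtain ⟨M, hM⟩ := exists_nat_ge (3 * N + c + M₀ + N * M₀ : ℝ)
  have hN' : (2 : ℝ) ≤ N := by exact_mod_cast hN
  have hN0 : (N : ℂ) ≠ 0 := by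
    have : N ≠ 0 := by omega
    exact_mod_cast this
  have hNM : (0 : ℝ) ≤ N * M₀ := by positivity
  have hM₀' : (1 : ℝ) ≤ M₀ := by exact_mod_cast hM₀
  have hMM : M₀ ≤ M := by
    have : (M₀ : ℝ) ≤ M := by linarith
    exact_mod_cast this
  refine ⟨M, by omega, fun D K V P δ hV hP hMδ hδ => ?_⟩
  have hδ0 : 0 ≤ δ := (hδ ⟨0, by omega⟩ ⟨0, by omega⟩).nonneg
  have hM₀δ : M₀ * δ ≤ 1 := by
    refine le_trans ?_ hMδ
    gcongr
  have hδ1 : δ ≤ 1 := by nlinarith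
  set E : ℝ → Matrix (Fin N) (Fin N) ℂ := fun t => (V t)ᴴ * P t - 1 with hE
  have hET : MTrigPoly (D + K) E := (hV.2.conjTranspose.mul hP).sub (MTrigPoly.const _ _)
  choose a ha1 ha2 using fun i j => WienerLE.exists_coeff (hET i j) (hδ i j)
  obtain ⟨G, hG, -, hG2⟩ := hs (D + K) (fun k => (1 / 2 : ℂ) • Matrix.of fun i j => a i j k) δ hδ0
    hM₀δ (fun i j => by
      refine le_trans (Finset.sum_le_sum fun k _ => ?_) (ha2 i j)
      simp only [Matrix.smul_apply, Matrix.of_apply, smul_eq_mul, norm_mul, norm_div, norm_one,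
        Complex.norm_ofNat]
      nlinarith [norm_nonneg (a i j k)])
  have hEc : ∀ t, E t = ∑ k ∈ Finset.Icc (-((D + K : ℕ) : ℤ)) (D + K : ℕ),
      chr k t • Matrix.of fun i j => a i j k := by
    intro t
    ext i j
    rw [ha1 i j t, Matrix.sum_apply]
    exact Finset.sum_congr rfl fun k _ => by simp [mul_comm]
  simp only [sum_chr_smul_eq_skewPart hEc] at hG2
  refine ⟨fun t => V t * G t, fun t => ((V t * G t)ᴴ * P t - 1) -
    ((1 / 2 : ℂ) • ((P t)ᴴ * P t - 1) +
        ((1 / (2 * N) : ℂ) * (((P t).det - 1) - star ((P t).det - 1))) • 1), ?_, ?_, fun t => ?_⟩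
  · refine (hV.mul hG).mono ?_
    gcongr
  · have hrem := hc δ E hδ1 hδ
    have hB := MWienerLE.skewPart hN hδ
    have hG3 := hG2.conjTranspose
    have h1 := (((((hδ.conjTranspose.mul hδ).const_smul (-1 / 2)).sub
      (MWienerLE.smul_one ((hrem.sub hrem.star).const_mul (1 / (2 * N))) N)).sub
      (hB.mul hδ)).add hG3).add (hG3.mul hδ)
    refine (h1.mono ?_).congr fun t => ?_
    · simp only [norm_div, norm_mul, norm_one, norm_neg, Complex.norm_ofNat, Complex.norm_natCast]
      have e1 : (1 : ℝ) / (2 * N) * (c * δ ^ 2 + c * δ ^ 2) ≤ c * δ ^ 2 := by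
        rw [div_mul_eq_mul_div, div_le_iff₀ (by positivity)]
        nlinarith [mul_nonneg hc0 (sq_nonneg δ)]
      have e2 : (N : ℝ) * (M₀ * δ ^ 2 * δ) ≤ N * M₀ * δ ^ 2 := by
        nlinarith [mul_nonneg hNM (sq_nonneg δ)]
      nlinarith [mul_le_mul_of_nonneg_right hM (sq_nonneg δ), sq_nonneg δ]
    · have hVV := specialUnitary_mul_conjTranspose (hV.1 t)
      have q1 : (V t)ᴴ * P t = 1 + E t := by simp [hE]
      have q2 : (P t)ᴴ * P t = (1 + E t)ᴴ * (1 + E t) := by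
        rw [← q1, conjTranspose_mul, conjTranspose_conjTranspose, Matrix.mul_assoc,
          ← Matrix.mul_assoc (V t), hVV, Matrix.one_mul]
      have q3 : (P t).det = (1 + E t).det := by
        rw [← q1, det_mul, det_conjTranspose, (hV.1 t).2, star_one, one_mul]
      have q4 : (V t * G t)ᴴ * P t = (G t)ᴴ * (1 + E t) := by
        rw [conjTranspose_mul, Matrix.mul_assoc, q1]
      rw [q2, q3, q4]
      simp only [conjTranspose_sub, skewPart_conjTranspose, conjTranspose_add, conjTranspose_one]
      generalize hd : (1 + E t).det = d
      generalize E t = F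
      have q5 : F = skewPart F + ((1 / 2 : ℂ) • (F + Fᴴ) +
          ((1 / (2 * N) : ℂ) * (F.trace - star F.trace)) • 1) := by
        rw [skewPart]
        ext i j
        simp only [Matrix.sub_apply, Matrix.add_apply, Matrix.smul_apply, smul_eq_mul]
        ring
      have q6 : (G t)ᴴ * (1 + F) - 1 = F - skewPart F - skewPart F * F +
          ((G t)ᴴ - 1 - -skewPart F) + ((G t)ᴴ - 1 - -skewPart F) * F := by noncomm_ring
      rw [q6]
      have q7 : F - skewPart F = (1 / 2 : ℂ) • (F + Fᴴ) +
          ((1 / (2 * N) : ℂ) * (F.trace - star F.trace)) • 1 := by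
        rw [sub_eq_iff_eq_add']
        exact q5
      rw [q7]
      have q8 : (1 + Fᴴ) * (1 + F) - 1 = F + Fᴴ + Fᴴ * F := by noncomm_ring
      rw [q8]
      simp only [star_sub, star_one, smul_add, sub_smul, mul_sub]
      rw [neg_div, neg_smul]
      abel
  · exact (add_sub_cancel _ _).symm

end LoopApprox

namespace LoopApprox

open Matrix

variable {N : ℕ}

lemma norm_half_smul_add_le {A : Matrix (Fin N) (Fin N) ℂ} {d : ℂ} {η : ℝ} (hN : 2 ≤ N)
    (hA : ∀ i j, ‖A i j‖ ≤ η) (hd : ‖d‖ ≤ η) (i j : Fin N) :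
    ‖((1 / 2 : ℂ) • A + ((1 / (2 * N) : ℂ) * (d - star d)) • 1) i j‖ ≤ η := by
  have hη := (norm_nonneg _).trans hd
  have hN' : (2 : ℝ) ≤ N := by exact_mod_cast hN
  have h1 : ‖(1 : Matrix (Fin N) (Fin N) ℂ) i j‖ ≤ 1 := by
    rw [Matrix.one_apply]
    split_ifs <;> simp
  have h2 : ‖d - star d‖ ≤ 2 * η := by
    refine (norm_sub_le _ _).trans ?_
    rw [norm_star]
    linarith
  rw [Matrix.add_apply, Matrix.smul_apply, Matrix.smul_apply, smul_eq_mul, smul_eq_mul]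
  refine (norm_add_le _ _).trans ?_
  rw [norm_mul, norm_mul, norm_mul]
  simp only [norm_div, norm_mul, norm_one, Complex.norm_ofNat, Complex.norm_natCast]
  have h3 : 1 / (2 * (N : ℝ)) * ‖d - star d‖ * ‖(1 : Matrix (Fin N) (Fin N) ℂ) i j‖ ≤
      1 / (2 * 2) * (2 * η) * 1 := by gcongr
  linarith [hA i j]

lemma MWienerLE.half_smul_add (hN : 2 ≤ N) {Q : ℝ → Matrix (Fin N) (Fin N) ℂ} {d : ℝ → ℂ} {η : ℝ}
    (hQ : MWienerLE η Q) (hd : WienerLE η d) : MWienerLE η (fun t => (1 / 2 : ℂ) • Q t +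
      ((1 / (2 * N) : ℂ) * (d t - star (d t))) • 1) := by
  have hη := hd.nonneg
  have hN' : (2 : ℝ) ≤ N := by exact_mod_cast hN
  refine ((hQ.const_smul (1 / 2)).add
    (MWienerLE.smul_one ((hd.sub hd.star).const_mul (1 / (2 * N))) N)).mono ?_
  simp only [norm_div, norm_mul, norm_one, Complex.norm_ofNat, Complex.norm_natCast]
  have h3 : 1 / (2 * (N : ℝ)) * (η + η) ≤ 1 / (2 * 2) * (η + η) := by gcongr
  linarith

lemma newton_iterate (hN : 2 ≤ N) : ∃ M : ℕ, 1 ≤ M ∧ ∀ (D K : ℕ)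
    (V P : ℝ → Matrix (Fin N) (Fin N) ℂ) (δ η θ : ℝ), IsTrigLoop D V → MTrigPoly K P →
    MWienerLE δ (fun t => (V t)ᴴ * P t - 1) → MWienerLE η (fun t => (P t)ᴴ * P t - 1) →
    WienerLE η (fun t => (P t).det - 1) → θ ≤ 1 / 2 → M * (δ + 2 * η) ≤ θ → ∀ J : ℕ,
    (∃ D' V', IsTrigLoop D' V' ∧ D' + K + 1 ≤ (M + 1) ^ J * (D + K + 1) ∧
      MWienerLE (θ ^ J * δ + 2 * η) (fun t => (V' t)ᴴ * P t - 1)) ∧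
    ∀ ηs : ℝ, (∀ t i j, ‖((P t)ᴴ * P t - 1) i j‖ ≤ ηs) → (∀ t, ‖(P t).det - 1‖ ≤ ηs) →
      ∃ (D' : ℕ) (V' : ℝ → Matrix (Fin N) (Fin N) ℂ), IsTrigLoop D' V' ∧
        D' + K + 1 ≤ (M + 1) ^ (J + 1) * (D + K + 1) ∧
        ∀ t i j, ‖((V' t)ᴴ * P t - 1) i j‖ ≤ M * (θ ^ J * δ + 2 * η) ^ 2 + ηs := by
  obtain ⟨M, hM1, hM⟩ := newton_step hN
  refine ⟨M, hM1, fun D K V P δ η θ hV hP hδ hη hd hθ hMθ J => ?_⟩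
  have hη0 := hd.nonneg
  have hδ0 : 0 ≤ δ := (hδ ⟨0, by omega⟩ ⟨0, by omega⟩).nonneg
  have hθ0 : 0 ≤ θ := le_trans (by positivity) hMθ
  have hle : ∀ J : ℕ, M * (θ ^ J * δ + 2 * η) ≤ θ := by
    intro J
    refine le_trans ?_ hMθ
    gcongr
    exact mul_le_of_le_one_left hδ0 (pow_le_one₀ hθ0 (by linarith))
  have hdeg : ∀ {D' J : ℕ}, D' + K + 1 ≤ (M + 1) ^ J * (D + K + 1) →
      D' + M * (D' + K + 1) + K + 1 ≤ (M + 1) ^ (J + 1) * (D + K + 1) := by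
    intro D' J h
    calc D' + M * (D' + K + 1) + K + 1 = (M + 1) * (D' + K + 1) := by ring
      _ ≤ (M + 1) * ((M + 1) ^ J * (D + K + 1)) := by gcongr
      _ = _ := by ring
  have key : ∃ D' V', IsTrigLoop D' V' ∧ D' + K + 1 ≤ (M + 1) ^ J * (D + K + 1) ∧
      MWienerLE (θ ^ J * δ + 2 * η) (fun t => (V' t)ᴴ * P t - 1) := by
    induction J with
    | zero => exact ⟨D, V, hV, by simp, hδ.mono (by simp [hη0])⟩
    | succ J ih =>
      obtain ⟨D', V', h1, h2, h3⟩ := ih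
      obtain ⟨V'', ρ, k1, k2, k3⟩ := hM D' K V' P _ h1 hP ((hle J).trans (by linarith)) h3
      refine ⟨_, V'', k1, hdeg h2, ?_⟩
      refine (((hη.half_smul_add hN hd).add k2).mono ?_).congr fun t => (k3 t).symm
      have h4 : 0 ≤ θ ^ J * δ := by positivity
      have h5 : M * (θ ^ J * δ + 2 * η) ^ 2 ≤ θ * (θ ^ J * δ + 2 * η) := by
        rw [pow_two, ← mul_assoc]
        gcongr
        exact hle J
      have h6 : θ * η ≤ 1 / 2 * η := by gcongr
      rw [pow_succ θ J]
      nlinarith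
  refine ⟨key, fun ηs hQs hds => ?_⟩
  obtain ⟨D', V', h1, h2, h3⟩ := key
  obtain ⟨V'', ρ, k1, k2, k3⟩ := hM D' K V' P _ h1 hP ((hle J).trans (by linarith)) h3
  refine ⟨_, V'', k1, hdeg h2, fun t i j => ?_⟩
  rw [k3 t, add_comm, Matrix.add_apply]
  exact (norm_add_le _ _).trans (add_le_add ((k2 i j).norm_le t)
    (norm_half_smul_add_le hN (hQs t) (hds t) i j))

end LoopApprox

namespace LoopApprox

lemma sum_sq_mul_sub_sq (m : ℝ) (n : ℕ) : ∑ j ∈ Finset.range n, ((j : ℝ) * (m - j)) ^ 2 =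
    m ^ 2 * ((n - 1) * n * (2 * n - 1) / 6) - 2 * m * (n * (n - 1) / 2) ^ 2 +
      (n - 1) * n * (2 * n - 1) * (3 * n ^ 2 - 3 * n - 1) / 30 := by
  induction n with
  | zero => simp
  | succ n ih =>
    rw [Finset.sum_range_succ, ih]
    push_cast
    ring

lemma integral_normSq_sum_range (n : ℕ) (c : ℕ → ℂ) :
    ∫ t in (-π)..π, ‖∑ j ∈ Finset.range n, c j * chr j t‖ ^ 2 =
      2 * π * ∑ j ∈ Finset.range n, ‖c j‖ ^ 2 := by
  have := integral_normSq_sum ((Finset.range n).map Nat.castEmbedding) (fun k => c k.toNat)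
  simpa using this

lemma sq_le_normSq_one_sub_chr {t : ℝ} (h : |t| ≤ π) : t ^ 2 ≤ 3 * ‖1 - chr 1 t‖ ^ 2 := by
  have h1 := Real.cos_le_one_sub_mul_cos_sq h
  have h2 : ‖1 - chr 1 t‖ ^ 2 = 2 - 2 * Real.cos t := by
    rw [← Complex.normSq_eq_norm_sq, chr, Int.cast_one, one_mul, Complex.exp_mul_I,
      ← Complex.ofReal_cos, ← Complex.ofReal_sin, Complex.normSq_apply]
    simp [-Complex.ofReal_cos, -Complex.ofReal_sin]
    nlinarith [Real.sin_sq_add_cos_sq t]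
  have h3 : π ^ 2 ≤ 12 := by nlinarith [Real.pi_lt_d2, Real.pi_pos]
  have h4 : t ^ 2 = π ^ 2 / 2 * (2 / π ^ 2 * t ^ 2) := by
    field_simp
  have h5 : 2 / π ^ 2 * t ^ 2 ≤ 1 - Real.cos t := by linarith
  have h6 := Real.cos_le_one t
  rw [h2, h4]
  calc _ ≤ 12 / 2 * (1 - Real.cos t) := by gcongr
    _ = _ := by ring

lemma exists_fejer_type_kernel {m : ℕ} (hm : 2 ≤ m) : ∃ J : ℝ → ℝ, (∀ t, 0 ≤ J t) ∧
    (fun t => (J t : ℂ)) ∈ trigPoly (2 * m) ∧ ∫ t in (-π)..π, J t = 1 ∧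
    ∫ t in (-π)..π, J t * t ^ 2 ≤ 96 / (m : ℝ) ^ 2 := by
  have hm' : (2 : ℝ) ≤ m := by exact_mod_cast hm
  set c : ℕ → ℂ := fun j => (j : ℂ) * (m - j) with hc
  have hcn : ∀ j, ‖c j‖ ^ 2 = ((j : ℝ) * (m - j)) ^ 2 := by
    intro j
    have : c j = (((j : ℝ) * (m - j) : ℝ) : ℂ) := by simp [hc]
    rw [this, Complex.norm_real, Real.norm_eq_abs, sq_abs]
  set Q : ℝ → ℂ := fun t => ∑ j ∈ Finset.range (m + 1), c j * chr j t with hQ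
  set S : ℝ := (m : ℝ) * (m ^ 4 - 1) / 30 with hS
  have hSpos : (m : ℝ) ^ 5 / 32 ≤ S := by
    have : (16 : ℝ) ≤ m ^ 4 := by
      calc (16 : ℝ) = 2 ^ 4 := by norm_num
        _ ≤ _ := by gcongr
    rw [hS]
    nlinarith
  have hS0 : 0 < S := lt_of_lt_of_le (by positivity) hSpos
  have hQint : ∫ t in (-π)..π, ‖Q t‖ ^ 2 = 2 * π * S := by
    rw [hQ, integral_normSq_sum_range]
    simp only [hcn]
    rw [sum_sq_mul_sub_sq, hS]
    push_cast
    ring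
  have hQc : Continuous Q := continuous_finsetSum _ fun j _ =>
    continuous_const.mul (continuous_chr j)
  have hQT : Q ∈ trigPoly m := by
    have : Q = ∑ j ∈ Finset.range (m + 1), c j • chr j := by
      ext t
      simp [hQ]
    rw [this]
    refine Submodule.sum_mem _ fun j hj => Submodule.smul_mem _ _ (chr_mem ?_)
    have := Finset.mem_range.1 hj
    rw [abs_le]
    constructor <;> omega
  have hpi := Real.pi_pos
  refine ⟨fun t => (2 * π * S)⁻¹ * ‖Q t‖ ^ 2, fun t => by positivity, ?_, ?_, ?_⟩
  · have : (fun t => (((2 * π * S)⁻¹ * ‖Q t‖ ^ 2 : ℝ) : ℂ)) =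
        (((2 * π * S)⁻¹ : ℝ) : ℂ) • (Q * star Q) := by
      ext t
      simp only [Pi.smul_apply, Pi.mul_apply, Pi.star_apply, smul_eq_mul, Complex.star_def,
        Complex.mul_conj, Complex.normSq_eq_norm_sq]
      push_cast
      rfl
    rw [this, two_mul]
    exact Submodule.smul_mem _ _ (mul_mem_trigPoly hQT (star_mem_trigPoly hQT))
  · rw [intervalIntegral.integral_const_mul, hQint, inv_mul_cancel₀ (by positivity)]
  · have h1 : ∀ t, (1 - chr 1 t) * Q t = ∑ j ∈ Finset.range (m + 2),
        (if j = 0 then 0 else if j = m + 1 then 0 else ((m : ℂ) - 2 * j + 1)) * chr j t := by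
      intro t
      rw [sub_mul, one_mul]
      have e1 : Q t = ∑ j ∈ Finset.range (m + 2), (if j = m + 1 then 0 else c j) * chr j t := by
        rw [Finset.sum_range_succ _ (m + 1), if_pos rfl, zero_mul, add_zero]
        refine Finset.sum_congr rfl fun j hj => ?_
        rw [if_neg (Finset.mem_range.1 hj).ne]
      have e2 : chr 1 t * Q t =
          ∑ j ∈ Finset.range (m + 2), (if j = 0 then 0 else c (j - 1)) * chr j t := by
        rw [Finset.sum_range_succ', if_pos rfl, zero_mul, add_zero, hQ]
        simp only [Finset.mul_sum]
        refine Finset.sum_congr rfl fun j hj => ?_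
        rw [if_neg (by omega), Nat.cast_add, Nat.cast_one, chr_add, Nat.add_sub_cancel]
        ring
      rw [e2, e1, ← Finset.sum_sub_distrib]
      refine Finset.sum_congr rfl fun j hj => ?_
      rw [← sub_mul]
      congr 1
      rcases j with _ | j
      · simp [hc]
      · simp only [Nat.succ_ne_zero, if_false, Nat.add_right_cancel_iff, Nat.add_sub_cancel]
        split_ifs with h
        · simp [hc, h]
        · simp only [hc]
          push_cast
          ring
    have h2 : ∫ t in (-π)..π, ‖(1 - chr 1 t) * Q t‖ ^ 2 ≤ 2 * π * m ^ 3 := by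
      simp only [h1]
      rw [integral_normSq_sum_range]
      gcongr
      rw [Finset.sum_range_succ, Finset.sum_range_succ']
      simp only [if_true, Nat.add_eq_zero_iff, one_ne_zero, and_false, if_false]
      calc _ ≤ ∑ j ∈ Finset.range m, (m : ℝ) ^ 2 := by
            simp only [norm_zero, ne_eq, OfNat.ofNat_ne_zero, not_false_eq_true, zero_pow, add_zero]
            refine Finset.sum_le_sum fun j hj => ?_
            have hj := Finset.mem_range.1 hj
            rw [if_neg (by omega)]
            have : ((m : ℂ) - 2 * ((j + 1 : ℕ) : ℂ) + 1) = (((m : ℝ) - 2 * j - 1 : ℝ) : ℂ) := by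
              push_cast
              ring
            rw [this, Complex.norm_real, Real.norm_eq_abs]
            gcongr
            have hj' : (j : ℝ) + 1 ≤ m := by exact_mod_cast hj
            have hj0 : (0 : ℝ) ≤ j := by positivity
            rw [abs_le]
            constructor <;> linarith
        _ = (m : ℝ) ^ 3 := by
            simp
            ring
    have h3 : ∫ t in (-π)..π, (2 * π * S)⁻¹ * ‖Q t‖ ^ 2 * t ^ 2 ≤
        ∫ t in (-π)..π, (2 * π * S)⁻¹ * 3 * ‖(1 - chr 1 t) * Q t‖ ^ 2 := by
      have := continuous_chr 1
      refine intervalIntegral.integral_mono_on (by linarith) ?_ ?_ fun t ht => ?_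
      · exact Continuous.intervalIntegrable (by fun_prop) _ _
      · exact Continuous.intervalIntegrable (by fun_prop) _ _
      · have h4 := sq_le_normSq_one_sub_chr (abs_le.2 ht)
        have h5 : 0 ≤ (2 * π * S)⁻¹ * ‖Q t‖ ^ 2 := by positivity
        rw [norm_mul, mul_pow]
        nlinarith [mul_le_mul_of_nonneg_left h4 h5]
    refine h3.trans ?_
    rw [intervalIntegral.integral_const_mul]
    calc _ ≤ (2 * π * S)⁻¹ * 3 * (2 * π * m ^ 3) := by gcongr
      _ = 3 * m ^ 3 / S := by field_simp
      _ ≤ 3 * m ^ 3 / (m ^ 5 / 32) := by gcongr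
      _ = _ := by field_simp; norm_num

lemma exists_jackson_kernel (K : ℕ) : ∃ J : ℝ → ℝ, (∀ t, 0 ≤ J t) ∧
    (fun t => (J t : ℂ)) ∈ trigPoly K ∧ ∫ t in (-π)..π, J t = 1 ∧
    ∫ t in (-π)..π, J t * t ^ 2 ≤ 999 / ((K : ℝ) + 1) ^ 2 := by
  have hpi := Real.pi_pos
  rcases lt_or_ge K 4 with hK | hK
  · refine ⟨fun _ => (2 * π)⁻¹, fun t => by positivity, const_mem_trigPoly _ _, ?_, ?_⟩
    · simp
      field_simp
      norm_num
    · rw [intervalIntegral.integral_const_mul, integral_pow]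
      have hK' : (K : ℝ) + 1 ≤ 4 := by exact_mod_cast hK
      have h3 : π ^ 2 ≤ 12 := by nlinarith [Real.pi_lt_d2, Real.pi_pos]
      calc _ = π ^ 2 / 3 := by
            field_simp
            push_cast
            ring
        _ ≤ 999 / 4 ^ 2 := by linarith
        _ ≤ _ := by gcongr
  · obtain ⟨J, h1, h2, h3, h4⟩ := exists_fejer_type_kernel (m := K / 2) (by omega)
    refine ⟨J, h1, trigPoly_mono (by omega) h2, h3, h4.trans ?_⟩
    have hm : (K : ℝ) + 1 ≤ 3 * (K / 2 : ℕ) := by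
      have : K + 1 ≤ 3 * (K / 2) := by omega
      exact_mod_cast this
    have hm0 : 0 < ((K / 2 : ℕ) : ℝ) := by
      have : 0 < K / 2 := by omega
      exact_mod_cast this
    rw [div_le_div_iff₀ (by positivity) (by positivity)]
    nlinarith [pow_le_pow_left₀ (by positivity) hm 2]

end LoopApprox

namespace LoopApprox

/-- The convolution operator with kernel `J` on the circle. -/
noncomputable def circleConv (J : ℝ → ℝ) (f : ℝ → ℂ) (x : ℝ) : ℂ :=
  ∫ t in (-π)..π, (J t : ℂ) * f (x + t)

/-- A nonnegative kernel of degree `K`, of mass one and with second moment of order `K⁻²`. -/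
structure IsJacksonKernel (K : ℕ) (J : ℝ → ℝ) : Prop where
  nonneg : ∀ t, 0 ≤ J t
  mem : (fun t => (J t : ℂ)) ∈ trigPoly K
  mass : ∫ t in (-π)..π, J t = 1
  moment : ∫ t in (-π)..π, J t * t ^ 2 ≤ 999 / ((K : ℝ) + 1) ^ 2

section

variable {K : ℕ} {J : ℝ → ℝ} {f g : ℝ → ℂ}

lemma IsJacksonKernel.continuous (hJ : IsJacksonKernel K J) : Continuous J :=
   Complex.continuous_re.comp (trigPoly_continuous hJ.mem)

lemma circleConv_mem (hJ : IsJacksonKernel K J) (hf : Continuous f)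
    (hp : Function.Periodic f (2 * π)) : circleConv J f ∈ trigPoly K := by
  obtain ⟨c, hc⟩ := mem_trigPoly_iff.1 hJ.mem
  have hJp : Function.Periodic (fun t => (J t : ℂ)) (2 * π) := by
    intro t
    simp only [hc]
    exact Finset.sum_congr rfl fun k _ => by rw [chr_periodic k t]
  have h1 : circleConv J f = ∑ k ∈ Finset.Icc (-(K : ℤ)) K,
      (∫ u in (-π)..π, c k * chr k u * f u) • chr (-k) := by
    ext x
    have e1 : circleConv J f x = ∫ u in (-π)..π, (J (u - x) : ℂ) * f u := by
      have h2 : circleConv J f x = ∫ u in (-π + x)..(π + x), (J (u - x) : ℂ) * f u := by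
        rw [circleConv, ← intervalIntegral.integral_comp_add_right
          (fun u => (J (u - x) : ℂ) * f u) x]
        simp [add_comm]
      have hp' : Function.Periodic (fun u => (J (u - x) : ℂ) * f u) (2 * π) := by
        intro u
        have := hJp (u - x)
        simp only at this
        simp only [hp u]
        rw [show u + 2 * π - x = u - x + 2 * π by ring, this]
      have := hp'.intervalIntegral_add_eq (-π + x) (-π)
      rw [show -π + x + 2 * π = π + x by ring, show -π + 2 * π = π by ring] at this
      rw [h2, this]
    rw [e1]
    simp only [hc, Finset.sum_apply, Pi.smul_apply, smul_eq_mul, Finset.sum_mul]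
    rw [intervalIntegral.integral_finsetSum]
    · refine Finset.sum_congr rfl fun k _ => ?_
      rw [← intervalIntegral.integral_mul_const]
      refine intervalIntegral.integral_congr fun u _ => ?_
      have : chr k (u - x) = chr k u * chr (-k) x := by
        simp only [chr, ← Complex.exp_add]
        congr 1
        push_cast
        ring
      simp only [this]
      ring
    · intro k _
      have := continuous_chr k
      exact Continuous.intervalIntegrable (by fun_prop) _ _
  rw [h1]
  refine Submodule.sum_mem _ fun k hk => Submodule.smul_mem _ _ (chr_mem ?_)
  have := Finset.mem_Icc.1 hk
  rw [abs_neg, abs_le]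
  exact this

lemma IsJacksonKernel.norm_integral_le (hJ : IsJacksonKernel K J) {h : ℝ → ℂ}
    {b : ℝ → ℝ} (hb : Continuous b) (H : ∀ t, ‖h t‖ ≤ b t) :
    ‖∫ t in (-π)..π, (J t : ℂ) * h t‖ ≤ ∫ t in (-π)..π, J t * b t := by
  have hJc := hJ.continuous
  have hpi := Real.pi_pos
  refine intervalIntegral.norm_integral_le_of_norm_le (by linarith)
    (Filter.Eventually.of_forall fun t _ => ?_)
    (Continuous.intervalIntegrable (by fun_prop) _ _)
  rw [norm_mul, Complex.norm_real, Real.norm_eq_abs, abs_of_nonneg (hJ.nonneg t)]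
  exact mul_le_mul_of_nonneg_left (H t) (hJ.nonneg t)

lemma norm_circleConv_le (hJ : IsJacksonKernel K J) {B : ℝ}
    (hB : ∀ x, ‖f x‖ ≤ B) (x : ℝ) : ‖circleConv J f x‖ ≤ B := by
  have := hJ.norm_integral_le (h := fun t => f (x + t)) (continuous_const (y := B))
    fun t => hB _
  rwa [intervalIntegral.integral_mul_const, hJ.mass, one_mul] at this

lemma norm_sub_circleConv_le (hJ : IsJacksonKernel K J) (hf : Continuous f) {β H : ℝ}
    (hβ : 0 < β) (hβ1 : β ≤ 1) (hH : 0 ≤ H) (h : ∀ x y, ‖f x - f y‖ ≤ H * |x - y| ^ β) (x : ℝ) :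
    ‖f x - circleConv J f x‖ ≤ 1000 * H * ((K : ℝ) + 1) ^ (-β) := by
  have hJc := hJ.continuous
  have hn : (0 : ℝ) < (K : ℝ) + 1 := by positivity
  set n : ℝ := (K : ℝ) + 1 with hn'
  have e : f x - circleConv J f x = ∫ t in (-π)..π, (J t : ℂ) * (f x - f (x + t)) := by
    simp only [mul_sub]
    rw [intervalIntegral.integral_sub, intervalIntegral.integral_mul_const,
      intervalIntegral.integral_ofReal, hJ.mass, circleConv]
    · simp
    · exact Continuous.intervalIntegrable (by fun_prop) _ _
    · exact Continuous.intervalIntegrable (by fun_prop) _ _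
  have key : ∀ t : ℝ, |t| ^ β ≤ n ^ (-β) * (1 + n ^ 2 * t ^ 2) := by
    intro t
    have h1 : |t| ^ β = n ^ (-β) * (n * |t|) ^ β := by
      rw [Real.mul_rpow hn.le (abs_nonneg t), ← mul_assoc, ← Real.rpow_add hn]
      simp
    rw [h1]
    gcongr
    have h0 : 0 ≤ n * |t| := by positivity
    rw [← sq_abs t, ← mul_pow]
    rcases le_total (n * |t|) 1 with h2 | h2
    · have := Real.rpow_le_one h0 h2 hβ.le
      nlinarith [sq_nonneg (n * |t|)]
    · have : (n * |t|) ^ β ≤ (n * |t|) ^ (1 : ℝ) := Real.rpow_le_rpow_of_exponent_le h2 hβ1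
      rw [Real.rpow_one] at this
      nlinarith
  rw [e]
  refine (hJ.norm_integral_le
    (b := fun t => H * (n ^ (-β) * (1 + n ^ 2 * t ^ 2))) (by fun_prop) fun t => ?_).trans ?_
  · refine (h x (x + t)).trans ?_
    rw [show x - (x + t) = -t by ring, abs_neg]
    exact mul_le_mul_of_nonneg_left (key t) hH
  · have e2 : ∀ t, J t * (H * (n ^ (-β) * (1 + n ^ 2 * t ^ 2))) =
        H * n ^ (-β) * J t + H * n ^ (-β) * n ^ 2 * (J t * t ^ 2) := fun t => by ring
    simp only [e2]
    rw [intervalIntegral.integral_add, intervalIntegral.integral_const_mul,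
      intervalIntegral.integral_const_mul, hJ.mass]
    · have h0 : 0 ≤ H * n ^ (-β) * n ^ 2 := by positivity
      calc _ ≤ H * n ^ (-β) * 1 + H * n ^ (-β) * n ^ 2 * (999 / n ^ 2) := by
            gcongr
            exact hJ.moment
        _ = _ := by
            field_simp
            ring
    · exact Continuous.intervalIntegrable (by fun_prop) _ _
    · exact Continuous.intervalIntegrable (by fun_prop) _ _

lemma hasDerivAt_circleConv (hJ : IsJacksonKernel K J) (hf : ∀ x, HasDerivAt f (g x) x)
    (hg : Continuous g) (x : ℝ) : HasDerivAt (circleConv J f) (circleConv J g x) x := by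
  have hJc := hJ.continuous
  have hfc : Continuous f := continuous_iff_continuousAt.2 fun x => (hf x).continuousAt
  obtain ⟨B, hB⟩ := (isCompact_Icc (a := x - 1 - π) (b := x + 1 + π)).exists_bound_of_continuousOn
    hg.continuousOn
  have := intervalIntegral.hasDerivAt_integral_of_dominated_loc_of_deriv_le
    (μ := MeasureTheory.volume) (a := -π) (b := π)
    (F := fun x t => (J t : ℂ) * f (x + t)) (F' := fun x t => (J t : ℂ) * g (x + t))
    (x₀ := x) (s := Metric.ball x 1) (bound := fun t => J t * B) (Metric.ball_mem_nhds x one_pos)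
    (Filter.Eventually.of_forall fun y =>
      (Continuous.aestronglyMeasurable (by fun_prop)))
    (Continuous.intervalIntegrable (by fun_prop) _ _)
    (Continuous.aestronglyMeasurable (by fun_prop))
    (Filter.Eventually.of_forall fun t ht y hy => ?_)
    (Continuous.intervalIntegrable (by fun_prop) _ _)
    (Filter.Eventually.of_forall fun t ht y hy => ?_)
  · exact this.2
  · rw [norm_mul, Complex.norm_real, Real.norm_eq_abs, abs_of_nonneg (hJ.nonneg t)]
    refine mul_le_mul_of_nonneg_left (hB _ ?_) (hJ.nonneg t)
    rw [Set.uIoc_of_le (by linarith [Real.pi_pos])] at ht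
    rw [Metric.mem_ball, Real.dist_eq, abs_lt] at hy
    constructor <;> linarith [ht.1, ht.2, hy.1, hy.2]
  · have h2 : HasDerivAt (fun y => f (y + t)) (g (y + t)) y := by
      simpa using (hf (y + t)).comp_add_const y t
    exact h2.const_mul _

lemma circleConv_periodic (hp : Function.Periodic f (2 * π)) :
    Function.Periodic (circleConv J f) (2 * π) := by
  intro x
  simp only [circleConv]
  congr 1
  ext t
  rw [show x + 2 * π + t = x + t + 2 * π by ring, hp]

/-- The remainder operator `f ↦ f - J * f`. -/
noncomputable def convRemainder (J : ℝ → ℝ) (f : ℝ → ℂ) : ℝ → ℂ := fun x => f x - circleConv J f x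

lemma continuous_iterate_convRemainder (hJ : IsJacksonKernel K J) (j : ℕ) (hf : Continuous f)
    (hp : Function.Periodic f (2 * π)) :
    Continuous ((convRemainder J)^[j] f) ∧ Function.Periodic ((convRemainder J)^[j] f) (2 * π) := by
  induction j with
  | zero => exact ⟨hf, hp⟩
  | succ j ih =>
    rw [Function.iterate_succ_apply']
    refine ⟨ih.1.sub (trigPoly_continuous (circleConv_mem hJ ih.1 ih.2)), fun x => ?_⟩
    simp only [convRemainder]
    rw [ih.2 x, circleConv_periodic ih.2 x]

lemma sub_iterate_convRemainder_mem (hJ : IsJacksonKernel K J) (j : ℕ) (hf : Continuous f)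
    (hp : Function.Periodic f (2 * π)) : f - (convRemainder J)^[j] f ∈ trigPoly K := by
  induction j with
  | zero => simp
  | succ j ih =>
    obtain ⟨h1, h2⟩ := continuous_iterate_convRemainder hJ j hf hp
    have : f - (convRemainder J)^[j + 1] f =
        (f - (convRemainder J)^[j] f) + circleConv J ((convRemainder J)^[j] f) := by
      rw [Function.iterate_succ_apply']
      ext x
      simp only [Pi.sub_apply, Pi.add_apply, convRemainder]
      ring
    rw [this]
    exact Submodule.add_mem _ ih (circleConv_mem hJ h1 h2)

lemma hasDerivAt_iterate_convRemainder (hJ : IsJacksonKernel K J) (j : ℕ)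
    (hf : ∀ x, HasDerivAt f (g x) x) (hg : Continuous g) (hp : Function.Periodic g (2 * π)) :
    ∀ x, HasDerivAt ((convRemainder J)^[j] f) ((convRemainder J)^[j] g x) x := by
  induction j with
  | zero => exact hf
  | succ j ih =>
    intro x
    rw [Function.iterate_succ_apply', Function.iterate_succ_apply']
    exact (ih x).sub (hasDerivAt_circleConv hJ ih
      (continuous_iterate_convRemainder hJ j hg hp).1 x)

end

/-- Periodic functions with `r` derivatives, the last one `β`-Hölder with constant `H`. -/
def PeriodicHolder (β H : ℝ) : ℕ → (ℝ → ℂ) → Prop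
  | 0, f => Continuous f ∧ Function.Periodic f (2 * π) ∧ ∀ x y, ‖f x - f y‖ ≤ H * |x - y| ^ β
  | r + 1, f => Function.Periodic f (2 * π) ∧
      ∃ g, (∀ x, HasDerivAt f (g x) x) ∧ PeriodicHolder β H r g

lemma PeriodicHolder.continuous {β H : ℝ} {r : ℕ} {f : ℝ → ℂ} (h : PeriodicHolder β H r f) :
    Continuous f := by
  cases r with
  | zero => exact h.1
  | succ r =>
    obtain ⟨_, g, hg, _⟩ := h
    exact continuous_iff_continuousAt.2 fun x => (hg x).continuousAt

lemma PeriodicHolder.periodic {β H : ℝ} {r : ℕ} {f : ℝ → ℂ} (h : PeriodicHolder β H r f) :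
    Function.Periodic f (2 * π) := by
  cases r with
  | zero => exact h.2.1
  | succ r => exact h.1

lemma norm_sub_le_of_hasDerivAt {f g : ℝ → ℂ} (hf : ∀ x, HasDerivAt f (g x) x) {B : ℝ}
    (hB : ∀ x, ‖g x‖ ≤ B) (x y : ℝ) : ‖f x - f y‖ ≤ B * |x - y| :=
  Convex.norm_image_sub_le_of_norm_hasDerivWithin_le (s := Set.univ)
    (fun x _ => (hf x).hasDerivWithinAt) (fun x _ => hB x) convex_univ (Set.mem_univ _)
    (Set.mem_univ _)

lemma norm_iterate_convRemainder_le {K : ℕ} {J : ℝ → ℝ} (hJ : IsJacksonKernel K J) {β H : ℝ}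
    (hβ : 0 < β) (hβ1 : β ≤ 1) (hH : 0 ≤ H) (r : ℕ) : ∀ f, PeriodicHolder β H r f →
    ∀ x, ‖(convRemainder J)^[r + 1] f x‖ ≤ 1000 ^ (r + 1) * H * ((K : ℝ) + 1) ^ (-(r + β)) := by
  induction r with
  | zero =>
    intro f hf x
    simpa [convRemainder] using norm_sub_circleConv_le hJ hf.1 hβ hβ1 hH hf.2.2 x
  | succ r ih =>
    rintro f hf x
    have hfc := hf.continuous
    obtain ⟨hp, g, hfg, hg⟩ := hf
    rw [Function.iterate_succ_apply']
    have h1 := norm_sub_le_of_hasDerivAt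
      (hasDerivAt_iterate_convRemainder hJ (r + 1) hfg hg.continuous hg.periodic) (ih g hg)
    have hn : (0 : ℝ) < (K : ℝ) + 1 := by positivity
    have h2 := norm_sub_circleConv_le hJ
      (continuous_iterate_convRemainder hJ (r + 1) hfc hp).1 one_pos le_rfl
      (H := 1000 ^ (r + 1) * H * ((K : ℝ) + 1) ^ (-(r + β))) (by positivity)
      (fun x y => by simpa using h1 x y) x
    refine h2.trans_eq ?_
    have : ((K : ℝ) + 1) ^ (-(((r + 1 : ℕ) : ℝ) + β)) =
        ((K : ℝ) + 1) ^ (-(r + β)) * ((K : ℝ) + 1) ^ (-1 : ℝ) := by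
      rw [← Real.rpow_add hn]
      push_cast
      ring_nf
    rw [this]
    ring

lemma exists_jackson_approx {β H : ℝ} (hβ : 0 < β) (hβ1 : β ≤ 1) (hH : 0 ≤ H) {r : ℕ}
    {f : ℝ → ℂ} (hf : PeriodicHolder β H (r + 1) f) (K : ℕ) : ∃ p ∈ trigPoly K,
    (∀ x, ‖p x - f x‖ ≤ 1000 ^ (r + 2) * H * ((K : ℝ) + 1) ^ (-((r + 1 : ℕ) + β))) ∧
    ∀ x y, ‖(p x - f x) - (p y - f y)‖ ≤
      2 * (1000 ^ (r + 1) * H * ((K : ℝ) + 1) ^ (-(r + β))) * |x - y| := by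
  obtain ⟨J, h1, h2, h3, h4⟩ := exists_jackson_kernel K
  have hJ : IsJacksonKernel K J := ⟨h1, h2, h3, h4⟩
  have e : ∀ x, (f - (convRemainder J)^[r + 2] f) x - f x = -((convRemainder J)^[r + 2] f x) := by
    intro x
    simp
  refine ⟨f - (convRemainder J)^[r + 2] f, sub_iterate_convRemainder_mem hJ _ hf.continuous
    hf.periodic, fun x => ?_, fun x y => ?_⟩
  · rw [e, norm_neg]
    exact norm_iterate_convRemainder_le hJ hβ hβ1 hH (r + 1) f hf x
  · rw [e, e, ← neg_sub', norm_neg]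
    obtain ⟨hp, g, hfg, hg⟩ := hf
    refine norm_sub_le_of_hasDerivAt
      (hasDerivAt_iterate_convRemainder hJ (r + 2) hfg hg.continuous hg.periodic) (fun x => ?_) x y
    have h5 := norm_iterate_convRemainder_le hJ hβ hβ1 hH r g hg
    rw [Function.iterate_succ_apply']
    refine (norm_sub_le _ _).trans ?_
    have h6 := norm_circleConv_le hJ h5 x
    linarith [h5 x]

end LoopApprox

namespace LoopApprox

/-- A periodic Lipschitz function has an absolutely convergent Fourier series. -/
lemma exists_wienerLE_of_lipschitz : ∃ C : ℝ, 0 ≤ C ∧ ∀ (a : ℝ) (f : ℝ → ℂ),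
    Function.Periodic f (2 * π) → (∀ x, ‖f x‖ ≤ a) → (∀ x y, ‖f x - f y‖ ≤ a * |x - y|) →
    WienerLE (C * a) f := by
  set r : ℝ := √2 / 2 with hr
  have hr0 : 0 ≤ r := by positivity
  have hr1 : r < 1 := by
    have : √2 < 2 := by
      rw [Real.sqrt_lt' (by norm_num)]
      norm_num
    rw [hr]
    linarith
  refine ⟨6000 * (1 - r)⁻¹, mul_nonneg (by norm_num) (inv_nonneg.2 (by linarith)), ?_⟩
  intro a f hp hfa hfl
  have ha : 0 ≤ a := (norm_nonneg _).trans (hfa 0)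
  have hfc : Continuous f := by
    refine (LipschitzWith.of_dist_le_mul (K := a.toNNReal) fun x y => ?_).continuous
    rw [dist_eq_norm, Real.dist_eq, Real.coe_toNNReal a ha]
    exact hfl x y
  have hex : ∀ i : ℕ, ∃ p ∈ trigPoly (2 ^ i), ∀ x, ‖f x - p x‖ ≤ 1000 * a * (1 / 2) ^ i := by
    intro i
    obtain ⟨J, h1, h2, h3, h4⟩ := exists_jackson_kernel (2 ^ i)
    have hJ : IsJacksonKernel (2 ^ i) J := ⟨h1, h2, h3, h4⟩
    refine ⟨_, circleConv_mem hJ hfc hp, fun x => ?_⟩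
    refine (norm_sub_circleConv_le hJ hfc one_pos le_rfl ha (fun x y => by simpa using hfl x y)
      x).trans ?_
    gcongr
    rw [Real.rpow_neg_one, one_div, inv_pow]
    gcongr
    push_cast
    linarith
  choose p hp1 hp2 using hex
  obtain ⟨q, hq0, hq⟩ : ∃ q : ℕ → ℝ → ℂ, q 0 = 0 ∧ ∀ i, q (i + 1) = p i :=
    ⟨fun i => Nat.casesOn i 0 p, rfl, fun _ => rfl⟩
  have hdn : ∀ i x, ‖q (i + 1) x - q i x‖ ≤ 3000 * a * (1 / 2) ^ i := by
    intro i x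
    cases i with
    | zero =>
      have h1 := hp2 0 x
      have h2 := norm_sub_norm_le (p 0 x) (f x)
      rw [norm_sub_rev] at h1
      simp only [hq, hq0, Pi.zero_apply, sub_zero, pow_zero, mul_one] at h1 ⊢
      linarith [hfa x]
    | succ i =>
      have h1 := hp2 (i + 1) x
      have h2 := hp2 i x
      rw [norm_sub_rev] at h1
      have h3 := norm_add_le (p (i + 1) x - f x) (f x - p i x)
      rw [sub_add_sub_cancel] at h3
      have h4 : ((1 : ℝ) / 2) ^ i = 2 * (1 / 2) ^ (i + 1) := by
        rw [pow_succ]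
        ring
      rw [h4] at h2
      simp only [hq]
      linarith
  have hdm : ∀ i, (fun x => q (i + 1) x - q i x) ∈ trigPoly (2 ^ i) := by
    intro i
    cases i with
    | zero =>
      simp only [hq, hq0]
      exact Submodule.sub_mem _ (hp1 0) (Submodule.zero_mem _)
    | succ i =>
      simp only [hq]
      exact Submodule.sub_mem _ (hp1 (i + 1)) (trigPoly_mono (pow_le_pow_right₀ (by norm_num)
        (Nat.le_succ i)) (hp1 i))
  have hdw : ∀ i, WienerLE (6000 * a * r ^ i) (fun x => q (i + 1) x - q i x) := by
    intro i
    refine (wienerLE_of_norm_le (hdm i) (hdn i)).mono ?_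
    have h1 : √(2 * ((2 ^ i : ℕ) : ℝ) + 1) ≤ 2 * √2 ^ i := by
      rw [Real.sqrt_le_left (by positivity), mul_pow, ← pow_mul, mul_comm i, pow_mul,
        Real.sq_sqrt (by norm_num)]
      have : (1 : ℝ) ≤ 2 ^ i := one_le_pow₀ (by norm_num)
      push_cast
      linarith
    calc _ ≤ 2 * √2 ^ i * (3000 * a * (1 / 2) ^ i) := by gcongr
      _ = _ := by
        rw [hr, div_pow, div_pow, one_pow]
        field_simp
        ring
  have hgs := (hasSum_geometric_of_lt_one hr0 hr1).mul_left (6000 * a)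
  have hs : ∀ t, HasSum (fun i => q (i + 1) t - q i t) (f t) := by
    intro t
    have hsum : Summable fun i => q (i + 1) t - q i t :=
      Summable.of_norm_bounded ((summable_geometric_of_lt_one (by norm_num : (0 : ℝ) ≤ 1 / 2)
        (by norm_num)).mul_left (3000 * a)) fun i => hdn i t
    rw [hsum.hasSum_iff_tendsto_nat]
    simp only [Finset.sum_range_sub (fun i => q i t)]
    rw [← Filter.tendsto_add_atTop_iff_nat 1]
    simp only [hq, hq0, Pi.zero_apply, sub_zero]
    rw [tendsto_iff_norm_sub_tendsto_zero]
    refine squeeze_zero (fun _ => norm_nonneg _) (fun i => (norm_sub_rev _ _).trans_le (hp2 i t)) ?_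
    simpa using (tendsto_pow_atTop_nhds_zero_of_lt_one (by norm_num : (0 : ℝ) ≤ 1 / 2)
      (by norm_num)).const_mul (1000 * a)
  have := WienerLE.hasSum hdw hgs.summable hs
  rw [hgs.tsum_eq] at this
  convert this using 1
  ring

end LoopApprox

namespace LoopApprox

open Matrix

lemma MTrigPoly.exists_mWienerLE {m n D : ℕ} {F : ℝ → Matrix (Fin m) (Fin n) ℂ}
    (h : MTrigPoly D F) : ∃ w, 0 ≤ w ∧ MWienerLE w F := by
  have : ∀ i j, ∃ w, 0 ≤ w ∧ WienerLE w (fun t => F t i j) := by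
    intro i j
    obtain ⟨c, hc⟩ := mem_trigPoly_iff.1 (h i j)
    exact ⟨_, (wienerLE_sum _ c).nonneg, (wienerLE_sum _ c).congr fun t => (hc t).symm⟩
  choose w hw0 hw using this
  refine ⟨∑ i, ∑ j, w i j, Finset.sum_nonneg fun i _ => Finset.sum_nonneg fun j _ => hw0 i j,
    fun i j => (hw i j).mono ?_⟩
  exact (Finset.single_le_sum (f := fun j => w i j) (fun j _ => hw0 i j) (Finset.mem_univ j)).trans
    (Finset.single_le_sum (f := fun i => ∑ j, w i j)
      (fun i _ => Finset.sum_nonneg fun j _ => hw0 i j) (Finset.mem_univ i))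

lemma MWienerLE.exists_trigPoly {m n : ℕ} {w μ : ℝ} {F : ℝ → Matrix (Fin m) (Fin n) ℂ}
    (h : MWienerLE w F) (hμ : 0 < μ) :
    ∃ K P, MTrigPoly K P ∧ MWienerLE μ (fun t => P t - F t) := by
  choose D p hp1 hp2 using fun i j => (h i j).exists_trigPoly hμ
  refine ⟨∑ i, ∑ j, D i j, fun t => Matrix.of fun i j => p i j t, fun i j => ?_, fun i j => hp2 i j⟩
  refine trigPoly_mono ?_ (hp1 i j)
  exact (Finset.single_le_sum (f := fun j => D i j) (fun j _ => Nat.zero_le _)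
    (Finset.mem_univ j)).trans
    (Finset.single_le_sum (f := fun i => ∑ j, D i j) (fun i _ => Nat.zero_le _) (Finset.mem_univ i))

variable {N : ℕ}

lemma exists_perturbation_bound (N : ℕ) {w : ℝ} (hw : 0 ≤ w) : ∃ c : ℝ, 1 ≤ c ∧
    ∀ (F P : ℝ → Matrix (Fin N) (Fin N) ℂ) (μ : ℝ), 0 ≤ μ → (∀ t, F t ∈ SpecialUnitary N) →
    MWienerLE w F → MWienerLE μ (fun t => P t - F t) → c * μ ≤ 1 →
    MWienerLE (c * μ) (fun t => (F t)ᴴ * P t - 1) ∧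
    MWienerLE (c * μ) (fun t => (P t)ᴴ * P t - 1) ∧
    WienerLE (c * μ) (fun t => (P t).det - 1) := by
  obtain ⟨C, hC, hdet⟩ := wienerLE_det_one_add_sub N
  have hCN : 0 ≤ (C + N) * (N * w) := by positivity
  have hNw : 0 ≤ N * w := by positivity
  have hN0 : (0 : ℝ) ≤ N := by positivity
  refine ⟨(C + N) * (N * w) + N * (2 * w + 1) + N * w + 1, by nlinarith, ?_⟩
  intro F P μ hμ hF hFw hP hcμ
  set c := (C + N) * (N * w) + N * (2 * w + 1) + N * w + 1 with hc
  have hc0 : 0 ≤ c := by nlinarith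
  have hμ1 : μ ≤ 1 := by nlinarith
  have hE := hFw.conjTranspose.mul hP
  have hE1 : N * (w * μ) ≤ c * μ := by nlinarith
  refine ⟨(hE.mono hE1).congr fun t => ?_, ?_, ?_⟩
  · rw [mul_sub, specialUnitary_conjTranspose_mul (hF t)]
  · refine (((hE.add (hP.conjTranspose.mul hFw)).add (hP.conjTranspose.mul hP)).mono ?_).congr
      fun t => ?_
    · nlinarith [mul_nonneg hN0 hμ, mul_nonneg (mul_nonneg hN0 hμ) hμ,
        mul_nonneg (mul_nonneg hN0 hμ) (sub_nonneg.2 hμ1), mul_nonneg hCN hμ, mul_nonneg hNw hμ]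
    · have := specialUnitary_conjTranspose_mul (hF t)
      simp only [Matrix.mul_sub, conjTranspose_sub, Matrix.sub_mul, this]
      abel
  · have h1 := (hdet _ _ (hE1.trans hcμ) hE).add hE.trace
    refine (h1.mono ?_).congr fun t => ?_
    · have : C * (N * (w * μ)) ^ 2 ≤ C * (N * (w * μ)) := by
        refine mul_le_mul_of_nonneg_left ?_ hC
        have : 0 ≤ N * (w * μ) := by positivity
        nlinarith
      nlinarith [mul_nonneg hN0 hμ, mul_nonneg (mul_nonneg hN0 hμ) hw]
    · have h2 : 1 + (F t)ᴴ * (P t - F t) = (F t)ᴴ * P t := by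
        rw [mul_sub, specialUnitary_conjTranspose_mul (hF t)]
        abel
      rw [h2, det_mul, det_conjTranspose, (hF t).2]
      simp

/-- If `X - 1 = A - X E` with `E` small then `X - 1` is controlled by `A` and `E`. -/
lemma MWienerLE.absorb {a e x ε : ℝ} {X A E : ℝ → Matrix (Fin N) (Fin N) ℂ}
    (hA : MWienerLE a A) (hE : MWienerLE e E) (hX : MWienerLE x (fun t => X t - 1))
    (h : ∀ t, X t - 1 = A t - X t * E t) (he : N * e ≤ 1 / 2)
    (hε : 2 * (a + e) < ε) : MWienerLE ε (fun t => X t - 1) := by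
  have key : ∀ n : ℕ, MWienerLE (2 * (a + e) * (1 - (1 / 2) ^ n) + x * (1 / 2) ^ n)
      (fun t => X t - 1) := by
    intro n
    induction n with
    | zero => simpa using hX
    | succ n ih =>
      intro i j
      have h1 := ((hA.sub hE).sub (ih.mul hE)) i j
      refine (h1.mono ?_).congr fun t => ?_
      · have h2 := (ih i j).nonneg
        rw [pow_succ]
        nlinarith
      · show (A t - E t - (X t - 1) * E t) i j = (X t - 1) i j
        rw [Matrix.sub_mul, h t, one_mul, sub_sub, add_sub_cancel]
  have ht : Filter.Tendsto (fun n : ℕ => 2 * (a + e) * (1 - (1 / 2 : ℝ) ^ n) + x * (1 / 2) ^ n)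
      Filter.atTop (nhds (2 * (a + e) * (1 - 0) + x * 0)) := by
    have := tendsto_pow_atTop_nhds_zero_of_lt_one (by norm_num : (0 : ℝ) ≤ 1 / 2) (by norm_num)
    exact ((this.const_sub 1).const_mul _).add (this.const_mul x)
  obtain ⟨n, hn⟩ := (ht.eventually_lt_const (by simpa using hε)).exists
  exact (key n).mono hn.le

/-- `F` is a limit, in the Wiener norm, of `SU(N)`-valued trigonometric loops. -/
def IsTrigLimit (F : ℝ → Matrix (Fin N) (Fin N) ℂ) : Prop :=
  ∀ ε : ℝ, 0 < ε → ∃ D V, IsTrigLoop D V ∧ MWienerLE ε (fun t => (V t)ᴴ * F t - 1)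

lemma exists_isTrigLimit_of_near (hN : 2 ≤ N) : ∃ δ₀ : ℝ, 0 < δ₀ ∧
    ∀ (F V : ℝ → Matrix (Fin N) (Fin N) ℂ) (D : ℕ), (∀ t, F t ∈ SpecialUnitary N) →
    IsTrigLoop D V → MWienerLE δ₀ (fun t => (V t)ᴴ * F t - 1) → IsTrigLimit F := by
  obtain ⟨M, hM1, hM⟩ := newton_iterate hN
  have hM1' : (1 : ℝ) ≤ M := by exact_mod_cast hM1
  refine ⟨1 / (8 * M), by positivity, fun F V D hF hV hVF ε hε => ?_⟩
  set δ₀ : ℝ := 1 / (8 * M) with hδ₀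
  have hδ₀0 : 0 < δ₀ := by positivity
  have hMδ : M * δ₀ = 1 / 8 := by
    rw [hδ₀]
    field_simp
  obtain ⟨w₀, hw₀, hVw⟩ := hV.2.exists_mWienerLE
  set w := N * (w₀ * δ₀) + w₀ with hw
  have hw0 : 0 ≤ w := by positivity
  have hFw : MWienerLE w F := ((hVw.mul hVF).add hVw).congr fun t => by
    rw [mul_sub, ← mul_assoc, specialUnitary_mul_conjTranspose (hV.1 t), one_mul, mul_one,
      sub_add_cancel]
  obtain ⟨c, hc1, hc⟩ := exists_perturbation_bound N hw0
  have hsmall : ∃ μ : ℝ, 0 < μ ∧ c * μ ≤ 1 ∧ N * (w₀ * μ) ≤ δ₀ ∧ c * μ ≤ δ₀ ∧ c * μ ≤ ε / 16 ∧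
      N * (c * μ) ≤ 1 / 2 := by
    have ht : ∀ k b : ℝ, 0 < b → ∀ᶠ μ in nhdsWithin (0 : ℝ) (Set.Ioi 0), k * μ ≤ b := by
      intro k b hb
      have : Filter.Tendsto (fun μ : ℝ => k * μ) (nhdsWithin 0 (Set.Ioi 0)) (nhds (k * 0)) :=
        (Filter.tendsto_id.mono_left nhdsWithin_le_nhds).const_mul k
      rw [mul_zero] at this
      exact (this.eventually_lt_const hb).mono fun _ h => h.le
    have hpos : ∀ᶠ μ in nhdsWithin (0 : ℝ) (Set.Ioi 0), 0 < μ := self_mem_nhdsWithin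
    obtain ⟨μ, h0, h1, h2, h3, h4, h5⟩ := (hpos.and ((ht c 1 one_pos).and
      ((ht (N * w₀) δ₀ hδ₀0).and ((ht c δ₀ hδ₀0).and
      ((ht c (ε / 16) (by positivity)).and (ht (N * c) (1 / 2) (by norm_num))))))).exists
    exact ⟨μ, h0, h1, by linarith, h3, h4, by linarith⟩
  obtain ⟨μ, hμ0, h1, h2, h3, h4, h5⟩ := hsmall
  obtain ⟨K, P, hPK, hPF⟩ := hFw.exists_trigPoly hμ0
  obtain ⟨hFP, hPP, hPd⟩ := hc F P μ hμ0.le hF hFw hPF h1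
  have hVP : MWienerLE (2 * δ₀) (fun t => (V t)ᴴ * P t - 1) := by
    refine ((hVF.add (hVw.conjTranspose.mul hPF)).mono (by linarith)).congr fun t => ?_
    rw [mul_sub]
    abel
  obtain ⟨J, hJ⟩ := exists_pow_lt_of_lt_one (show 0 < ε / 16 / (2 * δ₀) by positivity)
    (show (1 / 2 : ℝ) < 1 by norm_num)
  obtain ⟨D', V', hV', -, hV'P⟩ := (hM D K V P (2 * δ₀) (c * μ) (1 / 2) hV hPK hVP hPP hPd le_rfl
    (by nlinarith) J).1
  rw [lt_div_iff₀ (by positivity)] at hJ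
  obtain ⟨w', hw', hV'w⟩ := hV'.2.exists_mWienerLE
  refine ⟨D', V', hV', ?_⟩
  refine hV'P.absorb hFP ((hV'w.conjTranspose.mul hFw).sub (MWienerLE.one N)) (fun t => ?_)
    h5 (by nlinarith)
  rw [Matrix.mul_sub, mul_one, mul_assoc, ← mul_assoc (F t),
    specialUnitary_mul_conjTranspose (hF t), one_mul]
  abel

end LoopApprox

namespace LoopApprox

open Matrix Filter Topology

lemma eventually_wienerLE {φ : ℝ × ℝ → ℂ} (hφ : ContDiff ℝ 1 φ)
    (hp : ∀ s, Function.Periodic (fun t => φ (s, t)) (2 * π)) {s₀ : ℝ} (h0 : ∀ t, φ (s₀, t) = 0)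
    {ε : ℝ} (hε : 0 < ε) : ∀ᶠ s in 𝓝 s₀, WienerLE ε (fun t => φ (s, t)) := by
  obtain ⟨C, hC, hW⟩ := exists_wienerLE_of_lipschitz
  set a : ℝ := ε / (C + 1) with ha
  have ha0 : 0 < a := by positivity
  have haC : C * a ≤ ε := by
    rw [ha, mul_div_assoc', div_le_iff₀ (by positivity)]
    nlinarith
  set g : ℝ × ℝ → ℂ := fun x => fderiv ℝ φ x (0, 1) with hg
  have hgc : Continuous g := (hφ.continuous_fderiv one_ne_zero).clm_apply continuous_const
  have hgd : ∀ s t, HasDerivAt (fun t => φ (s, t)) (g (s, t)) t := by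
    intro s t
    have h1 := (hφ.differentiable one_ne_zero (s, t)).hasFDerivAt
    have h2 : HasDerivAt (fun t : ℝ => (s, t)) (0, 1) t :=
      (hasDerivAt_const t s).prodMk (hasDerivAt_id t)
    exact h1.comp_hasDerivAt t h2
  have hgp : ∀ s, Function.Periodic (fun t => g (s, t)) (2 * π) := by
    intro s t
    have h1 := (hgd s (t + 2 * π)).comp_add_const t (2 * π)
    simp only [hp s _] at h1
    exact h1.unique (hgd s t)
  have hg0 : ∀ t, g (s₀, t) = 0 := by
    intro t
    have h1 := hgd s₀ t
    simp only [h0] at h1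
    exact h1.unique (hasDerivAt_const t 0)
  have hev : ∀ᶠ s in 𝓝 s₀, ∀ t ∈ Set.Icc 0 (2 * π), ‖φ (s, t)‖ < a ∧ ‖g (s, t)‖ < a := by
    refine isCompact_Icc.eventually_forall_of_forall_eventually fun t _ => ?_
    have h1 : Tendsto (fun x => ‖φ x‖) (𝓝 (s₀, t)) (𝓝 ‖φ (s₀, t)‖) := hφ.continuous.norm.tendsto _
    have h2 : Tendsto (fun x => ‖g x‖) (𝓝 (s₀, t)) (𝓝 ‖g (s₀, t)‖) := hgc.norm.tendsto _
    rw [h0, norm_zero] at h1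
    rw [hg0, norm_zero] at h2
    exact (h1.eventually_lt_const ha0).and (h2.eventually_lt_const ha0)
  filter_upwards [hev] with s hs
  have hall : ∀ t, ‖φ (s, t)‖ ≤ a ∧ ‖g (s, t)‖ ≤ a := by
    intro t
    obtain ⟨y, hy, hy'⟩ := (hp s).exists_mem_Ico₀ Real.two_pi_pos t
    obtain ⟨z, hz, hz'⟩ := (hgp s).exists_mem_Ico₀ Real.two_pi_pos t
    rw [hy', hz']
    exact ⟨(hs y (Set.Ico_subset_Icc_self hy)).1.le, (hs z (Set.Ico_subset_Icc_self hz)).2.le⟩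
  exact (hW a _ (hp s) (fun t => (hall t).1)
    (norm_sub_le_of_hasDerivAt (hgd s) fun t => (hall t).2)).mono haC

variable {N : ℕ}

lemma contDiff_star {E : Type*} [NormedAddCommGroup E] [NormedSpace ℝ E] {f : E → ℂ}
    {n : WithTop ℕ∞} (hf : ContDiff ℝ n f) : ContDiff ℝ n (fun x => star (f x)) :=
  Complex.conjCLE.contDiff.comp hf

/-- Approximability is invariant along smooth paths of loops. -/
lemma isTrigLimit_iff_of_path (hN : 2 ≤ N) {F : ℝ → ℝ → Matrix (Fin N) (Fin N) ℂ}
    (hF : ∀ s t, F s t ∈ SpecialUnitary N)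
    (hp : ∀ s, Function.Periodic (F s) (2 * π))
    (hc : ∀ i j, ContDiff ℝ 1 (fun x : ℝ × ℝ => F x.1 x.2 i j)) :
    IsTrigLimit (F 0) ↔ IsTrigLimit (F 1) := by
  obtain ⟨δ₀, hδ₀, hnear⟩ := exists_isTrigLimit_of_near hN
  set ε : ℝ := min 1 (δ₀ / (N + 2)) with hε
  have hε0 : 0 < ε := by positivity
  have hε1 : ε ≤ 1 := min_le_left _ _
  have hεδ : ε * (N + 2) ≤ δ₀ := by
    rw [← le_div_iff₀ (by positivity)]
    exact min_le_right _ _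
  have transfer : ∀ A B : ℝ → Matrix (Fin N) (Fin N) ℂ, (∀ t, A t ∈ SpecialUnitary N) →
      (∀ t, B t ∈ SpecialUnitary N) → MWienerLE ε (fun t => (A t)ᴴ * B t - 1) →
      IsTrigLimit A → IsTrigLimit B := by
    intro A B hA hB hAB hlim
    obtain ⟨D, V, hV, hVA⟩ := hlim ε hε0
    refine hnear B V D hB hV ((((hVA.add hAB).add (hVA.mul hAB)).mono ?_).congr fun t => ?_)
    · have hN0 : (0 : ℝ) ≤ N := by positivity
      nlinarith [mul_nonneg hN0 hε0.le, mul_nonneg (mul_nonneg hN0 hε0.le) (sub_nonneg.2 hε1)]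
    · have h1 : (V t)ᴴ * A t * ((A t)ᴴ * B t) = (V t)ᴴ * B t := by
        rw [mul_assoc, ← mul_assoc (A t), specialUnitary_mul_conjTranspose (hA t), one_mul]
      rw [Matrix.sub_mul, Matrix.mul_sub, h1]
      simp only [one_mul, mul_one]
      abel
  have hloc : IsLocallyConstant (fun s => IsTrigLimit (F s)) := by
    rw [IsLocallyConstant.iff_eventually_eq]
    intro s₀
    have hev : ∀ᶠ s in 𝓝 s₀, MWienerLE ε (fun t => (F s₀ t)ᴴ * F s t - 1) := by
      simp only [MWienerLE, eventually_all]
      intro i j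
      refine eventually_wienerLE (φ := fun x => ((F s₀ x.2)ᴴ * F x.1 x.2 - 1) i j) ?_ ?_ ?_ hε0
      · simp only [Matrix.sub_apply, Matrix.mul_apply, conjTranspose_apply]
        refine ContDiff.sub (ContDiff.sum fun k _ => ContDiff.mul (contDiff_star ?_) (hc k j))
          contDiff_const
        exact (hc k i).comp (contDiff_const.prodMk contDiff_snd)
      · intro s t
        simp only [hp s₀ t, hp s t]
      · intro t
        simp [specialUnitary_conjTranspose_mul (hF s₀ t)]
    filter_upwards [hev] with s hs
    refine propext ⟨transfer _ _ (hF s) (hF s₀) ?_, transfer _ _ (hF s₀) (hF s) hs⟩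
    exact hs.conjTranspose.congr fun t => by simp
  exact iff_of_eq (hloc.apply_eq_of_preconnectedSpace 0 1)

end LoopApprox

namespace LoopApprox

open Matrix

/-- A continuously differentiable loop in `SU(N)`. -/
structure IsSmoothLoop {N : ℕ} (G : ℝ → Matrix (Fin N) (Fin N) ℂ) : Prop where
  mem : ∀ t, G t ∈ SpecialUnitary N
  periodic : Function.Periodic G (2 * π)
  contDiff : ∀ i j, ContDiff ℝ 1 (fun t => G t i j)

section

variable {N : ℕ}

lemma row_eq_of_column_eq {A : Matrix (Fin N) (Fin N) ℂ} (hA : A ∈ SpecialUnitary N) {i : Fin N}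
    (h : ∀ l, A l i = (1 : Matrix (Fin N) (Fin N) ℂ) l i) (j : Fin N) :
    A i j = (1 : Matrix (Fin N) (Fin N) ℂ) i j := by
  have h1 := congrFun (congrFun (specialUnitary_conjTranspose_mul hA) i) j
  simpa [Matrix.mul_apply, h, Matrix.one_apply] using h1

lemma sum_star_mul_column {A : Matrix (Fin N) (Fin N) ℂ} (hA : A ∈ SpecialUnitary N) (k : Fin N) :
    ∑ j, star (A j k) * A j k = 1 := by
  have h1 := congrFun (congrFun (specialUnitary_conjTranspose_mul hA) k) k
  simpa [Matrix.mul_apply] using h1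

lemma star_mul_self_eq (z : ℂ) : star z * z = ((‖z‖ ^ 2 : ℝ) : ℂ) := by
  rw [mul_comm, Complex.star_def, Complex.mul_conj, Complex.normSq_eq_norm_sq]

lemma sum_star_sub_mul {u v : Fin N → ℂ} (hu : ∑ j, star (u j) * u j = 1)
    (hv : ∑ j, star (v j) * v j = 1) :
    ∑ j, star (v j - (∑ l, star (u l) * v l) * u j) * (v j - (∑ l, star (u l) * v l) * u j) =
      ((1 - ‖∑ l, star (u l) * v l‖ ^ 2 : ℝ) : ℂ) := by
  set p := ∑ l, star (u l) * v l with hp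
  have hp' : ∑ l, star (v l) * u l = star p := by
    rw [hp, star_sum]
    exact Finset.sum_congr rfl fun l _ => by rw [star_mul', star_star, mul_comm]
  have : ∀ j, star (v j - p * u j) * (v j - p * u j) = star (v j) * v j - p * (star (v j) * u j) -
      star p * (star (u j) * v j) + star p * p * (star (u j) * u j) := by
    intro j
    rw [star_sub, star_mul']
    ring
  simp only [this, Finset.sum_add_distrib, Finset.sum_sub_distrib, ← Finset.mul_sum, hu, hv, hp',
    ← hp]
  have h := star_mul_self_eq p
  push_cast at h ⊢
  linear_combination -h

lemma contDiff_mul_entry {E : Type*} [NormedAddCommGroup E] [NormedSpace ℝ E] {l m n : ℕ}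
    {A : E → Matrix (Fin l) (Fin m) ℂ} {B : E → Matrix (Fin m) (Fin n) ℂ}
    (hA : ∀ i j, ContDiff ℝ 1 (fun x => A x i j)) (hB : ∀ i j, ContDiff ℝ 1 (fun x => B x i j))
    (i : Fin l) (j : Fin n) : ContDiff ℝ 1 (fun x => (A x * B x) i j) := by
  simp only [Matrix.mul_apply]
  exact ContDiff.sum fun k _ => (hA i k).mul (hB k j)

/-- Completing a smooth unit vector `u` to an orthonormal pair whose span contains `v`. -/
lemma exists_orthonormal_completion {u : ℝ → Fin N → ℂ} {v : Fin N → ℂ} {p : ℝ → ℂ}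
    (huc : ∀ j, ContDiff ℝ 1 (fun t => u t j)) (hup : Function.Periodic u (2 * π))
    (huu : ∀ t, ∑ j, star (u t j) * u t j = 1) (hv : ∑ j, star (v j) * v j = 1)
    (hp : ∀ t, p t = ∑ j, star (u t j) * v j) (hpc : ContDiff ℝ 1 p) (hlt : ∀ t, ‖p t‖ < 1) :
    ∃ (q : ℝ → ℝ) (y : ℝ → Fin N → ℂ), (∀ t, 0 < q t) ∧ (∀ t, q t ^ 2 = 1 - ‖p t‖ ^ 2) ∧
      ContDiff ℝ 1 q ∧ (∀ j, ContDiff ℝ 1 (fun t => y t j)) ∧ Function.Periodic q (2 * π) ∧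
      Function.Periodic y (2 * π) ∧ (∀ t j, v j = p t * u t j + q t * y t j) ∧
      (∀ t, ∑ j, star (u t j) * y t j = 0) ∧ (∀ t, ∑ j, star (y t j) * u t j = 0) ∧
      (∀ t, ∑ j, star (y t j) * y t j = 1) := by
  have hp1 : ∀ t, 0 < 1 - ‖p t‖ ^ 2 := fun t => by nlinarith [hlt t, norm_nonneg (p t)]
  have hpp : ∀ t, p (t + 2 * π) = p t := fun t => by simp only [hp, hup t]
  obtain ⟨q, hq⟩ : ∃ q : ℝ → ℝ, ∀ t, q t = √(1 - ‖p t‖ ^ 2) := ⟨_, fun _ => rfl⟩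
  have hq0 : ∀ t, 0 < q t := fun t => (hq t).symm ▸ Real.sqrt_pos.2 (hp1 t)
  have hq2 : ∀ t, q t ^ 2 = 1 - ‖p t‖ ^ 2 := fun t => (hq t).symm ▸ Real.sq_sqrt (hp1 t).le
  have hqc : ContDiff ℝ 1 q := (funext hq).symm ▸
    (contDiff_const.sub (hpc.norm_sq ℝ)).sqrt fun t => (hp1 t).ne'
  have hqp : ∀ t, q (t + 2 * π) = q t := fun t => by simp only [hq, hpp t]
  obtain ⟨y, hy⟩ : ∃ y : ℝ → Fin N → ℂ,
    ∀ t j, y t j = (v j - p t * u t j) * (((q t)⁻¹ : ℝ) : ℂ) := ⟨_, fun _ _ => rfl⟩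
  have huy : ∀ t, ∑ j, star (u t j) * y t j = 0 := by
    intro t
    have h1 : ∀ j, star (u t j) * y t j =
        (star (u t j) * v j - p t * (star (u t j) * u t j)) * (((q t)⁻¹ : ℝ) : ℂ) := fun j => by
      rw [hy]
      ring
    simp only [h1, ← Finset.sum_mul, Finset.sum_sub_distrib, ← Finset.mul_sum, huu]
    rw [← hp]
    simp
  refine ⟨q, y, hq0, hq2, hqc, fun j => ?_, hqp, fun t => ?_, fun t j => ?_, huy, fun t => ?_,
    fun t => ?_⟩
  · simp only [hy]
    exact (contDiff_const.sub (hpc.mul (huc j))).mul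
      (Complex.ofRealCLM.contDiff.comp (hqc.inv fun t => (hq0 t).ne'))
  · ext j
    simp only [hy, hpp t, hqp t, hup t]
  · have hqne : (q t : ℂ) ≠ 0 := by exact_mod_cast (hq0 t).ne'
    rw [hy]
    push_cast
    field_simp
    ring
  · have := congrArg star (huy t)
    rw [star_sum, star_zero] at this
    rw [← this]
    exact Finset.sum_congr rfl fun j _ => by rw [star_mul', star_star, mul_comm]
  · have h1 : ∀ j, star (y t j) * y t j = star (v j - p t * u t j) * (v j - p t * u t j) *
        ((((q t)⁻¹) ^ 2 : ℝ) : ℂ) := by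
      intro j
      have hr : star (((q t)⁻¹ : ℝ) : ℂ) = (((q t)⁻¹ : ℝ) : ℂ) := Complex.conj_ofReal _
      rw [hy, star_mul', hr]
      push_cast
      ring
    have h2 := sum_star_sub_mul (huu t) hv
    rw [← hp, ← hq2] at h2
    simp only [h1, ← Finset.sum_mul]
    rw [h2, ← Complex.ofReal_mul, ← mul_pow, mul_inv_cancel₀ (hq0 t).ne']
    simp

/-- A smooth path in `SU(2)` from the identity to a matrix with prescribed first column. -/
lemma exists_path_specialUnitary_two {p : ℝ → ℂ} {q : ℝ → ℝ} (hpc : ContDiff ℝ 1 p)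
    (hqc : ContDiff ℝ 1 q) (hq0 : ∀ t, 0 < q t) (hq2 : ∀ t, q t ^ 2 = 1 - ‖p t‖ ^ 2) :
    ∃ M : ℝ → ℝ → Matrix (Fin 2) (Fin 2) ℂ, (∀ s t, M s t ∈ SpecialUnitary 2) ∧
      (∀ i j, ContDiff ℝ 1 (fun x : ℝ × ℝ => M x.1 x.2 i j)) ∧
      (∀ s t t', p t = p t' → q t = q t' → M s t = M s t') ∧ (∀ t, M 0 t = 1) ∧
      ∀ t, M 1 t 0 0 = p t ∧ M 1 t 1 0 = q t := by
  obtain ⟨b, hb⟩ : ∃ b : ℝ → ℝ → ℂ, ∀ s t, b s t = 1 - s + s * p t := ⟨_, fun _ _ => rfl⟩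
  have hρ0 : ∀ s t, 0 < ‖b s t‖ ^ 2 + (s * q t) ^ 2 := by
    intro s t
    rcases eq_or_ne s 0 with rfl | hs
    · simp [hb]
    · have := hq0 t
      have : 0 < (s * q t) ^ 2 := by positivity
      positivity
  obtain ⟨ρ, hρ⟩ : ∃ ρ : ℝ → ℝ → ℝ, ∀ s t, ρ s t = √(‖b s t‖ ^ 2 + (s * q t) ^ 2) :=
    ⟨_, fun _ _ => rfl⟩
  have hρpos : ∀ s t, 0 < ρ s t := fun s t => (hρ s t).symm ▸ Real.sqrt_pos.2 (hρ0 s t)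
  have hρ2 : ∀ s t, ρ s t ^ 2 = ‖b s t‖ ^ 2 + (s * q t) ^ 2 := fun s t =>
    (hρ s t).symm ▸ Real.sq_sqrt (hρ0 s t).le
  have hbc : ContDiff ℝ 1 (fun x : ℝ × ℝ => b x.1 x.2) := by
    simp only [hb]
    exact (contDiff_const.sub (Complex.ofRealCLM.contDiff.comp contDiff_fst)).add
      ((Complex.ofRealCLM.contDiff.comp contDiff_fst).mul (hpc.comp contDiff_snd))
  have hsq : ContDiff ℝ 1 (fun x : ℝ × ℝ => x.1 * q x.2) :=
    contDiff_fst.mul (hqc.comp contDiff_snd)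
  have hρc : ContDiff ℝ 1 (fun x : ℝ × ℝ => ρ x.1 x.2) := by
    simp only [hρ]
    exact ((hbc.norm_sq ℝ).add (hsq.pow 2)).sqrt fun x => (hρ0 x.1 x.2).ne'
  have hρi := hρc.inv fun x => (hρpos x.1 x.2).ne'
  obtain ⟨a, ha⟩ : ∃ a : ℝ → ℝ → ℂ, ∀ s t, a s t = b s t * (((ρ s t)⁻¹ : ℝ) : ℂ) :=
    ⟨_, fun _ _ => rfl⟩
  obtain ⟨d, hd⟩ : ∃ d : ℝ → ℝ → ℂ, ∀ s t, d s t = ((-(s * q t * (ρ s t)⁻¹) : ℝ) : ℂ) :=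
    ⟨_, fun _ _ => rfl⟩
  have hac : ContDiff ℝ 1 (fun x : ℝ × ℝ => a x.1 x.2) := by
    simp only [ha]
    exact hbc.mul (Complex.ofRealCLM.contDiff.comp hρi)
  have hdc : ContDiff ℝ 1 (fun x : ℝ × ℝ => d x.1 x.2) := by
    simp only [hd]
    exact Complex.ofRealCLM.contDiff.comp (hsq.mul hρi).neg
  refine ⟨fun s t => !![a s t, d s t; -star (d s t), star (a s t)], fun s t => su_two_mem ?_,
    fun i j => ?_, fun s t t' h h' => ?_, fun t => ?_, fun t => ?_⟩
  · rw [ha, hd, norm_mul, Complex.norm_real, Complex.norm_real, norm_neg, Real.norm_eq_abs,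
      Real.norm_eq_abs, mul_pow, sq_abs, sq_abs, mul_pow (s * q t), ← add_mul, ← hρ2, ← mul_pow,
      mul_inv_cancel₀ (hρpos s t).ne', one_pow]
  · fin_cases i <;> fin_cases j
    · exact hac
    · exact hdc
    · exact (contDiff_star hdc).neg
    · exact contDiff_star hac
  · simp only [ha, hd, hρ, hb, h, h']
  · have h1 : ρ 0 t = 1 := by simp [hρ, hb]
    ext i j
    fin_cases i <;> fin_cases j <;> simp [ha, hd, h1, hb]
  · have h1 : ρ 1 t = 1 := by
      rw [hρ, hb, one_mul, hq2]
      simp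
    have h2 : star (d 1 t) = -(q t : ℂ) := by
      simp [hd, h1]
    exact ⟨by simp [ha, h1, hb], by simp [h2]⟩

/-- A column of a smooth loop can be deformed to a constant vector which is nowhere proportional
to it. -/
lemma IsSmoothLoop.exists_column_eq (hN : 2 ≤ N) {G : ℝ → Matrix (Fin N) (Fin N) ℂ}
    (hG : IsSmoothLoop G) (k : Fin N) (hfix : ∀ t, ∀ i < k, ∀ j, G t j i = (1 : Matrix _ _ ℂ) j i)
    {v : Fin N → ℂ} (hv : ∑ j, star (v j) * v j = 1) (hv0 : ∀ i < k, v i = 0)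
    (hlt : ∀ t, ‖∑ j, star (G t j k) * v j‖ < 1) :
    ∃ G' : ℝ → Matrix (Fin N) (Fin N) ℂ, IsSmoothLoop G' ∧
      (∀ t, ∀ i < k, ∀ j, G' t j i = (1 : Matrix _ _ ℂ) j i) ∧ (∀ t j, G' t j k = v j) ∧
      (IsTrigLimit G ↔ IsTrigLimit G') := by
  have hGp := hG.periodic
  have huu := fun t => sum_star_mul_column (hG.mem t) k
  obtain ⟨p, hp⟩ : ∃ p : ℝ → ℂ, ∀ t, p t = ∑ j, star (G t j k) * v j := ⟨_, fun _ => rfl⟩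
  have hpc : ContDiff ℝ 1 p := by
    rw [funext hp]
    exact ContDiff.sum fun j _ => (contDiff_star (hG.contDiff j k)).mul contDiff_const
  have hpp : ∀ t, p (t + 2 * π) = p t := fun t => by simp only [hp, hGp t]
  obtain ⟨q, y, hq0, hq2, hqc, hyc, hqp, hyp, hvy, huy, hyu, hyy⟩ := exists_orthonormal_completion
    (u := fun t j => G t j k) (fun j => hG.contDiff j k) (fun t => by simp only [hGp t]) huu hv hp
    hpc (fun t => (hp t).symm ▸ hlt t)
  obtain ⟨M, hMmem, hMc, hMp, hM0, hM1⟩ := exists_path_specialUnitary_two hpc hqc hq0 hq2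
  obtain ⟨Z, hZ0, hZ1, hZp⟩ : ∃ Z : ℝ → Matrix (Fin N) (Fin 2) ℂ, (∀ t j, Z t j 0 = G t j k) ∧
      (∀ t j, Z t j 1 = y t j) ∧ Function.Periodic Z (2 * π) :=
    ⟨fun t => Matrix.of fun j => ![G t j k, y t j], fun _ _ => rfl, fun _ _ => rfl,
      fun t => by simp only [hGp t, hyp t]⟩
  have hZc : ∀ i c, ContDiff ℝ 1 (fun x : ℝ × ℝ => Z x.2 i c) := by
    intro i c
    fin_cases c
    · simp only [Fin.zero_eta, hZ0]
      exact (hG.contDiff i k).comp contDiff_snd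
    · simp only [Fin.mk_one, hZ1]
      exact (hyc i).comp contDiff_snd
  have hZZ : ∀ t, (Z t)ᴴ * Z t = 1 := by
    intro t
    ext c d
    rw [Matrix.mul_apply]
    fin_cases c <;> fin_cases d <;> simp [-Complex.star_def, -RCLike.star_def, hZ0, hZ1, huu t,
      huy t, hyu t, hyy t]
  obtain ⟨F, hF⟩ : ∃ F : ℝ → ℝ → Matrix (Fin N) (Fin N) ℂ,
    ∀ s t, F s t = planeEmbed (Z t) (M s t) * G t := ⟨_, fun _ _ => rfl⟩
  have hFp : ∀ s, Function.Periodic (F s) (2 * π) := fun s t => by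
    rw [hF, hF, hGp t, hZp t, hMp s _ t (hpp t) (hqp t)]
  have hFm : ∀ s t, F s t ∈ SpecialUnitary N := fun s t => by
    rw [hF]
    exact specialUnitary_mul (planeEmbed_mem (hZZ t) (hMmem s t)) (hG.mem t)
  have hFc : ∀ i j, ContDiff ℝ 1 (fun x : ℝ × ℝ => F x.1 x.2 i j) := by
    simp only [hF]
    refine contDiff_mul_entry (A := fun x : ℝ × ℝ => planeEmbed (Z x.2) (M x.1 x.2))
      (B := fun x => G x.2) (fun i j => ?_) fun i j => (hG.contDiff i j).comp contDiff_snd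
    simp only [planeEmbed, Matrix.add_apply]
    refine contDiff_const.add (contDiff_mul_entry (A := fun x : ℝ × ℝ => Z x.2 * (M x.1 x.2 - 1))
      (B := fun x => (Z x.2)ᴴ) (contDiff_mul_entry hZc fun i j => ?_) (fun i j => ?_) i j)
    · exact (hMc i j).sub contDiff_const
    · exact contDiff_star (hZc j i)
  have hF0 : F 0 = G := by
    ext1 t
    simp [hF, hM0, planeEmbed]
  have hFfix : ∀ s t, ∀ i < k, ∀ j, F s t j i = (1 : Matrix _ _ ℂ) j i := by
    intro s t i hi j
    have hGi : G t i k = 0 := by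
      rw [row_eq_of_column_eq (hG.mem t) (hfix t i hi), Matrix.one_apply_ne hi.ne]
    have hyi : y t i = 0 := by
      have h1 := hvy t i
      have hqne : (q t : ℂ) ≠ 0 := by exact_mod_cast (hq0 t).ne'
      rw [hv0 i hi, hGi, mul_zero, zero_add] at h1
      exact (mul_eq_zero.1 h1.symm).resolve_left hqne
    have hZi : ∀ c, Z t i c = 0 := by
      intro c
      fin_cases c
      · exact (hZ0 t i).trans hGi
      · exact (hZ1 t i).trans hyi
    have h1 : F s t j i = planeEmbed (Z t) (M s t) j i := by
      rw [hF, Matrix.mul_apply]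
      simp only [hfix t i hi]
      rw [← Matrix.mul_apply, mul_one]
    rw [h1, planeEmbed, Matrix.add_apply, Matrix.mul_apply]
    simp [hZi]
  refine ⟨F 1, ⟨hFm 1, hFp 1, fun i j => (hFc i j).comp (contDiff_const.prodMk contDiff_id)⟩,
    hFfix 1, fun t j => ?_, ?_⟩
  · have hZu : ∀ c, ((Z t)ᴴ * G t) c k = (1 : Matrix (Fin 2) (Fin 2) ℂ) c 0 := by
      intro c
      rw [← hZZ t, Matrix.mul_apply, Matrix.mul_apply]
      simp only [hZ0]
    have h1 : F 1 t j k = G t j k +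
        ∑ c, (Z t * (M 1 t - 1) : Matrix (Fin N) (Fin 2) ℂ) j c * ((Z t)ᴴ * G t) c k := by
      rw [hF, planeEmbed, Matrix.add_mul, one_mul, Matrix.add_apply, Matrix.mul_assoc,
        Matrix.mul_apply (M := Z t * (M 1 t - 1))]
    rw [h1]
    simp only [hZu]
    rw [Fin.sum_univ_two, Matrix.mul_apply, Fin.sum_univ_two, hvy t j]
    simp only [Matrix.sub_apply, (hM1 t).1, (hM1 t).2, hZ0, hZ1, Matrix.one_apply_eq,
      Matrix.one_apply_ne (show (1 : Fin 2) ≠ 0 by decide)]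
    ring
  · rw [← isTrigLimit_iff_of_path hN hFm hFp hFc, hF0]

end

end LoopApprox

namespace LoopApprox

/-- Unit vectors of `ℂ²` avoiding the complex lines spanned by a smooth curve. -/
lemma exists_unit_notMem_line {a b : ℝ → ℂ} (ha : ContDiff ℝ 1 a) (hb : ContDiff ℝ 1 b) :
    ∃ x y : ℂ, star x * x + star y * y = 1 ∧ y ≠ 0 ∧
      ∀ t z, ¬ (x = z * a t ∧ y = z * b t) := by
  have hd : Dense (Set.range fun w : ℂ × ℝ => (w.1 * a w.2, w.1 * b w.2))ᶜ := by
    refine ContDiff.dense_compl_range_of_finrank_lt_finrank (ContDiff.prodMk ?_ ?_) ?_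
    · exact contDiff_fst.mul (ha.comp contDiff_snd)
    · exact contDiff_fst.mul (hb.comp contDiff_snd)
    · simp [Complex.finrank_real_complex]
  have ho : IsOpen {X : ℂ × ℂ | X.2 ≠ 0} := isOpen_ne.preimage continuous_snd
  obtain ⟨X, hX, hX'⟩ := hd.inter_open_nonempty _ ho ⟨(1, 1), by simp⟩
  have hX0 : X.2 ≠ 0 := hX
  obtain ⟨c, hc0, hc⟩ : ∃ c : ℝ, 0 < c ∧ c ^ 2 = ‖X.1‖ ^ 2 + ‖X.2‖ ^ 2 := by
    have : 0 < ‖X.1‖ ^ 2 + ‖X.2‖ ^ 2 := by positivity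
    exact ⟨_, Real.sqrt_pos.2 this, Real.sq_sqrt this.le⟩
  have hcc : (c : ℂ) ≠ 0 := by exact_mod_cast hc0.ne'
  refine ⟨X.1 / c, X.2 / c, ?_, div_ne_zero hX0 hcc, fun t z h => hX' ⟨(c * z, t), ?_⟩⟩
  · rw [star_mul_self_eq, star_mul_self_eq, norm_div, norm_div, Complex.norm_of_nonneg hc0.le,
      ← Complex.ofReal_add, div_pow, div_pow, ← add_div, ← hc, div_self (by positivity),
      Complex.ofReal_one]
  · refine Prod.ext ?_ ?_
    · have := h.1
      rw [div_eq_iff hcc] at this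
      simp only [this]
      ring
    · have := h.2
      rw [div_eq_iff hcc] at this
      simp only [this]
      ring

variable {N : ℕ}

lemma eq_one_of_columns_eq {A : Matrix (Fin N) (Fin N) ℂ} (hA : A ∈ SpecialUnitary N) (l : Fin N)
    (h : ∀ i ≠ l, ∀ j, A j i = (1 : Matrix (Fin N) (Fin N) ℂ) j i) : A = 1 := by
  have hd : A = Matrix.diagonal fun i => A i i := by
    ext i j
    rw [Matrix.diagonal_apply]
    split_ifs with hij
    · rw [hij]
    · by_cases hj : j = l
      · rw [row_eq_of_column_eq hA (h i fun hi => hij (hi.trans hj.symm)), Matrix.one_apply_ne hij]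
      · rw [h j hj, Matrix.one_apply_ne hij]
  have hdet := hA.2
  rw [hd, Matrix.det_diagonal, Finset.prod_eq_single l
    (fun i _ hi => by rw [h i hi, Matrix.one_apply_eq]) (by simp)] at hdet
  ext i j
  by_cases hj : j = l
  · by_cases hi : i = l
    · rw [hi, hj, hdet, Matrix.one_apply_eq]
    · exact row_eq_of_column_eq hA (h i hi) j
  · exact h j hj i

lemma IsTrigLimit.one : IsTrigLimit (fun _ => (1 : Matrix (Fin N) (Fin N) ℂ)) := fun ε hε =>
  ⟨0, fun _ => 1, isTrigLoop_one 0, by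
    simpa using MWienerLE.const (0 : Matrix (Fin N) (Fin N) ℂ) (fun _ _ => by simpa using hε.le)⟩

lemma norm_inner_lt_one {u v : Fin N → ℂ} (hu : ∑ j, star (u j) * u j = 1)
    (hv : ∑ j, star (v j) * v j = 1) (h : ∀ z, v ≠ fun j => z * u j) :
    ‖∑ j, star (u j) * v j‖ < 1 := by
  set p := ∑ j, star (u j) * v j with hp
  by_contra! h1
  have hs := sum_star_sub_mul hu hv
  simp only [star_mul_self_eq, ← hp] at hs
  have hs' : ∑ j, ‖v j - p * u j‖ ^ 2 = 1 - ‖p‖ ^ 2 := by exact_mod_cast hs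
  have h0 : ∑ j, ‖v j - p * u j‖ ^ 2 = 0 :=
    le_antisymm (by nlinarith) (Finset.sum_nonneg fun _ _ => sq_nonneg _)
  rw [Finset.sum_eq_zero_iff_of_nonneg fun _ _ => sq_nonneg _] at h0
  refine h p (funext fun j => ?_)
  have := h0 j (Finset.mem_univ j)
  rwa [sq_eq_zero_iff, norm_eq_zero, sub_eq_zero] at this

/-- Polynomial loops are dense in the continuously differentiable loops. -/
theorem IsSmoothLoop.isTrigLimit (hN : 2 ≤ N) {G : ℝ → Matrix (Fin N) (Fin N) ℂ}
    (hG : IsSmoothLoop G) : IsTrigLimit G := by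
  suffices H : ∀ m k : ℕ, k + m + 1 = N → ∀ G : ℝ → Matrix (Fin N) (Fin N) ℂ, IsSmoothLoop G →
      (∀ t, ∀ i : Fin N, (i : ℕ) < k → ∀ j, G t j i = (1 : Matrix (Fin N) (Fin N) ℂ) j i) →
      IsTrigLimit G from
    H (N - 1) 0 (by omega) G hG fun _ i hi => absurd hi (Nat.not_lt_zero _)
  intro m
  induction m with
  | zero =>
    intro k hk G hG hfix
    have : G = fun _ => 1 := funext fun t => eq_one_of_columns_eq (hG.mem t) ⟨k, by omega⟩
      fun i hi j => hfix t i (by have := Fin.val_ne_of_ne hi; simp at this; omega) j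
    rw [this]
    exact IsTrigLimit.one
  | succ m ih =>
    intro k hk G hG hfix
    obtain ⟨k0, hk0⟩ : ∃ i : Fin N, (i : ℕ) = k := ⟨⟨k, by omega⟩, rfl⟩
    obtain ⟨k1, hk1⟩ : ∃ i : Fin N, (i : ℕ) = k + 1 := ⟨⟨k + 1, by omega⟩, rfl⟩
    have hne : k0 ≠ k1 := fun h => by rw [h] at hk0; omega
    obtain ⟨x, y, hxy, hy0, hline⟩ :=
      exists_unit_notMem_line (hG.contDiff k0 k0) (hG.contDiff k1 k0)
    obtain ⟨v, hv⟩ : ∃ v : Fin N → ℂ, ∀ j, v j = if j = k0 then x else if j = k1 then y else 0 :=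
      ⟨_, fun _ => rfl⟩
    have hvk0 : v k0 = x := by simp [hv]
    have hvk1 : v k1 = y := by simp [hv, hne.symm]
    have hvv : ∑ j, star (v j) * v j = 1 := by
      rw [Fintype.sum_eq_add k0 k1 hne, hvk0, hvk1, hxy]
      rintro j ⟨h0, h1⟩
      simp [hv, h0, h1]
    have hlow : ∀ i < k0, i ≠ k0 ∧ i ≠ k1 := fun i hi => by
      have : (i : ℕ) < k0 := hi
      exact ⟨hi.ne, fun h => by rw [h] at this; omega⟩
    have hfix0 : ∀ t, ∀ i < k0, ∀ j, G t j i = (1 : Matrix (Fin N) (Fin N) ℂ) j i :=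
      fun t i hi => hfix t i (hk0 ▸ hi)
    obtain ⟨G₁, hG₁, hfix₁, hcol₁, hiff₁⟩ := hG.exists_column_eq hN k0 hfix0 hvv
      (fun i hi => by simp [hv, hlow i hi]) fun t =>
        norm_inner_lt_one (u := fun j => G t j k0) (sum_star_mul_column (hG.mem t) k0) hvv
          fun z hz => hline t z ⟨hvk0 ▸ congrFun hz k0, hvk1 ▸ congrFun hz k1⟩
    obtain ⟨e, he⟩ : ∃ e : Fin N → ℂ, ∀ j, e j = (1 : Matrix (Fin N) (Fin N) ℂ) j k0 :=
      ⟨_, fun _ => rfl⟩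
    have hee : ∑ j, star (e j) * e j = 1 := by simp [he, Matrix.one_apply]
    obtain ⟨G₂, hG₂, hfix₂, hcol₂, hiff₂⟩ := hG₁.exists_column_eq hN k0 hfix₁ hee
      (fun i hi => by rw [he, Matrix.one_apply_ne hi.ne]) fun t => by
        simp only [hcol₁ t]
        refine norm_inner_lt_one hvv hee fun z hz => ?_
        have h1 := congrFun hz k1
        have h0 := congrFun hz k0
        simp only [he, hvk1, hvk0, Matrix.one_apply_eq, Matrix.one_apply_ne hne.symm] at h1 h0
        rcases mul_eq_zero.1 h1.symm with h | h
        · simp [h] at h0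
        · exact hy0 h
    rw [hiff₁, hiff₂]
    refine ih (k + 1) (by omega) G₂ hG₂ fun t i hi j => ?_
    rcases lt_or_eq_of_le (Nat.lt_succ_iff.1 hi) with h | h
    · exact hfix₂ t i (show (i : ℕ) < k0 by omega) j
    · obtain rfl : i = k0 := Fin.ext (h.trans hk0.symm)
      rw [hcol₂, he]

end LoopApprox

namespace LoopApprox

variable {N : ℕ}

lemma norm_apply_le_specNorm (A : Matrix (Fin N) (Fin N) ℂ) (i j : Fin N) :
    ‖A i j‖ ≤ specNorm A := by
  have h := (Matrix.toEuclideanCLM (𝕜 := ℂ) A).le_opNorm (EuclideanSpace.single j 1)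
  rw [PiLp.norm_single, norm_one, mul_one] at h
  refine le_trans ?_ ((PiLp.norm_apply_le _ i).trans h)
  rw [Matrix.ofLp_toEuclideanCLM]
  simp

lemma specNorm_le {A : Matrix (Fin N) (Fin N) ℂ} {c : ℝ} (hc : 0 ≤ c)
    (h : ∀ i j, ‖A i j‖ ≤ c) : specNorm A ≤ (N : ℝ) ^ 2 * c := by
  refine ContinuousLinearMap.opNorm_le_bound _ (by positivity) fun x => ?_
  have h1 : ∀ i, ‖(Matrix.toEuclideanCLM (𝕜 := ℂ) A x) i‖ ≤ N * (c * ‖x‖) := by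
    intro i
    rw [Matrix.ofLp_toEuclideanCLM, Matrix.mulVec, dotProduct]
    refine (norm_sum_le_of_le _ fun j _ => ?_).trans (by simp : ∑ _j : Fin N, c * ‖x‖ ≤ _)
    rw [norm_mul]
    exact mul_le_mul (h i j) (PiLp.norm_apply_le x j) (norm_nonneg _) hc
  rw [EuclideanSpace.norm_eq]
  refine Real.sqrt_le_iff.2 ⟨by positivity, ?_⟩
  calc ∑ i, ‖(Matrix.toEuclideanCLM (𝕜 := ℂ) A x) i‖ ^ 2
      ≤ ∑ _i : Fin N, (N * (c * ‖x‖)) ^ 2 :=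
        Finset.sum_le_sum fun i _ => pow_le_pow_left₀ (norm_nonneg _) (h1 i) 2
    _ = N * (N * (c * ‖x‖)) ^ 2 := by simp
    _ ≤ ((N : ℝ) ^ 2 * c * ‖x‖) ^ 2 := by
        rcases Nat.eq_zero_or_pos N with rfl | hN
        · simp
        · have hN' : (1 : ℝ) ≤ N := by exact_mod_cast hN
          have : 0 ≤ (N * (c * ‖x‖)) ^ 2 := by positivity
          calc (N : ℝ) * (N * (c * ‖x‖)) ^ 2 ≤ N * (N * (N * (c * ‖x‖)) ^ 2) := by
                exact mul_le_mul_of_nonneg_left (le_mul_of_one_le_left this hN') (by positivity)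
            _ = _ := by ring

lemma unifNorm_le {F : ℝ → Matrix (Fin N) (Fin N) ℂ} {c : ℝ} (hc : 0 ≤ c)
    (h : ∀ t i j, ‖F t i j‖ ≤ c) : unifNorm F ≤ (N : ℝ) ^ 2 * c :=
  ciSup_le fun t => specNorm_le hc (h t)

lemma periodicHolder_entry {β H : ℝ} (i j : Fin N) :
    ∀ (r : ℕ) {F : ℝ → Matrix (Fin N) (Fin N) ℂ}, ContDiff ℝ (r : ℕ∞) F →
      Function.Periodic F (2 * π) →
      (∀ s t, specNorm (iteratedDeriv r F t - iteratedDeriv r F s) ≤ H * |t - s| ^ β) →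
      PeriodicHolder β H r (fun t => F t i j) := by
  intro r
  have hL : ∀ (G : ℝ → Matrix (Fin N) (Fin N) ℂ) (G' : Matrix (Fin N) (Fin N) ℂ) (x : ℝ),
      HasDerivAt G G' x → HasDerivAt (fun t => G t i j) (G' i j) x := fun G G' x h =>
    hasDerivAt_pi.1 (hasDerivAt_pi.1 h i) j
  induction r with
  | zero =>
    intro F hF hp hH
    refine ⟨(continuous_apply_apply i j).comp hF.continuous, fun t => by simp only [hp t],
      fun x y => ?_⟩
    have := hH y x
    rw [iteratedDeriv_zero] at this
    exact (norm_apply_le_specNorm (F x - F y) i j).trans this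
  | succ r ih =>
    intro F hF hp hH
    have hF' : ContDiff ℝ ((r : WithTop ℕ∞) + 1) F := by exact_mod_cast hF
    rw [contDiff_succ_iff_deriv] at hF'
    refine ⟨fun t => by simp only [hp t], fun t => deriv F t i j,
      fun x => hL _ _ _ (hF'.1 x).hasDerivAt, ih (by exact_mod_cast hF'.2.2) (fun t => ?_) ?_⟩
    · exact (deriv_comp_add_const F (2 * π) t).symm.trans
        (congrArg (fun G => deriv G t) (funext hp))
    · rw [iteratedDeriv_succ'] at hH
      exact hH

lemma contDiff_entry {F : ℝ → Matrix (Fin N) (Fin N) ℂ} (h : ContDiff ℝ 1 F) (i j : Fin N) :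
    ContDiff ℝ 1 (fun t => F t i j) :=
  contDiff_pi.1 (contDiff_pi.1 h i) j

lemma IsTrigLoop.isPolyLoop {D : ℕ} {V : ℝ → Matrix (Fin N) (Fin N) ℂ} (h : IsTrigLoop D V) :
    IsPolyLoop D (SpecialUnitary N) V := by
  refine ⟨?_, h.1⟩
  have h1 : ∀ i j, ∃ c : ℤ → ℂ, ∀ t, V t i j = ∑ k ∈ Finset.Icc (-(D : ℤ)) D, c k * chr k t :=
    fun i j => mem_trigPoly_iff.1 (h.2 i j)
  choose c hc using h1
  refine ⟨fun k => Matrix.of fun i j => c i j k, fun t => ?_⟩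
  ext i j
  rw [hc, Matrix.sum_apply]
  exact Finset.sum_congr rfl fun k _ => mul_comm _ _

end LoopApprox

namespace LoopApprox

/-- Optimising over the two parameters `K` and `J` of an approximation scheme of degree
`L ^ (J + 1) * (D + K + 1)` and error `(K + 1) ^ (-α) + θ ^ (2 * J)`. -/
lemma exists_rate_of_scheme {A : ℕ → ℝ → Prop} {L : ℕ} (hL : 2 ≤ L) {α γ : ℝ} (hγ : 0 < γ)
    (hγα : γ < α) (hmono : ∀ D D' e e', A D e → D ≤ D' → e ≤ e' → A D' e') {e₀ : ℝ}
    (he₀ : 0 < e₀) (h₀ : A 0 e₀)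
    (h : ∀ θ : ℝ, 0 < θ → θ ≤ 1 / 2 → ∃ (D K₀ : ℕ) (C : ℝ), 0 ≤ C ∧ ∀ K, K₀ ≤ K → ∀ J : ℕ,
      A (L ^ (J + 1) * (D + K + 1)) (C * (((K : ℝ) + 1) ^ (-α) + θ ^ (2 * J)))) :
    ∃ C : ℝ, 0 < C ∧ ∀ n : ℕ, A n (C * ((n : ℝ) + 1) ^ (-γ)) := by
  have hα : 0 < α := hγ.trans hγα
  have hL1 : (1 : ℝ) ≤ L := by exact_mod_cast (by omega : 1 ≤ L)
  have hL0 : (0 : ℝ) < L := by linarith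
  obtain ⟨q, hq⟩ := exists_nat_ge (max 2 (α / (α - γ)))
  have hq2 : (2 : ℝ) ≤ q := (le_max_left _ _).trans hq
  have hq0 : (0 : ℝ) < q := by linarith
  have hqγ : γ ≤ α * (1 - 1 / q) := by
    have h1 : α / (α - γ) ≤ q := (le_max_right _ _).trans hq
    rw [div_le_iff₀ (by linarith)] at h1
    have h2 : α / q ≤ α - γ := by
      rw [div_le_iff₀ hq0]
      linarith
    have h3 : α * (1 - 1 / q) = α - α / q := by ring
    linarith
  have hqnat : 2 ≤ q := by exact_mod_cast hq2
  obtain ⟨p, hp⟩ := exists_nat_ge (max 1 (q * α))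
  have hp1 : (1 : ℝ) ≤ p := (le_max_left _ _).trans hp
  have hp1' : 1 ≤ p := by exact_mod_cast hp1
  have hpα : q * α ≤ p := (le_max_right _ _).trans hp
  have hθ0 : (0 : ℝ) < ((L : ℝ) ^ p)⁻¹ := by positivity
  have hθ : ((L : ℝ) ^ p)⁻¹ ≤ 1 / 2 := by
    rw [one_div]
    gcongr
    calc (2 : ℝ) ≤ L := by exact_mod_cast hL
      _ = (L : ℝ) ^ 1 := (pow_one _).symm
      _ ≤ (L : ℝ) ^ p := pow_le_pow_right₀ hL1 hp1'
  obtain ⟨D, K₀, C, hC, hA⟩ := h _ hθ0 hθ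
  have hexp : 0 < 1 - 1 / (q : ℝ) := by
    have : 1 / (q : ℝ) ≤ 1 / 2 := by gcongr
    linarith
  have hlim : Filter.Tendsto (fun n : ℕ => ((n : ℝ) + 1) ^ (1 - 1 / (q : ℝ)) / L) Filter.atTop
      Filter.atTop :=
    ((tendsto_rpow_atTop hexp).comp
      (Filter.tendsto_atTop_add_const_right _ _ tendsto_natCast_atTop_atTop)).atTop_div_const hL0
  obtain ⟨n₀, hn₀⟩ := Filter.eventually_atTop.1
    (hlim.eventually_ge_atTop (2 * ((D : ℝ) + K₀ + 2)))
  have hpow : ∀ n : ℕ, (0 : ℝ) < ((n : ℝ) + 1) ^ (-γ) := fun n => by positivity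
  set C₁ : ℝ := C * ((2 * L) ^ α + (L : ℝ) ^ (2 * p)) with hC₁
  have hC₁0 : 0 ≤ C₁ := by positivity
  set C₂ : ℝ := e₀ * ((n₀ : ℝ) + 1) ^ γ with hC₂
  have hC₂0 : 0 < C₂ := by positivity
  refine ⟨C₁ + C₂, by positivity, fun n => ?_⟩
  rcases lt_or_ge n n₀ with hn | hn
  · refine hmono 0 n _ _ h₀ (Nat.zero_le n) ?_
    have h1 : (1 : ℝ) ≤ ((n₀ : ℝ) + 1) ^ γ * ((n : ℝ) + 1) ^ (-γ) := by
      rw [Real.rpow_neg (by positivity), ← div_eq_mul_inv, one_le_div (by positivity)]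
      gcongr
    calc e₀ ≤ e₀ * (((n₀ : ℝ) + 1) ^ γ * ((n : ℝ) + 1) ^ (-γ)) := le_mul_of_one_le_right he₀.le h1
      _ = C₂ * ((n : ℝ) + 1) ^ (-γ) := by rw [hC₂]; ring
      _ ≤ _ := mul_le_mul_of_nonneg_right (by linarith) (hpow n).le
  obtain ⟨x, hx⟩ : ∃ x : ℝ, x = (n : ℝ) + 1 := ⟨_, rfl⟩
  have hx1 : 1 ≤ x := by
    rw [hx]
    linarith [n.cast_nonneg (α := ℝ)]
  have hx0 : 0 < x := by linarith
  obtain ⟨J, hJ⟩ : ∃ J, J = Nat.log (L ^ q) (n + 1) := ⟨_, rfl⟩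
  have hLq : 1 < L ^ q := Nat.one_lt_pow (by omega) (by omega)
  have hJ1 : ((L : ℝ) ^ J) ^ q ≤ x := by
    rw [← pow_mul, mul_comm, pow_mul, hx]
    exact_mod_cast hJ ▸ Nat.pow_log_le_self (L ^ q) n.succ_ne_zero
  have hJ2 : x ≤ ((L : ℝ) ^ (J + 1)) ^ q := by
    rw [← pow_mul, mul_comm, pow_mul, hx]
    exact_mod_cast hJ ▸ (Nat.lt_pow_succ_log_self hLq (n + 1)).le
  have hJ1' : (L : ℝ) ^ J ≤ x ^ (1 / (q : ℝ)) := by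
    rw [one_div, Real.le_rpow_inv_iff_of_pos (by positivity) hx0.le hq0, Real.rpow_natCast]
    exact hJ1
  have hJ2' : x ^ (1 / (q : ℝ)) ≤ (L : ℝ) ^ (J + 1) := by
    rw [one_div, Real.rpow_inv_le_iff_of_pos hx0.le (by positivity) hq0, Real.rpow_natCast]
    exact hJ2
  obtain ⟨y, hy⟩ : ∃ y, y = n / L ^ (J + 1) := ⟨_, rfl⟩
  have hy1 : L ^ (J + 1) * y ≤ n := by
    rw [hy]
    exact Nat.mul_div_le _ _
  have hy2 : x ≤ (L : ℝ) ^ (J + 1) * ((y : ℝ) + 1) := by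
    rw [hx]
    have : n < L ^ (J + 1) * (y + 1) := by
      rw [hy]
      exact Nat.lt_mul_div_succ _ (by positivity)
    exact_mod_cast this
  have hy3 : x ^ (1 - 1 / (q : ℝ)) / L ≤ (y : ℝ) + 1 := by
    rw [Real.rpow_sub hx0, Real.rpow_one, div_div, div_le_iff₀ (by positivity)]
    calc x ≤ (L : ℝ) ^ (J + 1) * ((y : ℝ) + 1) := hy2
      _ = ((y : ℝ) + 1) * ((L : ℝ) ^ J * L) := by ring
      _ ≤ ((y : ℝ) + 1) * (x ^ (1 / (q : ℝ)) * L) := by gcongr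
  have hy4 : 2 * (D + K₀ + 2) ≤ y + 1 := by
    have := (hn₀ n hn).trans (hx ▸ hy3)
    exact_mod_cast this
  obtain ⟨K, hK⟩ : ∃ K, K = y - D - 1 := ⟨_, rfl⟩
  have hK1 : D + K + 1 = y := by omega
  have hK2 : (y : ℝ) + 1 ≤ 2 * ((K : ℝ) + 1) := by exact_mod_cast (by omega : y + 1 ≤ 2 * (K + 1))
  refine hmono _ n _ _ (hA K (by omega) J) (hK1.symm ▸ hy1) ?_
  rw [← hx]
  have e1 : ((K : ℝ) + 1) ^ (-α) ≤ (2 * L) ^ α * x ^ (-γ) := by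
    have h1 : x ^ (1 - 1 / (q : ℝ)) / (2 * L) ≤ (K : ℝ) + 1 := by
      rw [mul_comm, ← div_div]
      linarith
    calc ((K : ℝ) + 1) ^ (-α) ≤ (x ^ (1 - 1 / (q : ℝ)) / (2 * L)) ^ (-α) :=
          Real.rpow_le_rpow_of_nonpos (by positivity) h1 (by linarith)
      _ = (2 * L) ^ α * x ^ (-(α * (1 - 1 / q))) := by
          rw [Real.div_rpow (by positivity) (by positivity),
            Real.rpow_neg (by positivity : (0 : ℝ) ≤ 2 * L), div_inv_eq_mul,
            ← Real.rpow_mul hx0.le, mul_comm]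
          congr 2
          ring
      _ ≤ (2 * L) ^ α * x ^ (-γ) := by gcongr
  have e2 : (((L : ℝ) ^ p)⁻¹) ^ (2 * J) ≤ (L : ℝ) ^ (2 * p) * x ^ (-γ) := by
    have h1 : x ^ γ ≤ (L : ℝ) ^ (2 * p * (J + 1)) := by
      calc x ^ γ ≤ x ^ (1 / (q : ℝ) * (2 * p : ℕ)) := by
            refine Real.rpow_le_rpow_of_exponent_le hx1 ?_
            rw [one_div, inv_mul_eq_div, le_div_iff₀ hq0]
            push_cast
            nlinarith
        _ = (x ^ (1 / (q : ℝ))) ^ (2 * p) := by rw [Real.rpow_mul hx0.le, Real.rpow_natCast]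
        _ ≤ ((L : ℝ) ^ (J + 1)) ^ (2 * p) := by gcongr
        _ = _ := by rw [← pow_mul, mul_comm]
    rw [Real.rpow_neg hx0.le, ← div_eq_mul_inv, inv_pow, ← pow_mul, le_div_iff₀ (by positivity),
      inv_mul_le_iff₀ (by positivity), ← pow_add]
    exact h1.trans_eq (by ring)
  calc C * (((K : ℝ) + 1) ^ (-α) + (((L : ℝ) ^ p)⁻¹) ^ (2 * J))
      ≤ C * ((2 * L) ^ α * x ^ (-γ) + (L : ℝ) ^ (2 * p) * x ^ (-γ)) := by gcongr
    _ = C₁ * x ^ (-γ) := by rw [hC₁]; ring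
    _ ≤ _ := by
      have := hpow n
      rw [← hx] at this
      exact mul_le_mul_of_nonneg_right (by linarith) this.le

end LoopApprox

namespace LoopApprox

open Matrix

variable {N : ℕ}

lemma exists_jackson_approx_of_memLip {α : ℝ} (hα : 1 < α) {U : ℝ → Matrix (Fin N) (Fin N) ℂ}
    (hUper : Function.Periodic U (2 * π)) (hUlip : MemLip α U) :
    ∃ C : ℝ, 0 ≤ C ∧ ∀ K : ℕ, ∃ P, MTrigPoly K P ∧
      (∀ t i j, ‖(P t - U t) i j‖ ≤ C * ((K : ℝ) + 1) ^ (-α)) ∧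
      MWienerLE (C * ((K : ℝ) + 1) ^ (1 - α)) (fun t => P t - U t) := by
  obtain ⟨hUc, H₀, hH₀⟩ := hUlip
  obtain ⟨H, hH, hHU⟩ : ∃ H : ℝ, 0 ≤ H ∧ ∀ s t : ℝ,
      specNorm (iteratedDeriv (lipR α) U t - iteratedDeriv (lipR α) U s) ≤ H * |t - s| ^ lipβ α :=
    ⟨max H₀ 0, le_max_right _ _, fun s t => (hH₀ s t).trans
      (mul_le_mul_of_nonneg_right (le_max_left _ _) (Real.rpow_nonneg (abs_nonneg _) _))⟩
  have h1 : 1 < ⌈α⌉₊ := Nat.lt_ceil.2 (by simpa using hα)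
  obtain ⟨r, hr⟩ : ∃ r, lipR α = r + 1 := ⟨⌈α⌉₊ - 2, by rw [lipR]; omega⟩
  have hceil : ((r : ℝ) + 1 + 1) = ⌈α⌉₊ := by
    have : r + 1 + 1 = ⌈α⌉₊ := by rw [← hr, lipR]; omega
    exact_mod_cast this
  have hβe : lipβ α = α - (r + 1) := by
    rw [lipβ, hr]
    push_cast
    ring
  have hβ : 0 < lipβ α := by
    have := Nat.ceil_lt_add_one (by linarith : 0 ≤ α)
    linarith
  have hβ1 : lipβ α ≤ 1 := by
    have := Nat.le_ceil α
    linarith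
  have hent : ∀ i j, PeriodicHolder (lipβ α) H (r + 1) (fun t => U t i j) := fun i j => by
    rw [hr] at hUc hHU
    exact periodicHolder_entry i j (r + 1) hUc hUper hHU
  obtain ⟨C, hC, hCW⟩ := exists_wienerLE_of_lipschitz
  set B : ℝ := 2 * 1000 ^ (r + 2) * H with hB
  have hB0 : 0 ≤ B := by positivity
  refine ⟨(C + 1) * B, by positivity, fun K => ?_⟩
  choose p hp hp1 hp2 using fun i j => exists_jackson_approx hβ hβ1 hH (hent i j) K
  have hK0 : (0 : ℝ) < (K : ℝ) + 1 := by positivity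
  have hK1 : (1 : ℝ) ≤ (K : ℝ) + 1 := by linarith [K.cast_nonneg (α := ℝ)]
  have e1 : (-((r + 1 : ℕ) + lipβ α) : ℝ) = -α := by
    rw [hβe]
    push_cast
    ring
  have e2 : (-(r + lipβ α) : ℝ) = 1 - α := by
    rw [hβe]
    ring
  simp only [e1, e2] at hp1 hp2
  have hX : (0 : ℝ) ≤ ((K : ℝ) + 1) ^ (-α) := by positivity
  have hX' : (0 : ℝ) ≤ ((K : ℝ) + 1) ^ (1 - α) := by positivity
  have hXX : ((K : ℝ) + 1) ^ (-α) ≤ ((K : ℝ) + 1) ^ (1 - α) :=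
    Real.rpow_le_rpow_of_exponent_le hK1 (by linarith)
  have hsup : ∀ i j t, ‖p i j t - U t i j‖ ≤ B * ((K : ℝ) + 1) ^ (-α) := fun i j t =>
    (hp1 i j t).trans (mul_le_mul_of_nonneg_right
      (mul_le_mul_of_nonneg_right (by linarith [pow_pos (by norm_num : (0 : ℝ) < 1000) (r + 2)]) hH)
      hX)
  refine ⟨fun t => Matrix.of fun i j => p i j t, hp, fun t i j => ?_, fun i j => ?_⟩
  · refine (hsup i j t).trans (mul_le_mul_of_nonneg_right ?_ hX)
    nlinarith
  · refine (hCW (B * ((K : ℝ) + 1) ^ (1 - α)) (fun t => p i j t - U t i j) (fun t => ?_)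
      (fun t => (hsup i j t).trans (mul_le_mul_of_nonneg_left hXX hB0)) fun x y => ?_).mono ?_
    · have : p i j (t + 2 * π) = p i j t := by
        obtain ⟨c, hc⟩ := mem_trigPoly_iff.1 (hp i j)
        simp only [hc, chr_periodic _ t]
      simp only [this, hUper t]
    · refine (hp2 i j x y).trans (mul_le_mul_of_nonneg_right ?_ (abs_nonneg _))
      rw [hB, ← mul_assoc, ← mul_assoc]
      refine mul_le_mul_of_nonneg_right (mul_le_mul_of_nonneg_right ?_ hH) hX'
      gcongr <;> norm_num
    · nlinarith [mul_nonneg hB0 hX']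

lemma tendsto_natCast_add_one_rpow_neg {e : ℝ} (he : 0 < e) :
    Filter.Tendsto (fun K : ℕ => ((K : ℝ) + 1) ^ (-e)) Filter.atTop (nhds 0) :=
  (tendsto_rpow_neg_atTop he).comp
    (Filter.tendsto_atTop_add_const_right _ _ tendsto_natCast_atTop_atTop)

lemma eventually_mul_rpow_neg_le {e : ℝ} (he : 0 < e) (B : ℝ) {b : ℝ} (hb : 0 < b) :
    ∀ᶠ K : ℕ in Filter.atTop, B * ((K : ℝ) + 1) ^ (-e) ≤ b := by
  have := (tendsto_natCast_add_one_rpow_neg he).const_mul B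
  rw [mul_zero] at this
  exact (this.eventually_lt_const hb).mono fun _ h => h.le

/-- Pointwise defects of unitarity and of the determinant for an approximation of a loop in
`SU(N)`. -/
lemma exists_norm_perturbation_bound (N : ℕ) : ∃ c : ℝ, 1 ≤ c ∧
    ∀ (F P : Matrix (Fin N) (Fin N) ℂ) (μ : ℝ), 0 ≤ μ → F ∈ SpecialUnitary N →
    (∀ i j, ‖(P - F) i j‖ ≤ μ) → c * μ ≤ 1 →
    (∀ i j, ‖(Pᴴ * P - 1) i j‖ ≤ c * μ) ∧ ‖P.det - 1‖ ≤ c * μ := by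
  obtain ⟨c, hc1, hc⟩ := exists_perturbation_bound N zero_le_one
  refine ⟨c, hc1, fun F P μ hμ hF hP hcμ => ?_⟩
  obtain ⟨-, h2, h3⟩ := hc (fun _ => F) (fun _ => P) μ hμ (fun _ => hF)
    (MWienerLE.const F (specialUnitary_norm_le hF)) (MWienerLE.const _ hP) hcμ
  exact ⟨fun i j => (h2 i j).norm_le 0, h3.norm_le 0⟩

lemma norm_sub_apply_le {U V P : Matrix (Fin N) (Fin N) ℂ} {μ e : ℝ} (hV : V ∈ SpecialUnitary N)
    (hP : ∀ i j, ‖(P - U) i j‖ ≤ μ) (he : ∀ i j, ‖(Vᴴ * P - 1) i j‖ ≤ e) (i j : Fin N) :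
    ‖(U - V) i j‖ ≤ μ + N * e := by
  have h1 : U - V = V * (Vᴴ * P - 1) - (P - U) := by
    rw [mul_sub, ← mul_assoc, specialUnitary_mul_conjTranspose hV, one_mul, mul_one]
    abel
  rw [h1, Matrix.sub_apply, Matrix.mul_apply, add_comm]
  refine (norm_sub_le _ _).trans (add_le_add ?_ (hP i j))
  refine (norm_sum_le_of_le _ fun k _ => ?_).trans (by simp : ∑ _k : Fin N, e ≤ _)
  rw [norm_mul]
  have := mul_le_mul (specialUnitary_norm_le hV i k) (he k j) (norm_nonneg _) zero_le_one
  rwa [one_mul] at this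

lemma exists_approximation_scheme (hN : 2 ≤ N) {α : ℝ} (hα : 1 < α)
    {U : ℝ → Matrix (Fin N) (Fin N) ℂ} (hUper : Function.Periodic U (2 * π)) (hUlip : MemLip α U)
    (hUsu : ∀ t, U t ∈ SpecialUnitary N) (hlim : IsTrigLimit U) :
    ∃ L : ℕ, 2 ≤ L ∧ ∀ θ : ℝ, 0 < θ → θ ≤ 1 / 2 → ∃ (D K₀ : ℕ) (C : ℝ), 0 ≤ C ∧
      ∀ K, K₀ ≤ K → ∀ J : ℕ, ∃ V : ℝ → Matrix (Fin N) (Fin N) ℂ,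
        IsTrigLoop (L ^ (J + 1) * (D + K + 1)) V ∧
        ∀ t i j, ‖(U t - V t) i j‖ ≤ C * (((K : ℝ) + 1) ^ (-α) + θ ^ (2 * J)) := by
  obtain ⟨C₁, hC₁, happrox⟩ := exists_jackson_approx_of_memLip hα hUper hUlip
  obtain ⟨c, hc1, hc⟩ := exists_norm_perturbation_bound N
  obtain ⟨M, hM1, hM⟩ := newton_iterate hN
  have hMr : (1 : ℝ) ≤ M := by exact_mod_cast hM1
  have hNr : (2 : ℝ) ≤ N := by exact_mod_cast hN
  have hc0 : 0 ≤ c := by linarith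
  refine ⟨M + 1, by omega, fun θ hθ0 hθ => ?_⟩
  obtain ⟨δ, hδ⟩ : ∃ δ : ℝ, δ = θ / (4 * M) := ⟨_, rfl⟩
  have hδ0 : 0 < δ := by
    rw [hδ]
    positivity
  have hMδ : M * δ = θ / 4 := by
    rw [hδ]
    field_simp
  have hδ1 : 2 * δ ≤ 1 := by nlinarith
  obtain ⟨D, V₀, hV₀, hV₀U⟩ := hlim δ hδ0
  obtain ⟨w, hw, hV₀w⟩ := hV₀.2.exists_mWienerLE
  set B : ℝ := 2 * N * (c * C₁) ^ 2 with hB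
  have hB0 : 0 ≤ B := by positivity
  obtain ⟨K₀, hK₀⟩ := Filter.eventually_atTop.1
    ((eventually_mul_rpow_neg_le (by linarith : 0 < α) (c * C₁) one_pos).and
    ((eventually_mul_rpow_neg_le (by linarith : 0 < α - 1) (N * (w * C₁)) hδ0).and
    (eventually_mul_rpow_neg_le (by linarith : 0 < α) B (by positivity : 0 < δ ^ 2))))
  refine ⟨D, K₀, C₁ + N * (2 * M + 8 * M * B + c * C₁), by positivity, fun K hK J => ?_⟩
  obtain ⟨h1, h2, h3⟩ := hK₀ K hK
  obtain ⟨P, hP, hPU, hPW⟩ := happrox K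
  obtain ⟨X, hX⟩ : ∃ X : ℝ, X = ((K : ℝ) + 1) ^ (-α) := ⟨_, rfl⟩
  have hX0 : 0 ≤ X := by
    rw [hX]
    positivity
  rw [← hX] at h1 h3 hPU ⊢
  rw [neg_sub] at h2
  have hμ : 0 ≤ C₁ * X := by positivity
  have hcμ : c * (C₁ * X) ≤ 1 := by linarith
  have hdef : ∀ t, (∀ i j, ‖((P t)ᴴ * P t - 1) i j‖ ≤ c * (C₁ * X)) ∧
      ‖(P t).det - 1‖ ≤ c * (C₁ * X) := fun t =>
    hc (U t) (P t) _ hμ (hUsu t) (hPU t) hcμ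
  obtain ⟨η, hη⟩ : ∃ η : ℝ, η = √(2 * (N * K : ℕ) + 1) * (c * (C₁ * X)) := ⟨_, rfl⟩
  have hη0 : 0 ≤ η := by
    rw [hη]
    positivity
  have hη2 : η ^ 2 ≤ B * X := by
    have hK1 : (1 : ℝ) ≤ (K : ℝ) + 1 := by linarith [K.cast_nonneg (α := ℝ)]
    have hXX : ((K : ℝ) + 1) * X ≤ 1 := by
      calc ((K : ℝ) + 1) * X = ((K : ℝ) + 1) ^ (1 + -α) := by
            rw [Real.rpow_add (by positivity), Real.rpow_one, hX]
        _ ≤ 1 := Real.rpow_le_one_of_one_le_of_nonpos hK1 (by linarith)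
    rw [hη, mul_pow, Real.sq_sqrt (by positivity)]
    push_cast
    calc (2 * (N * K) + 1 : ℝ) * (c * (C₁ * X)) ^ 2
        ≤ (2 * N * (K + 1)) * (c * (C₁ * X)) ^ 2 := by
          gcongr
          linarith
      _ = B * X * ((K + 1) * X) := by rw [hB]; ring
      _ ≤ B * X := mul_le_of_le_one_right (by positivity) hXX
  have hηδ : η ≤ δ := by
    refine le_of_sq_le_sq ?_ hδ0.le
    linarith
  have hW1 : MWienerLE η (fun t => (P t)ᴴ * P t - 1) := fun i j => by
    rw [hη]
    refine wienerLE_of_norm_le (trigPoly_mono (D := K + K) (by nlinarith)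
      (((hP.conjTranspose.mul hP).sub (MTrigPoly.const _ 1)) i j)) fun t => (hdef t).1 i j
  have hW2 : WienerLE η (fun t => (P t).det - 1) := by
    rw [hη]
    exact wienerLE_of_norm_le (sub_mem hP.det (const_mem_trigPoly _ 1)) fun t => (hdef t).2
  have hW3 : MWienerLE (2 * δ) (fun t => (V₀ t)ᴴ * P t - 1) := by
    have := (hV₀U.add (hV₀w.conjTranspose.mul hPW)).mono (ε := 2 * δ) (by linarith)
    refine this.congr fun t => ?_
    rw [mul_sub]
    abel
  obtain ⟨D', V, hV, hD', hVP⟩ := (hM D K V₀ P (2 * δ) η θ hV₀ hP hW3 hW1 hW2 hθ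
    (by nlinarith) J).2 (c * (C₁ * X)) (fun t => (hdef t).1) fun t => (hdef t).2
  refine ⟨V, hV.mono (by omega), fun t i j => ?_⟩
  refine (norm_sub_apply_le (hV.1 t) (hPU t) (hVP t) i j).trans ?_
  obtain ⟨T, hT⟩ : ∃ T : ℝ, T = θ ^ J := ⟨_, rfl⟩
  have hT0 : 0 ≤ T := by
    rw [hT]
    positivity
  have hTT : θ ^ (2 * J) = T ^ 2 := by rw [hT, mul_comm, pow_mul]
  rw [← hT, hTT]
  have h4 : (T * (2 * δ) + 2 * η) ^ 2 ≤ 2 * T ^ 2 + 8 * (B * X) := by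
    have h5 : (T * (2 * δ)) ^ 2 ≤ T ^ 2 :=
      pow_le_pow_left₀ (by positivity) (mul_le_of_le_one_right hT0 hδ1) 2
    nlinarith [sq_nonneg (T * (2 * δ) - 2 * η)]
  calc C₁ * X + N * (M * (T * (2 * δ) + 2 * η) ^ 2 + c * (C₁ * X))
      ≤ C₁ * X + N * (M * (2 * T ^ 2 + 8 * (B * X)) + c * (C₁ * X)) := by gcongr
    _ = (C₁ + N * (8 * M * B + c * C₁)) * X + N * (2 * M) * T ^ 2 := by ring
    _ ≤ (C₁ + N * (2 * M + 8 * M * B + c * C₁)) * X +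
        (C₁ + N * (2 * M + 8 * M * B + c * C₁)) * T ^ 2 := by
        gcongr ?_ * X + ?_ * T ^ 2
        · gcongr
          have : (0 : ℝ) ≤ 2 * M := by positivity
          linarith
        · have : 0 ≤ N * (8 * M * B + c * C₁) := by positivity
          linarith
    _ = _ := by ring

/-- Every rate below the smoothness exponent is attained by polynomial loops in `SU(N)`. -/
theorem exists_polyLoop_rate (hN : 2 ≤ N) {α γ : ℝ} (hα : 1 < α) (hγ : 0 < γ) (hγα : γ < α)
    {U : ℝ → Matrix (Fin N) (Fin N) ℂ} (hUper : Function.Periodic U (2 * π)) (hUlip : MemLip α U)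
    (hUsu : ∀ t, U t ∈ SpecialUnitary N) :
    ∃ C : ℝ, 0 < C ∧ ∀ n : ℕ, ∃ V, IsPolyLoop n (SpecialUnitary N) V ∧
      unifNorm (fun t => U t - V t) ≤ C * ((n : ℝ) + 1) ^ (-γ) := by
  have hr : 1 ≤ lipR α := by
    have : 1 < ⌈α⌉₊ := Nat.lt_ceil.2 (by simpa using hα)
    rw [lipR]
    omega
  have hU1 : ContDiff ℝ 1 U := hUlip.1.of_le (by exact_mod_cast hr)
  have hU : IsSmoothLoop U := ⟨hUsu, hUper, contDiff_entry hU1⟩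
  obtain ⟨L, hL, hLU⟩ := exists_approximation_scheme hN hα hUper hUlip hUsu (hU.isTrigLimit hN)
  obtain ⟨C, hC, h⟩ := exists_rate_of_scheme
    (A := fun D e => ∃ V : ℝ → Matrix (Fin N) (Fin N) ℂ, IsTrigLoop D V ∧
      ∀ t i j, ‖(U t - V t) i j‖ ≤ e) hL hγ hγα
    (fun D D' e e' ⟨V, hV, hVe⟩ hD he =>
      ⟨V, hV.mono hD, fun t i j => (hVe t i j).trans he⟩) two_pos
    ⟨_, isTrigLoop_one 0, fun t i j => by
      have h1 := specialUnitary_norm_le (hUsu t) i j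
      have h2 := specialUnitary_norm_le (specialUnitary_one (N := N)) i j
      refine (norm_sub_le (U t i j) _).trans ?_
      linarith⟩ hLU
  refine ⟨(N : ℝ) ^ 2 * C, by positivity, fun n => ?_⟩
  obtain ⟨V, hV, hVe⟩ := h n
  refine ⟨V, hV.isPolyLoop, ?_⟩
  rw [mul_assoc]
  exact unifNorm_le (by positivity) hVe

end LoopApprox

/-- For `N ≥ 2`, `α > 1` and an integer `s ≥ 1`, every `Lip_α`
loop `U : 𝕋 → SU(N)` admits polynomial `SU(N)`-loop approximants of degree `≤ n`
with error `≤ C (n+1)^{-2sα/(α+2s)}`. -/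
theorem sun_loop_approximation_splitting_rate (N : ℕ) (hN : 2 ≤ N) (α : ℝ) (hα : 1 < α)
    (s : ℕ) (hs : 1 ≤ s)
    (U : ℝ → Matrix (Fin N) (Fin N) ℂ)
    (hUper : Function.Periodic U (2 * π))
    (hUlip : MemLip α U)
    (hUsu : ∀ t : ℝ, U t ∈ SpecialUnitary N) :
    ∃ C : ℝ, 0 < C ∧ ∃ Us : ℕ → ℝ → Matrix (Fin N) (Fin N) ℂ,
      ∀ n : ℕ, IsPolyLoop n (SpecialUnitary N) (Us n) ∧
        unifNorm (fun t => U t - Us n t) ≤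
          C * ((n : ℝ) + 1) ^ (-(2 * (s : ℝ) * α / (α + 2 * (s : ℝ)))) := by
  have hs0 : (0 : ℝ) < s := by exact_mod_cast hs
  have hα0 : 0 < α := by linarith
  have hγα : 2 * (s : ℝ) * α / (α + 2 * (s : ℝ)) < α := by
    rw [div_lt_iff₀ (by positivity)]
    nlinarith
  obtain ⟨C, hC, h⟩ :=
    LoopApprox.exists_polyLoop_rate hN hα (by positivity) hγα hUper hUlip hUsu
  choose Us hUs using h
  exact ⟨C, hC, Us, hUs⟩
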